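/- There exists a unique probability measure ν concentrated on LO_0 such that Q_t ν = ν for all t ≥ 0, where Q_t π denotes the pushforward under θ = θ_0 of the measure ∫ P_t(ω, ·) dπ(ω) (the law at time t of the East process seen from the front started from π). Moreover, for every probability measure π concentrated on LO_0, Q_t π converges weakly to ν as t → ∞. (Ergodicity of the process seen from the front.) -/

import Mathlib

open MeasureTheory ProbabilityTheory Filter Topology

noncomputable section

/-- The configuration space of the East model on `ℤ`: `0` ↔ `false` (empty), `1` ↔ `true`. -/
abbrev Config : Type := ℤ → Bool

/-- The configuration `ω` flipped at site `x`. -/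
def flipAt (ω : Config) (x : ℤ) : Config := fun y => if y = x then !ω x else ω y

/-- `f` depends only on the coordinates in `S`. -/
def DependsOnF (f : Config → ℝ) (S : Set ℤ) : Prop :=
  ∀ ω ω' : Config, (∀ x ∈ S, ω x = ω' x) → f ω = f ω'

/-- The set `A` depends only on the coordinates in `S`. -/
def DependsOnSet (A : Set Config) (S : Set ℤ) : Prop :=
  ∀ ω ω' : Config, (∀ x ∈ S, ω x = ω' x) → (ω ∈ A ↔ ω' ∈ A)

/-- A cylinder (local) function: depends on finitely many coordinates. -/
def IsCylinder (f : Config → ℝ) : Prop := ∃ S : Finset ℤ, DependsOnF f ↑S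

/-- The East generator at density `p` of ones. -/
def eastGen (p : ℝ) (f : Config → ℝ) (ω : Config) : ℝ :=
  ∑' x : ℤ, (if ω (x + 1) = false then (1 : ℝ) else 0) *
    (if ω x = false then p else 1 - p) * (f (flipAt ω x) - f ω)

/-- Spatial translation: `(shift y ω) x = ω (x + y)`. -/
def shift (y : ℤ) (ω : Config) : Config := fun x => ω (x + y)

/-- Left-occupied configurations: identically `1` on a left half-line, with an empty site. -/
def LO : Set Config := {ω | (∃ y : ℤ, ∀ x < y, ω x = true) ∧ ∃ x, ω x = false}

/-- The front: position of the left-most zero. -/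
def front (ω : Config) : ℤ := sInf {x : ℤ | ω x = false}

/-- Left-occupied configurations with front at the origin. -/
def LO₀ : Set Config := {ω ∈ LO | front ω = 0}

/-- The configuration seen at distance `L` behind the front. -/
def θL (L : ℤ) (ω : Config) : Config := fun x =>
  if x < 0 then true else if x = 0 then false else ω (front ω + L + x)

/-- `f` averaged over the coordinate at site `1` w.r.t. Bernoulli(p). -/
def avg1 (p : ℝ) (f : Config → ℝ) (ω : Config) : ℝ :=
  p * f (Function.update ω 1 true) + (1 - p) * f (Function.update ω 1 false)

/-- The East process on `ℤ` at density `p`, together with its equilibrium measure. -/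
structure EastProcess where
  /-- equilibrium density of ones -/
  p : ℝ
  hp0 : 0 < p
  hp1 : p < 1
  /-- the Markov semigroup -/
  P : ℝ → Kernel Config Config
  markov : ∀ t : ℝ, IsMarkovKernel (P t)
  P0 : P 0 = Kernel.id
  semigroup : ∀ s t : ℝ, 0 ≤ s → 0 ≤ t → P (t + s) = (P s).comp (P t)
  feller : ∀ t : ℝ, 0 ≤ t → ∀ f : Config → ℝ, Continuous f →
    Continuous fun ω : Config => ∫ η, f η ∂(P t ω)
  timeCont : ∀ f : Config → ℝ, Continuous f → ∀ ω : Config,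
    Continuous fun t : ℝ => ∫ η, f η ∂(P t ω)
  shiftComm : ∀ t : ℝ, 0 ≤ t → ∀ y : ℤ, ∀ ω : Config,
    P t (shift y ω) = Measure.map (shift y) (P t ω)
  generator : ∀ f : Config → ℝ, IsCylinder f → ∀ ω : Config,
    HasDerivWithinAt (fun u : ℝ => ∫ η, f η ∂(P u ω)) (eastGen p f ω) (Set.Ici 0) 0
  /-- the product Bernoulli(p) measure -/
  μ : Measure Config
  μprob : IsProbabilityMeasure μ
  μprod : ∀ (S : Finset ℤ) (σ : ℤ → Bool),
    μ {ω : Config | ∀ x ∈ S, ω x = σ x} = ∏ x ∈ S, ENNReal.ofReal (if σ x then p else 1 - p)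
  /-- LO is stable for the dynamics -/
  loStable : ∀ t : ℝ, 0 ≤ t → ∀ ω ∈ LO, P t ω LO = 1

/-- The set of Rayleigh quotients defining the spectral gap. -/
def gapSet (E : EastProcess) : Set ℝ :=
  {r | ∃ f : Config → ℝ, IsCylinder f ∧ 0 < variance f E.μ ∧
    r = (-∫ ω, f ω * eastGen E.p f ω ∂E.μ) / variance f E.μ}

/-- The spectral gap of the East process. -/
def gap (E : EastProcess) : ℝ := sInf (gapSet E)

/-- The product measure `μ̃`: all ones on the negative half-line, a zero at the origin,
Bernoulli(p) on the positive half-line. -/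
def IsMuTilde (p : ℝ) (μt : Measure Config) : Prop :=
  IsProbabilityMeasure μt ∧
  ∀ (S : Finset ℤ) (σ : ℤ → Bool),
    μt {ω : Config | ∀ x ∈ S, ω x = σ x} =
      ∏ x ∈ S, ENNReal.ofReal
        (if x < 0 then (if σ x then 1 else 0)
         else if x = 0 then (if σ x then 0 else 1)
         else (if σ x then p else 1 - p))

/-- The law at time `t` of the process seen from the front started from `π`. -/
def Qt (E : EastProcess) (t : ℝ) (π : Measure Config) : Measure Config :=
  Measure.map (θL 0) (π.bind fun ω => E.P t ω)


/-- Continuous observables. -/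
abbrev CC : Type := C(Config, ℝ)

/-! ### Maximum principle -/

theorem max_principle {ι : Type*} (φ φ' : ι → ℝ → ℝ) (R T B B0 : ℝ) (hR : 0 ≤ R)
    (hd : ∀ i, ∀ t ∈ Set.Icc (0 : ℝ) T, HasDerivAt (φ i) (φ' i t) t)
    (hB : ∀ i, ∀ t ∈ Set.Icc (0 : ℝ) T, φ i t ≤ B)
    (h0 : ∀ i, φ i 0 ≤ B0)
    (hm : ∀ S, B0 ≤ S → ∀ t ∈ Set.Icc (0 : ℝ) T, (∀ j, φ j t ≤ S) →
      ∀ i, φ' i t ≤ R * (S - φ i t)) :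
    ∀ i, ∀ t ∈ Set.Icc (0 : ℝ) T, φ i t ≤ B0 := by
  intro i0 t0 ht0
  have hT : 0 ≤ T := ht0.1.trans ht0.2
  have step : ∀ e : ℝ, 0 ≤ e → (∀ i, ∀ t ∈ Set.Icc (0 : ℝ) T, φ i t ≤ B0 + e) →
      ∀ i, ∀ t ∈ Set.Icc (0 : ℝ) T, φ i t ≤ B0 + (1 - Real.exp (-(R * T))) * e := by
    intro e he hE i t ht
    have hanti : AntitoneOn (fun s => Real.exp (R * s) * (φ i s - (B0 + e))) (Set.Icc 0 T) := by
      have hder : ∀ s ∈ Set.Icc (0 : ℝ) T,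
          HasDerivAt (fun s => Real.exp (R * s) * (φ i s - (B0 + e)))
          (Real.exp (R * s) * R * (φ i s - (B0 + e)) + Real.exp (R * s) * φ' i s) s := by
        intro s hs
        have h1 : HasDerivAt (fun s : ℝ => Real.exp (R * s)) (Real.exp (R * s) * R) s := by
          have := ((hasDerivAt_id s).const_mul R).exp
          simpa using this
        exact h1.mul ((hd i s hs).sub_const _)
      apply antitoneOn_of_deriv_nonpos (convex_Icc 0 T)
      · intro s hs
        exact (hder s hs).continuousAt.continuousWithinAt
      · intro s hs
        rw [interior_Icc] at hs
        exact (hder s (Set.Ioo_subset_Icc_self hs)).differentiableAt.differentiableWithinAt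
      · intro s hs
        rw [interior_Icc] at hs
        have hs' := Set.Ioo_subset_Icc_self hs
        rw [(hder s hs').deriv]
        have h2 := hm (B0 + e) (by linarith) s hs' (fun j => hE j s hs') i
        have h3 := Real.exp_pos (R * s)
        nlinarith
    have h := hanti (⟨le_refl _, hT⟩ : (0 : ℝ) ∈ Set.Icc 0 T) ht ht.1
    simp only [mul_zero, Real.exp_zero, one_mul] at h
    have h1 : φ i 0 - (B0 + e) ≤ -e := by linarith [h0 i]
    have h2 : Real.exp (R * t) * (φ i t - (B0 + e)) ≤ -e := h.trans h1
    have h3 : φ i t - (B0 + e) ≤ -(Real.exp (-(R * t)) * e) := by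
      have h4 : Real.exp (-(R * t)) * (Real.exp (R * t) * (φ i t - (B0 + e)))
          ≤ Real.exp (-(R * t)) * (-e) :=
        mul_le_mul_of_nonneg_left h2 (Real.exp_pos _).le
      rw [← mul_assoc, ← Real.exp_add] at h4
      simpa using h4
    have h5 : Real.exp (-(R * T)) ≤ Real.exp (-(R * t)) := by
      apply Real.exp_le_exp.mpr
      have := mul_le_mul_of_nonneg_left ht.2 hR
      linarith
    nlinarith
  set ρ := 1 - Real.exp (-(R * T)) with hρ
  have hρ0 : 0 ≤ ρ := by
    have : Real.exp (-(R * T)) ≤ 1 := Real.exp_le_one_iff.mpr (by have := mul_nonneg hR hT; linarith)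
    linarith
  have hρ1 : ρ < 1 := by linarith [Real.exp_pos (-(R * T))]
  set e0 := max (B - B0) 0 with he0
  have all : ∀ k : ℕ, ∀ i, ∀ t ∈ Set.Icc (0 : ℝ) T, φ i t ≤ B0 + ρ ^ k * e0 := by
    intro k
    induction k with
    | zero =>
      intro i t ht
      have := hB i t ht
      have h2 : B - B0 ≤ e0 := le_max_left _ _
      simp only [pow_zero, one_mul]
      linarith
    | succ k ih =>
      intro i t ht
      have := step (ρ ^ k * e0) (mul_nonneg (pow_nonneg hρ0 k) (le_max_right _ _)) ih i t ht
      rw [pow_succ]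
      calc φ i t ≤ B0 + ρ * (ρ ^ k * e0) := this
        _ = _ := by ring
  have lim : Tendsto (fun k : ℕ => B0 + ρ ^ k * e0) atTop (𝓝 (B0 + 0 * e0)) :=
    ((tendsto_pow_atTop_nhds_zero_of_lt_one hρ0 hρ1).mul_const e0).const_add B0
  have := ge_of_tendsto' lim (fun k => all k i0 t0 ht0)
  simpa using this

/-! ### Exponentials of bounded operators -/

section ExpT
variable {E : Type*} [NormedAddCommGroup E] [NormedSpace ℝ E] [CompleteSpace E]

/-- The semigroup generated by a bounded operator. -/
def expT (A : E →L[ℝ] E) (t : ℝ) : E →L[ℝ] E := NormedSpace.exp (t • A)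

theorem expT_zero (A : E →L[ℝ] E) : expT A 0 = 1 := by
  simp [expT]

theorem expT_add (A : E →L[ℝ] E) (s t : ℝ) (f : E) :
    expT A (s + t) f = expT A s (expT A t f) := by
  unfold expT
  let : NormedAlgebra ℚ (E →L[ℝ] E) := NormedAlgebra.restrictScalars ℚ ℝ (E →L[ℝ] E)
  rw [add_smul, NormedSpace.exp_add_of_commute (((Commute.refl A).smul_left s).smul_right t)]
  rfl

theorem expT_hasDerivAt (A : E →L[ℝ] E) (f : E) (t : ℝ) :
    HasDerivAt (fun t => expT A t f) (A (expT A t f)) t := by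
  have h := hasDerivAt_exp_smul_const' (𝕂 := ℝ) A t
  have h2 := (ContinuousLinearMap.apply ℝ E f).hasFDerivAt.comp_hasDerivAt t h
  exact h2

theorem expT_mem {A : E →L[ℝ] E} {W : Submodule ℝ E} (hW : IsClosed (W : Set E))
    (hA : ∀ f ∈ W, A f ∈ W) (t : ℝ) {f : E} (hf : f ∈ W) : expT A t f ∈ W := by
  have hs : HasSum (fun n : ℕ => ((n.factorial : ℝ)⁻¹ • (t • A) ^ n) f) (expT A t f) := by
    have h := NormedSpace.exp_series_hasSum_exp' (𝕂 := ℝ) (t • A)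
    have h2 := (ContinuousLinearMap.apply ℝ E f).hasSum h
    exact h2
  have hpow : ∀ n : ℕ, ((t • A) ^ n) f ∈ W := by
    intro n
    induction n with
    | zero => simpa using hf
    | succ n ih =>
      rw [pow_succ']
      exact W.smul_mem t (hA _ ih)
  refine hW.mem_of_tendsto hs (Eventually.of_forall fun s => ?_)
  exact W.sum_mem fun n _ => W.smul_mem _ (hpow n)

end ExpT

/-! ### Elementary operators -/

/-- Set the value at `x` to `v`. -/
def setC (x : ℤ) (v : Bool) : C(Config, Config) :=
  ⟨fun ω => Function.update ω x v, continuous_id.update x continuous_const⟩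

/-- Facilitation indicator. -/
def kk (x : ℤ) : CC :=
  ⟨fun ω => if ω (x + 1) = false then 1 else 0,
    (continuous_of_discreteTopology (f := fun b : Bool => if b = false then (1 : ℝ) else 0)).comp
      (continuous_apply (x + 1))⟩

/-- Precomposition as a bounded operator. -/
def pull (φ : C(Config, Config)) : CC →L[ℝ] CC :=
  LinearMap.mkContinuous
    { toFun := fun f => f.comp φ
      map_add' := fun _ _ => rfl
      map_smul' := fun _ _ => rfl } 1 (by
      intro f
      rw [one_mul]
      exact (ContinuousMap.norm_le _ (norm_nonneg f)).mpr (fun x => f.norm_coe_le_norm (φ x)))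

theorem pull_apply (φ : C(Config, Config)) (f : CC) (ω : Config) : pull φ f ω = f (φ ω) := rfl

/-- Heat bath average at `x`. -/
def AA (p : ℝ) (x : ℤ) : CC →L[ℝ] CC :=
  p • pull (setC x true) + (1 - p) • pull (setC x false)

theorem AA_apply (p : ℝ) (x : ℤ) (f : CC) (ω : Config) :
    AA p x f ω = p * f (Function.update ω x true) + (1 - p) * f (Function.update ω x false) := rfl

/-- East generator restricted to flips in `S`. -/
def gen (p : ℝ) (S : Finset ℤ) : CC →L[ℝ] CC :=
  ∑ x ∈ S, (ContinuousLinearMap.mul ℝ CC (kk x)).comp (AA p x - ContinuousLinearMap.id ℝ CC)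

theorem gen_apply (p : ℝ) (S : Finset ℤ) (f : CC) (ω : Config) :
    gen p S f ω = ∑ x ∈ S, kk x ω * (AA p x f ω - f ω) := by
  simp only [gen, sum_apply, ContinuousMap.sum_apply]
  rfl

theorem kk_apply (x : ℤ) (ω : Config) : kk x ω = if ω (x + 1) = false then 1 else 0 := rfl

theorem kk_nonneg (x : ℤ) (ω : Config) : 0 ≤ kk x ω := by
  rw [kk_apply]; split_ifs <;> norm_num

theorem kk_le_one (x : ℤ) (ω : Config) : kk x ω ≤ 1 := by
  rw [kk_apply]; split_ifs <;> norm_num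

/-- Finite volume semigroup. -/
def TT (p : ℝ) (S : Finset ℤ) (t : ℝ) : CC →L[ℝ] CC := expT (gen p S) t

theorem TT_zero (p : ℝ) (S : Finset ℤ) : TT p S 0 = 1 := expT_zero _

theorem TT_add (p : ℝ) (S : Finset ℤ) (s t : ℝ) (f : CC) :
    TT p S (s + t) f = TT p S s (TT p S t f) := expT_add _ s t f

theorem TT_hasDerivAt (p : ℝ) (S : Finset ℤ) (f : CC) (t : ℝ) :
    HasDerivAt (fun t => TT p S t f) (gen p S (TT p S t f)) t := expT_hasDerivAt _ f t

/-- evaluation functional -/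
def evC (ω : Config) : CC →L[ℝ] ℝ := ContinuousMap.evalCLM ℝ ω

theorem evC_apply (ω : Config) (f : CC) : evC ω f = f ω := rfl

theorem hasDerivAt_eval {u : ℝ → CC} {u' : CC} {t : ℝ} (h : HasDerivAt u u' t) (ω : Config) :
    HasDerivAt (fun s => u s ω) (u' ω) t :=
  (evC ω).hasFDerivAt.comp_hasDerivAt t h

theorem hasDerivAt_clm {u : ℝ → CC} {u' : CC} {t : ℝ} (h : HasDerivAt u u' t)
    (A : CC →L[ℝ] CC) : HasDerivAt (fun s => A (u s)) (A u') t :=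
  A.hasFDerivAt.comp_hasDerivAt t h

theorem le_norm_C (f : CC) (ω : Config) : f ω ≤ ‖f‖ :=
  (le_abs_self _).trans (f.norm_coe_le_norm ω)

theorem norm_bound_Icc {u : ℝ → CC} (hu : Continuous u) (T : ℝ) :
    ∃ B, ∀ t ∈ Set.Icc (0 : ℝ) T, ‖u t‖ ≤ B := by
  obtain ⟨B, hB⟩ := (isCompact_Icc (a := (0 : ℝ)) (b := T)).exists_bound_of_continuousOn hu.continuousOn
  exact ⟨B, hB⟩

theorem TT_cont (p : ℝ) (S : Finset ℤ) (f : CC) : Continuous fun t => TT p S t f :=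
  continuous_iff_continuousAt.mpr fun t => (TT_hasDerivAt p S f t).continuousAt

/-- heat bath averages of functions bounded above -/
theorem AA_le {p : ℝ} (hp0 : 0 ≤ p) (hp1 : p ≤ 1) (x : ℤ) (f : CC) (S : ℝ) (ω : Config)
    (h : ∀ ω, f ω ≤ S) : AA p x f ω ≤ S := by
  rw [AA_apply]
  nlinarith [h (Function.update ω x true), h (Function.update ω x false)]

theorem gen_le {p : ℝ} (hp0 : 0 ≤ p) (hp1 : p ≤ 1) (V : Finset ℤ) (f : CC) (S : ℝ)
    (h : ∀ ω, f ω ≤ S) (ω : Config) : gen p V f ω ≤ V.card * (S - f ω) := by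
  rw [gen_apply, ← nsmul_eq_mul]
  apply Finset.sum_le_card_nsmul
  intro x _
  have h1 := AA_le hp0 hp1 x f S ω h
  nlinarith [kk_nonneg x ω, kk_le_one x ω, h ω]

/-- Upper bound preserved by the finite volume semigroup. -/
theorem TT_le {p : ℝ} (hp0 : 0 ≤ p) (hp1 : p ≤ 1) (V : Finset ℤ) (f : CC) (S : ℝ)
    (h : ∀ ω, f ω ≤ S) {t : ℝ} (ht : 0 ≤ t) (ω : Config) : TT p V t f ω ≤ S := by
  obtain ⟨B, hB⟩ := norm_bound_Icc (TT_cont p V f) t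
  exact max_principle (fun ω t => TT p V t f ω) (fun ω t => gen p V (TT p V t f) ω)
    V.card t B S (by positivity) (fun i s _ => hasDerivAt_eval (TT_hasDerivAt p V f s) i)
    (fun i s hs => (le_norm_C _ i).trans (hB s hs))
    (fun i => by simpa [TT_zero] using h i)
    (fun S _ s _ hS i => gen_le hp0 hp1 V _ S hS i) ω t ⟨ht, le_refl _⟩

theorem TT_ge {p : ℝ} (hp0 : 0 ≤ p) (hp1 : p ≤ 1) (V : Finset ℤ) (f : CC) (S : ℝ)
    (h : ∀ ω, S ≤ f ω) {t : ℝ} (ht : 0 ≤ t) (ω : Config) : S ≤ TT p V t f ω := by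
  have := TT_le hp0 hp1 V (-f) (-S) (fun ω => neg_le_neg (h ω)) ht ω
  rw [map_neg] at this
  exact neg_le_neg_iff.mp this

theorem TT_mono {p : ℝ} (hp0 : 0 ≤ p) (hp1 : p ≤ 1) (V : Finset ℤ) (f g : CC)
    (h : ∀ ω, f ω ≤ g ω) {t : ℝ} (ht : 0 ≤ t) (ω : Config) : TT p V t f ω ≤ TT p V t g ω := by
  have := TT_ge hp0 hp1 V (g - f) 0 (fun ω => sub_nonneg.mpr (h ω)) ht ω
  rw [map_sub] at this
  exact sub_nonneg.mp this

theorem TT_abs {p : ℝ} (hp0 : 0 ≤ p) (hp1 : p ≤ 1) (V : Finset ℤ) (f : CC) (S : ℝ)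
    (h : ∀ ω, |f ω| ≤ S) {t : ℝ} (ht : 0 ≤ t) (ω : Config) : |TT p V t f ω| ≤ S :=
  abs_le.mpr ⟨TT_ge hp0 hp1 V f (-S) (fun ω => (abs_le.mp (h ω)).1) ht ω,
    TT_le hp0 hp1 V f S (fun ω => (abs_le.mp (h ω)).2) ht ω⟩

/-! ### Dependence -/

/-- Closed submodule of functions depending on `S`. -/
def depSub (S : Set ℤ) : Submodule ℝ CC where
  carrier := {f | DependsOnF f S}
  add_mem' := by
    intro f g hf hg ω ω' h
    simp [hf ω ω' h, hg ω ω' h]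
  zero_mem' := by
    intro ω ω' _
    rfl
  smul_mem' := by
    intro c f hf ω ω' h
    simp [hf ω ω' h]

theorem mem_depSub {S : Set ℤ} {f : CC} : f ∈ depSub S ↔ DependsOnF f S := Iff.rfl

theorem depSub_closed (S : Set ℤ) : IsClosed (depSub S : Set CC) := by
  have : (depSub S : Set CC) = ⋂ (ω : Config) (ω' : Config) (_ : ∀ x ∈ S, ω x = ω' x),
      {f : CC | f ω = f ω'} := by
    ext f
    simp [depSub, DependsOnF]
  rw [this]
  refine isClosed_iInter fun ω => isClosed_iInter fun ω' => isClosed_iInter fun _ => ?_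
  exact isClosed_eq (evC ω).continuous (evC ω').continuous

theorem DependsOnF.mono {f : Config → ℝ} {S S' : Set ℤ} (h : DependsOnF f S) (hS : S ⊆ S') :
    DependsOnF f S' := fun ω ω' hh => h ω ω' fun x hx => hh x (hS hx)

theorem AA_eq_self {p : ℝ} {f : CC} {S : Set ℤ} (h : DependsOnF f S) {x : ℤ} (hx : x ∉ S) :
    AA p x f = f := by
  ext ω
  have e : ∀ v, f (Function.update ω x v) = f ω := fun v => h _ _ fun y hy => by
    rw [Function.update_of_ne]; rintro rfl; exact hx hy
  rw [AA_apply, e, e]; ring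

theorem AA_dep {p : ℝ} {f : CC} {S : Set ℤ} (h : DependsOnF f S) (x : ℤ) :
    DependsOnF (AA p x f) (S \ {x}) := by
  intro ω ω' hh
  have e : ∀ v, f (Function.update ω x v) = f (Function.update ω' x v) := fun v =>
    h _ _ fun y hy => by
      by_cases hyx : y = x
      · subst hyx; simp
      · rw [Function.update_of_ne hyx, Function.update_of_ne hyx]; exact hh y ⟨hy, hyx⟩
  rw [AA_apply, AA_apply, e, e]

theorem gen_dep {p : ℝ} {f : CC} {S : Set ℤ} {V : Finset ℤ} (h : DependsOnF f S)
    (hV : ∀ x ∈ V, x ∈ S → x + 1 ∈ S) : DependsOnF (gen p V f) S := by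
  intro ω ω' hh
  rw [gen_apply, gen_apply]
  refine Finset.sum_congr rfl fun x hx => ?_
  by_cases hxS : x ∈ S
  · have h1 : kk x ω = kk x ω' := by rw [kk_apply, kk_apply, hh _ (hV x hx hxS)]
    rw [h1, h ω ω' hh, ((AA_dep (p := p) h x).mono Set.sdiff_subset) ω ω' hh]
  · rw [AA_eq_self h hxS]; simp

theorem TT_dep {p : ℝ} {f : CC} {S : Set ℤ} {V : Finset ℤ} (h : DependsOnF f S)
    (hV : ∀ x ∈ V, x ∈ S → x + 1 ∈ S) (t : ℝ) : DependsOnF (TT p V t f) S :=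
  expT_mem (W := depSub S) (depSub_closed S) (fun _ hg => gen_dep hg hV) t h

/-! ### Finite speed of propagation -/

/-- Discrete derivative at `x`. -/
def DE (x : ℤ) : CC →L[ℝ] CC := pull (setC x true) - pull (setC x false)

theorem DE_apply (x : ℤ) (f : CC) (ω : Config) :
    DE x f ω = f (Function.update ω x true) - f (Function.update ω x false) := rfl

theorem DE_eq_zero {f : CC} {S : Set ℤ} (h : DependsOnF f S) {x : ℤ} (hx : x ∉ S) (ω : Config) :
    DE x f ω = 0 := by
  have e : ∀ v, f (Function.update ω x v) = f ω := fun v => h _ _ fun y hy => by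
    rw [Function.update_of_ne]; rintro rfl; exact hx hy
  rw [DE_apply, e, e]; ring

theorem AA_sub_abs {p : ℝ} (hp0 : 0 ≤ p) (hp1 : p ≤ 1) (x : ℤ) (f : CC) (ω : Config) :
    |AA p x f ω - f ω| ≤ |DE x f ω| := by
  rw [AA_apply, DE_apply]
  cases h : ω x
  · have : f ω = f (Function.update ω x false) := by rw [← h, Function.update_eq_self]
    rw [this]
    have : p * f (Function.update ω x true) + (1 - p) * f (Function.update ω x false)
      - f (Function.update ω x false) = p * (f (Function.update ω x true) - f (Function.update ω x false)) := by ring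
    rw [this, abs_mul, abs_of_nonneg hp0]
    exact mul_le_of_le_one_left (abs_nonneg _) hp1
  · have : f ω = f (Function.update ω x true) := by rw [← h, Function.update_eq_self]
    rw [this]
    have : p * f (Function.update ω x true) + (1 - p) * f (Function.update ω x false)
      - f (Function.update ω x true) = -(1-p) * (f (Function.update ω x true) - f (Function.update ω x false)) := by ring
    rw [this, abs_mul, abs_neg, abs_of_nonneg (by linarith : 0 ≤ 1 - p)]
    exact mul_le_of_le_one_left (abs_nonneg _) (by linarith)

theorem kk_update (x y : ℤ) (h : y ≠ x + 1) (v : Bool) (ω : Config) :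
    kk x (Function.update ω y v) = kk x ω := by
  rw [kk_apply, kk_apply, Function.update_of_ne (Ne.symm h)]

theorem gen_DE_le {p : ℝ} (hp0 : 0 ≤ p) (hp1 : p ≤ 1) (V : Finset ℤ) (x : ℤ) (u : CC)
    (S b : ℝ) (hS : 0 ≤ S) (hb0 : 0 ≤ b) (hb : ∀ ω, |DE (x - 1) u ω| ≤ b)
    (h : ∀ ω, DE x u ω ≤ S) (ω : Config) :
    DE x (gen p V u) ω ≤ V.card * (S - DE x u ω) + b := by
  have key : ∀ y ∈ V,
      kk y (Function.update ω x true) * (AA p y u (Function.update ω x true) - u (Function.update ω x true))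
      - kk y (Function.update ω x false) * (AA p y u (Function.update ω x false) - u (Function.update ω x false))
      ≤ (S - DE x u ω) + (if y = x - 1 then b else 0) := by
    intro y _
    have h0 := h ω
    by_cases hy : y = x - 1
    · subst hy
      simp only [if_true]
      have h1 : kk (x-1) (Function.update ω x true) = 0 := by simp [kk_apply]
      have h2 : kk (x-1) (Function.update ω x false) = 1 := by simp [kk_apply]
      rw [h1, h2]
      have h3 := (abs_le.mp (AA_sub_abs hp0 hp1 (x-1) u (Function.update ω x false))).1
      have h4 := hb (Function.update ω x false)
      linarith
    · rw [if_neg hy, kk_update y x (by omega), kk_update y x (by omega), add_zero]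
      by_cases hyx : y = x
      · subst hyx
        have e : ∀ v, AA p y u (Function.update ω y v) = AA p y u ω := fun v => by
          simp [AA_apply]
        rw [e, e]
        rw [DE_apply] at *
        nlinarith [kk_nonneg y ω, kk_le_one y ω]
      · have e : AA p y u (Function.update ω x true) - AA p y u (Function.update ω x false)
            = AA p y (DE x u) ω := by
          simp only [AA_apply, DE_apply]
          rw [Function.update_comm hyx, Function.update_comm hyx, Function.update_comm hyx,
            Function.update_comm hyx]
          ring
        have h5 := AA_le hp0 hp1 y (DE x u) S ω h
        have : kk y ω * (AA p y u (Function.update ω x true) - u (Function.update ω x true))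
          - kk y ω * (AA p y u (Function.update ω x false) - u (Function.update ω x false))
          = kk y ω * (AA p y (DE x u) ω - DE x u ω) := by
          rw [← e, DE_apply]; ring
        rw [this]
        nlinarith [kk_nonneg y ω, kk_le_one y ω]
  rw [DE_apply, gen_apply, gen_apply, ← Finset.sum_sub_distrib]
  refine (Finset.sum_le_sum key).trans ?_
  rw [Finset.sum_add_distrib, Finset.sum_const, nsmul_eq_mul, Finset.sum_ite_eq']
  split_ifs <;> linarith

theorem FS_step {p : ℝ} (hp0 : 0 ≤ p) (hp1 : p ≤ 1) (V : Finset ℤ) (x : ℤ) (f : CC)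
    (b c c' : ℝ → ℝ) (hb : ∀ t, 0 ≤ t → ∀ ω, |DE (x - 1) (TT p V t f) ω| ≤ b t)
    (hc : ∀ t, HasDerivAt c (c' t) t) (hbc : ∀ t, 0 ≤ t → b t ≤ c' t) (hc0 : ∀ t, 0 ≤ t → 0 ≤ c t)
    (hf : ∀ ω, DE x f ω ≤ c 0) {t : ℝ} (ht : 0 ≤ t) (ω : Config) :
    DE x (TT p V t f) ω ≤ c t := by
  have hd : ∀ s, HasDerivAt (fun s => DE x (TT p V s f)) (DE x (gen p V (TT p V s f))) s :=
    fun s => hasDerivAt_clm (TT_hasDerivAt p V f s) _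
  obtain ⟨B, hB⟩ := norm_bound_Icc (continuous_iff_continuousAt.mpr fun s => (hd s).continuousAt) t
  have := max_principle (fun ω s => DE x (TT p V s f) ω - c s)
    (fun ω s => DE x (gen p V (TT p V s f)) ω - c' s)
    V.card t B 0 (by positivity) (fun i s _ => (hasDerivAt_eval (hd s) i).sub (hc s))
    (fun i s hs => by linarith [(le_norm_C _ i).trans (hB s hs), hc0 s hs.1])
    (fun i => by simpa [TT_zero] using hf i)
    (fun S hS s hs hSi i => by
      have h1 := gen_DE_le hp0 hp1 V x (TT p V s f) (S + c s) (b s) (by linarith [hc0 s hs.1])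
        ((abs_nonneg _).trans (hb s hs.1 i)) (hb s hs.1) (fun j => by linarith [hSi j]) i
      have h2 := hbc s hs.1
      have h3 : (V.card : ℝ) * (S - (DE x (TT p V s f) i - c s)) = V.card * (S + c s - DE x (TT p V s f) i) := by
        ring
      rw [h3]; linarith) ω t ⟨ht, le_refl _⟩
  linarith

theorem FS {p : ℝ} (hp0 : 0 ≤ p) (hp1 : p ≤ 1) (V : Finset ℤ) (a : ℤ) (M : ℝ) (k : ℕ) :
    ∀ (f : CC), (∀ ω, |f ω| ≤ M) → DependsOnF f (Set.Iic a) → ∀ t : ℝ, 0 ≤ t → ∀ ω,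
    |DE (a + k) (TT p V t f) ω| ≤ 2 * M * (t ^ k / k.factorial) := by
  induction k with
  | zero =>
    intro f hM _ t ht ω
    have h := fun ω => abs_le.mp (TT_abs hp0 hp1 V f M hM ht ω)
    rw [DE_apply]
    simp only [pow_zero, Nat.factorial_zero, Nat.cast_one, div_one, mul_one, Nat.cast_zero, add_zero]
    rw [abs_le]
    have h1 := h (Function.update ω a true)
    have h2 := h (Function.update ω a false)
    constructor <;> linarith
  | succ k ih =>
    have hone : ∀ (f : CC), (∀ ω, |f ω| ≤ M) → DependsOnF f (Set.Iic a) → ∀ t : ℝ, 0 ≤ t → ∀ ω,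
        DE (a + (k + 1 : ℕ)) (TT p V t f) ω ≤ 2 * M * (t ^ (k + 1) / (k + 1).factorial) := by
      intro f hM hf t ht ω
      have hM0 : 0 ≤ M := (abs_nonneg _).trans (hM ω)
      refine FS_step hp0 hp1 V (a + (k + 1 : ℕ)) f (fun t => 2 * M * (t ^ k / k.factorial))
        (fun t => 2 * M * (t ^ (k + 1) / (k + 1).factorial))
        (fun t => 2 * M * (t ^ k / k.factorial)) ?_ ?_ (fun _ _ => le_refl _) ?_ ?_ ht ω
      · intro t ht ω
        have := ih f hM hf t ht ω
        rwa [show a + ((k + 1 : ℕ) : ℤ) - 1 = a + k by push_cast; ring]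
      · intro t
        have h1 := ((hasDerivAt_pow (k + 1) t).div_const ((k + 1).factorial : ℝ)).const_mul (2 * M)
        have e : 2 * M * (t ^ k / k.factorial) = 2 * M * (((k + 1 : ℕ) : ℝ) * t ^ (k + 1 - 1) / (k + 1).factorial) := by
          rw [Nat.factorial_succ]
          have : (k.factorial : ℝ) ≠ 0 := by positivity
          push_cast
          have : (k : ℝ) + 1 ≠ 0 := by positivity
          field_simp
        rw [e]
        exact h1
      · intro t ht
        positivity
      · intro ω
        rw [DE_eq_zero hf (by simp)]
        simp
    intro f hM hf t ht ω
    rw [abs_le]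
    refine ⟨?_, hone f hM hf t ht ω⟩
    have h := hone (-f) (fun ω => by simpa using hM ω) (fun ω ω' h => by simp [hf ω ω' h]) t ht ω
    rw [map_neg, map_neg] at h
    have h' : -(DE (a + (k + 1 : ℕ)) (TT p V t f) ω) ≤ _ := h
    linarith

/-! ### Decorrelation -/

theorem DE_abs_le {f : CC} {M : ℝ} (h : ∀ ω, |f ω| ≤ M) (x : ℤ) (ω : Config) :
    |DE x f ω| ≤ 2 * M := by
  rw [DE_apply, abs_le]
  have h1 := abs_le.mp (h (Function.update ω x true))
  have h2 := abs_le.mp (h (Function.update ω x false))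
  constructor <;> linarith

theorem carre_abs {p : ℝ} (hp0 : 0 ≤ p) (hp1 : p ≤ 1) (x : ℤ) (u v : CC) (ω : Config) :
    |AA p x (u * v) ω - u ω * v ω - v ω * (AA p x u ω - u ω) - u ω * (AA p x v ω - v ω)|
      ≤ |DE x u ω| * |DE x v ω| := by
  rw [← abs_mul]
  simp only [AA_apply, DE_apply, ContinuousMap.mul_apply]
  cases h : ω x
  · have e : ∀ f : CC, f ω = f (Function.update ω x false) := fun f => by
      rw [← h, Function.update_eq_self]
    rw [e u, e v]
    rw [show p * (u (Function.update ω x true) * v (Function.update ω x true)) +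
      (1 - p) * (u (Function.update ω x false) * v (Function.update ω x false)) -
      u (Function.update ω x false) * v (Function.update ω x false) -
      v (Function.update ω x false) * (p * u (Function.update ω x true) +
        (1 - p) * u (Function.update ω x false) - u (Function.update ω x false)) -
      u (Function.update ω x false) * (p * v (Function.update ω x true) +
        (1 - p) * v (Function.update ω x false) - v (Function.update ω x false))
      = p * ((u (Function.update ω x true) - u (Function.update ω x false)) *
        (v (Function.update ω x true) - v (Function.update ω x false))) by ring, abs_mul, abs_of_nonneg hp0]
    exact mul_le_of_le_one_left (abs_nonneg _) hp1
  · have e : ∀ f : CC, f ω = f (Function.update ω x true) := fun f => by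
      rw [← h, Function.update_eq_self]
    rw [e u, e v]
    rw [show p * (u (Function.update ω x true) * v (Function.update ω x true)) +
      (1 - p) * (u (Function.update ω x false) * v (Function.update ω x false)) -
      u (Function.update ω x true) * v (Function.update ω x true) -
      v (Function.update ω x true) * (p * u (Function.update ω x true) +
        (1 - p) * u (Function.update ω x false) - u (Function.update ω x true)) -
      u (Function.update ω x true) * (p * v (Function.update ω x true) +
        (1 - p) * v (Function.update ω x false) - v (Function.update ω x true))
      = (1 - p) * ((u (Function.update ω x true) - u (Function.update ω x false)) *
        (v (Function.update ω x true) - v (Function.update ω x false))) by ring, abs_mul,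
        abs_of_nonneg (by linarith : 0 ≤ 1 - p)]
    exact mul_le_of_le_one_left (abs_nonneg _) (by linarith)

theorem gen_mul_abs {p : ℝ} (hp0 : 0 ≤ p) (hp1 : p ≤ 1) (V : Finset ℤ) (u v : CC) (ω : Config) :
    |gen p V (u * v) ω - v ω * gen p V u ω - u ω * gen p V v ω|
      ≤ ∑ x ∈ V, |DE x u ω| * |DE x v ω| := by
  rw [gen_apply, gen_apply, gen_apply, Finset.mul_sum, Finset.mul_sum, ← Finset.sum_sub_distrib,
    ← Finset.sum_sub_distrib]
  refine (Finset.abs_sum_le_sum_abs _ _).trans (Finset.sum_le_sum fun x _ => ?_)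
  have h := carre_abs hp0 hp1 x u v ω
  rw [show kk x ω * (AA p x (u * v) ω - (u * v) ω) - v ω * (kk x ω * (AA p x u ω - u ω)) -
    u ω * (kk x ω * (AA p x v ω - v ω)) = kk x ω * (AA p x (u * v) ω - u ω * v ω - v ω * (AA p x u ω - u ω) - u ω * (AA p x v ω - v ω)) by
      rw [ContinuousMap.mul_apply]; ring, abs_mul, abs_of_nonneg (kk_nonneg x ω)]
  exact (mul_le_of_le_one_left (abs_nonneg _) (kk_le_one x ω)).trans h

theorem DEC_one {p : ℝ} (hp0 : 0 ≤ p) (hp1 : p ≤ 1) (V : Finset ℤ) (F g : CC) (γ : ℝ) (hγ0 : 0 ≤ γ) {t : ℝ}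
    (hγ : ∀ s ∈ Set.Icc 0 t, ∀ ω, ∑ x ∈ V, |DE x (TT p V s F) ω| * |DE x (TT p V s g) ω| ≤ γ)
    (ht : 0 ≤ t) (ω : Config) (σ : ℝ) (hσ : σ = 1 ∨ σ = -1) :
    σ * (TT p V t (F * g) ω - TT p V t F ω * TT p V t g ω) ≤ γ * t := by
  have hd : ∀ s, HasDerivAt (fun s => σ • (TT p V s (F * g) - TT p V s F * TT p V s g))
      (σ • (gen p V (TT p V s (F * g)) - (gen p V (TT p V s F) * TT p V s g +
        TT p V s F * gen p V (TT p V s g)))) s := fun s =>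
    ((TT_hasDerivAt p V (F * g) s).sub
      ((TT_hasDerivAt p V F s).mul (TT_hasDerivAt p V g s))).const_smul σ
  obtain ⟨B, hB⟩ := norm_bound_Icc (continuous_iff_continuousAt.mpr fun s => (hd s).continuousAt) t
  have := max_principle
    (fun ω s => (σ • (TT p V s (F * g) - TT p V s F * TT p V s g)) ω - γ * s)
    (fun ω s => (σ • (gen p V (TT p V s (F * g)) - (gen p V (TT p V s F) * TT p V s g +
        TT p V s F * gen p V (TT p V s g)))) ω - γ)
    V.card t B 0 (by positivity)
    (fun i s _ => by
      have h2 := (hasDerivAt_id s).const_mul γ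
      rw [mul_one] at h2
      exact (hasDerivAt_eval (hd s) i).sub h2)
    (fun i s hs => by linarith [(le_norm_C _ i).trans (hB s hs), mul_nonneg hγ0 hs.1])
    (fun i => by simp [TT_zero])
    (fun S hS s hs hSi i => by
      have h1 := gen_le hp0 hp1 V (σ • (TT p V s (F * g) - TT p V s F * TT p V s g)) (S + γ * s)
        (fun j => by linarith [hSi j]) i
      have h2 := abs_le.mp ((gen_mul_abs hp0 hp1 V (TT p V s F) (TT p V s g) i).trans (hγ s hs i))
      rw [map_smul, map_sub] at h1
      simp only [ContinuousMap.smul_apply, ContinuousMap.sub_apply, ContinuousMap.add_apply,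
        ContinuousMap.mul_apply, smul_eq_mul] at h1 ⊢
      rcases hσ with rfl | rfl
      · have := h2.2
        nlinarith
      · have := h2.1
        nlinarith) ω t ⟨ht, le_refl _⟩
  have h3 : (σ • (TT p V t (F * g) - TT p V t F * TT p V t g)) ω =
    σ * (TT p V t (F * g) ω - TT p V t F ω * TT p V t g ω) := rfl
  rw [h3] at this
  linarith

theorem half_sum (V : Finset ℤ) (y : ℤ) (L : ℕ) :
    ∑ x ∈ V.filter (fun x => y + L ≤ x), (1 / 2 : ℝ) ^ (x - y).toNat ≤ 2 * (1 / 2 : ℝ) ^ L := by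
  have h1 : ∑ x ∈ V.filter (fun x => y + L ≤ x), (1 / 2 : ℝ) ^ (x - y).toNat
      = ∑ j ∈ (V.filter (fun x => y + L ≤ x)).image (fun x => (x - (y + L)).toNat),
        (1 / 2 : ℝ) ^ L * (1 / 2 : ℝ) ^ j := by
    rw [Finset.sum_image]
    · refine Finset.sum_congr rfl fun x hx => ?_
      rw [← pow_add]
      congr 1
      have := (Finset.mem_filter.mp hx).2
      omega
    · intro x hx x' hx' h
      have h1 := (Finset.mem_filter.mp hx).2
      have h2 := (Finset.mem_filter.mp hx').2
      simp only at h
      omega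
  rw [h1, ← Finset.mul_sum, mul_comm]
  gcongr
  have := (summable_geometric_two).sum_le_tsum
    ((V.filter (fun x => y + L ≤ x)).image (fun x => (x - (y + L)).toNat)) (fun i _ => by positivity)
  rwa [tsum_geometric_two] at this

theorem pow_fact_half {s : ℝ} (hs : 0 ≤ s) (k : ℕ) (hk : s ≤ k / 8) :
    s ^ k / k.factorial ≤ (1 / 2 : ℝ) ^ k := by
  have h1 : (k : ℝ) ^ k / k.factorial ≤ Real.exp k :=
    Real.pow_div_factorial_le_exp (k : ℝ) (by positivity) k
  have h2 : s ^ k ≤ (k / 8 : ℝ) ^ k := pow_le_pow_left₀ hs hk k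
  have h3 : Real.exp k ≤ (4 : ℝ) ^ k := by
    rw [← Real.exp_one_pow]
    exact pow_le_pow_left₀ (Real.exp_pos _).le (by linarith [Real.exp_one_lt_d9]) k
  calc s ^ k / k.factorial ≤ (k / 8 : ℝ) ^ k / k.factorial := by gcongr
    _ = ((k : ℝ) ^ k / k.factorial) * (1 / 8) ^ k := by rw [div_pow, div_pow]; ring
    _ ≤ (4 : ℝ) ^ k * (1 / 8) ^ k := by
        gcongr
        exact h1.trans h3
    _ = _ := by rw [← mul_pow]; norm_num

/-- Decorrelation over distance `L` for times at most `L/8`. -/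
theorem DEC {p : ℝ} (hp0 : 0 ≤ p) (hp1 : p ≤ 1) (V : Finset ℤ) (F g : CC) (y : ℤ) (L : ℕ)
    (hF : DependsOnF F (Set.Iic y)) (hg : DependsOnF g (Set.Ici (y + L)))
    (hF1 : ∀ ω, |F ω| ≤ 1) (hg1 : ∀ ω, |g ω| ≤ 1) {t : ℝ} (ht : 0 ≤ t) (htL : t ≤ L / 8) (ω : Config) :
    |TT p V t (F * g) ω - TT p V t F ω * TT p V t g ω| ≤ 8 * (1 / 2 : ℝ) ^ L * t := by
  have hγ : ∀ s ∈ Set.Icc 0 t, ∀ ω, ∑ x ∈ V, |DE x (TT p V s F) ω| * |DE x (TT p V s g) ω|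
      ≤ 8 * (1 / 2 : ℝ) ^ L := by
    intro s hs ω
    have h1 : ∀ x ∈ V, |DE x (TT p V s F) ω| * |DE x (TT p V s g) ω| ≤
        if y + L ≤ x then 4 * (1 / 2 : ℝ) ^ (x - y).toNat else 0 := by
      intro x _
      split_ifs with hx
      · obtain ⟨k, hk⟩ : ∃ k : ℕ, x = y + k := ⟨(x - y).toNat, by omega⟩
        have hk' : (x - y).toNat = k := by omega
        rw [hk']
        have hLk : L ≤ k := by omega
        have h2 := FS hp0 hp1 V y 1 k F hF1 hF s hs.1 ω
        rw [← hk] at h2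
        have h3 := DE_abs_le (TT_abs hp0 hp1 V g 1 hg1 hs.1) x ω
        have h4 := pow_fact_half hs.1 k (hs.2.trans (htL.trans (by gcongr)))
        have h5 : |DE x (TT p V s F) ω| ≤ 2 * (1 / 2 : ℝ) ^ k := by linarith
        calc _ ≤ (2 * (1 / 2 : ℝ) ^ k) * (2 * 1) := mul_le_mul h5 h3 (abs_nonneg _) (by positivity)
          _ = _ := by ring
      · have h2 : DependsOnF (TT p V s g) (Set.Ici (y + L)) :=
          TT_dep hg (fun x _ hx => by simp only [Set.mem_Ici] at *; omega) s
        rw [DE_eq_zero h2 (by simpa using hx)]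
        simp
    refine (Finset.sum_le_sum h1).trans ?_
    rw [← Finset.sum_filter, ← Finset.mul_sum]
    linarith [half_sum V y L]
  rw [abs_le]
  have h1 := DEC_one hp0 hp1 V F g _ (by positivity) hγ ht ω 1 (Or.inl rfl)
  have h2 := DEC_one hp0 hp1 V F g _ (by positivity) hγ ht ω (-1) (Or.inr rfl)
  constructor <;> linarith

/-! ### Distinguished zero -/

/-- Average over the sites `a, …, a+m-1`. -/
def Av (p : ℝ) (a : ℤ) : ℕ → (CC →L[ℝ] CC)
  | 0 => ContinuousLinearMap.id ℝ CC
  | m + 1 => (AA p (a + m)).comp (Av p a m)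

theorem Av_zero (p : ℝ) (a : ℤ) (f : CC) : Av p a 0 f = f := rfl

theorem Av_succ (p : ℝ) (a : ℤ) (m : ℕ) (f : CC) :
    Av p a (m + 1) f = AA p (a + m) (Av p a m f) := rfl

theorem AA_comm (p : ℝ) (x y : ℤ) (f : CC) : AA p x (AA p y f) = AA p y (AA p x f) := by
  by_cases h : x = y
  · rw [h]
  · ext ω
    simp only [AA_apply]
    rw [Function.update_comm h, Function.update_comm h, Function.update_comm h,
      Function.update_comm h]
    ring

theorem AA_idem (p : ℝ) (x : ℤ) (f : CC) : AA p x (AA p x f) = AA p x f := by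
  ext ω
  simp only [AA_apply, Function.update_idem]
  ring

theorem AA_upd (p : ℝ) (x : ℤ) (f : CC) (ω : Config) (v : Bool) :
    AA p x f (Function.update ω x v) = AA p x f ω := by
  simp only [AA_apply, Function.update_idem]

theorem AA_kk_mul (p : ℝ) (x y : ℤ) (h : y ≠ x + 1) (f : CC) :
    AA p y (kk x * f) = kk x * AA p y f := by
  ext ω
  simp only [AA_apply, ContinuousMap.mul_apply, kk_update x y h]
  ring

theorem Av_AA (p : ℝ) (a : ℤ) (m : ℕ) (x : ℤ) (f : CC) :
    Av p a m (AA p x f) = AA p x (Av p a m f) := by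
  induction m with
  | zero => rfl
  | succ m ih => rw [Av_succ, Av_succ, ih, AA_comm]

theorem Av_kk_mul (p : ℝ) (a : ℤ) (m : ℕ) (x : ℤ) (h : x + 1 < a ∨ a + m ≤ x + 1) (f : CC) :
    Av p a m (kk x * f) = kk x * Av p a m f := by
  induction m with
  | zero => rfl
  | succ m ih =>
    rw [Av_succ, Av_succ, ih (by push_cast at h; omega), AA_kk_mul]
    push_cast at h; omega

theorem Av_absorb (p : ℝ) (a : ℤ) (m : ℕ) (x : ℤ) (h : a ≤ x) (h' : x < a + m) (f : CC) :
    Av p a m (AA p x f) = Av p a m f := by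
  induction m with
  | zero => simp at h'; omega
  | succ m ih =>
    rw [Av_succ, Av_succ]
    by_cases hx : x < a + m
    · rw [ih hx]
    · have : x = a + m := by push_cast at h'; omega
      rw [Av_AA, this, AA_idem]

theorem AA_mono {p : ℝ} (hp0 : 0 ≤ p) (hp1 : p ≤ 1) (x : ℤ) {f g : CC} (h : ∀ ω, f ω ≤ g ω) (ω : Config) :
    AA p x f ω ≤ AA p x g ω := by
  rw [AA_apply, AA_apply]
  have := h (Function.update ω x true)
  have := h (Function.update ω x false)
  have : 0 ≤ 1 - p := by linarith
  gcongr

theorem Av_mono {p : ℝ} (hp0 : 0 ≤ p) (hp1 : p ≤ 1) (a : ℤ) (m : ℕ) {f g : CC}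
    (h : ∀ ω, f ω ≤ g ω) (ω : Config) : Av p a m f ω ≤ Av p a m g ω := by
  induction m generalizing ω with
  | zero => exact h ω
  | succ m ih => exact AA_mono hp0 hp1 _ ih ω

theorem Av_le {p : ℝ} (hp0 : 0 ≤ p) (hp1 : p ≤ 1) (a : ℤ) (m : ℕ) {f : CC} {S : ℝ}
    (h : ∀ ω, f ω ≤ S) (ω : Config) : Av p a m f ω ≤ S := by
  induction m generalizing ω with
  | zero => exact h ω
  | succ m ih => exact AA_le hp0 hp1 _ _ _ _ ih

theorem Av_term_zero (p : ℝ) (a : ℤ) (m : ℕ) (x : ℤ) (h : a ≤ x) (h' : x < a + m) (f : CC) :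
    Av p a m (kk x * (AA p x f - f)) = 0 := by
  rw [← Av_absorb p a m x h h', AA_kk_mul p x x (by omega), map_sub, AA_idem, sub_self, mul_zero,
    map_zero]

/-- index set for the distinguished zero argument -/
def DZi (V : Finset ℤ) (a : ℤ) (m : ℕ) : Prop := 1 ≤ m ∧ ∀ x, a ≤ x → x < a + m → x ∈ V

theorem Av_term_le {p : ℝ} (hp0 : 0 ≤ p) (hp1 : p ≤ 1) (V : Finset ℤ) (a : ℤ) (w : CC) (S : ℝ)
    (hw : DependsOnF w (Set.Ici a))
    (hS : ∀ m, DZi V a m → ∀ η : Config, Av p a m w (Function.update η (a + m) false) ≤ S)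
    (m : ℕ) (hm : DZi V a m) (x : ℤ) (hx : x ∈ V) (η : Config) :
    Av p a m (kk x * (AA p x w - w)) (Function.update η (a + m) false)
      ≤ S - Av p a m w (Function.update η (a + m) false) := by
  have h0 := hS m hm η
  by_cases hxa : x < a
  · have : AA p x w = w := AA_eq_self hw (by simpa using hxa)
    rw [this, sub_self, mul_zero, map_zero]
    simpa using h0
  · by_cases hxc : x < a + m
    · rw [Av_term_zero p a m x (by omega) hxc]
      simpa using h0
    · rw [Av_kk_mul p a m x (by omega), map_sub, Av_AA, ContinuousMap.mul_apply,
        ContinuousMap.sub_apply]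
      by_cases hxc' : x = a + m
      · subst hxc'
        rw [kk_update _ _ (by omega), AA_upd, ← Av_succ]
        by_cases hk : η (a + m + 1) = false
        · have h1 := hS (m + 1) ⟨by omega, fun x h1 h2 => by
            by_cases h3 : x < a + m
            · exact hm.2 x h1 h3
            · have : x = a + m := by push_cast at h2; omega
              rwa [this]⟩ η
          have h2 : Function.update η (a + ((m + 1 : ℕ) : ℤ)) false = η := by
            rw [← hk]
            have : a + ((m + 1 : ℕ) : ℤ) = a + m + 1 := by push_cast; ring
            rw [this, Function.update_eq_self]
          rw [h2] at h1
          nlinarith [kk_nonneg (a + m) η, kk_le_one (a + m) η]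
        · have : kk (a + m) η = 0 := by rw [kk_apply, if_neg hk]
          rw [this]; linarith
      · have h1 : AA p x (Av p a m w) (Function.update η (a + m) false) ≤ S := by
          rw [AA_apply, Function.update_comm (Ne.symm hxc'), Function.update_comm (Ne.symm hxc')]
          have := hS m hm (Function.update η x true)
          have := hS m hm (Function.update η x false)
          nlinarith
        nlinarith [kk_nonneg x (Function.update η (a + m) false), kk_le_one x (Function.update η (a + m) false)]

theorem Av_gen (p : ℝ) (V : Finset ℤ) (a : ℤ) (m : ℕ) (w : CC) (ω : Config) :
    Av p a m (gen p V w) ω = ∑ x ∈ V, Av p a m (kk x * (AA p x w - w)) ω := by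
  have : gen p V w = ∑ x ∈ V, kk x * (AA p x w - w) := by
    ext ω
    rw [gen_apply, ContinuousMap.sum_apply]
    rfl
  rw [this, map_sum, ContinuousMap.sum_apply]

theorem DZmean {p : ℝ} (hp0 : 0 ≤ p) (hp1 : p ≤ 1) (V : Finset ℤ) (a : ℤ) (h : CC) (B0 : ℝ)
    (hh : DependsOnF h (Set.Ici a))
    (hB : ∀ m, DZi V a m → ∀ η : Config, Av p a m h (Function.update η (a + m) false) ≤ B0)
    (m : ℕ) (hm : DZi V a m) (η : Config) {t : ℝ} (ht : 0 ≤ t) :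
    Av p a m (TT p V t h) (Function.update η (a + m) false) ≤ B0 := by
  obtain ⟨B, hBd⟩ := norm_bound_Icc (TT_cont p V h) t
  exact max_principle
    (fun (i : {m // DZi V a m} × Config) s => Av p a i.1.1 (TT p V s h) (Function.update i.2 (a + i.1.1) false))
    (fun i s => Av p a i.1.1 (gen p V (TT p V s h)) (Function.update i.2 (a + i.1.1) false))
    V.card t B B0 (by positivity)
    (fun i s _ => hasDerivAt_eval (hasDerivAt_clm (TT_hasDerivAt p V h s) _) _)
    (fun i s hs => Av_le hp0 hp1 _ _ (fun ω => (le_norm_C _ ω).trans (hBd s hs)) _)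
    (fun i => by simpa [TT_zero] using hB i.1.1 i.1.2 i.2)
    (fun S hS s hs hSi i => by
      rw [Av_gen, ← nsmul_eq_mul]
      apply Finset.sum_le_card_nsmul
      intro x hx
      exact Av_term_le hp0 hp1 V a (TT p V s h) S
        (TT_dep hh (fun x _ hx => by simp only [Set.mem_Ici] at *; omega) s)
        (fun m hm η => hSi (⟨m, hm⟩, η)) i.1.1 i.1.2 x hx i.2) (⟨m, hm⟩, η) t ⟨ht, le_refl _⟩

theorem AA_sq_ge {p : ℝ} (hp0 : 0 ≤ p) (hp1 : p ≤ 1) (x : ℤ) (u : CC) (ω : Config) :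
    2 * u ω * (AA p x u ω - u ω) ≤ AA p x (u * u) ω - u ω * u ω := by
  simp only [AA_apply, ContinuousMap.mul_apply]
  nlinarith [mul_nonneg hp0 (sq_nonneg (u (Function.update ω x true) - u ω)),
    mul_nonneg (by linarith : 0 ≤ 1 - p) (sq_nonneg (u (Function.update ω x false) - u ω))]

/-- The finite volume Poincaré inequality needed below. -/
def GapIneq (p lam : ℝ) : Prop := ∀ (a : ℤ) (m : ℕ) (u : CC) (η : Config),
  Av p a m u (Function.update η (a + m) false) = 0 →
  lam * Av p a m (u * u) (Function.update η (a + m) false) ≤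
    ∑ x ∈ Finset.Ico a (a + m), Av p a m (kk x * (AA p x (u * u) - AA p x u * AA p x u))
      (Function.update η (a + m) false)

theorem DZvar {p : ℝ} (hp0 : 0 ≤ p) (hp1 : p ≤ 1) {lam : ℝ} (hlam : GapIneq p lam)
    (V : Finset ℤ) (a : ℤ) (g : CC) (hg1 : ∀ ω, |g ω| ≤ 1)
    (hg : DependsOnF g (Set.Ici a)) (hga : AA p a g = 0)
    (m : ℕ) (hm : DZi V a m) (η : Config) {t : ℝ} (ht : 0 ≤ t) :
    Av p a m (TT p V t g * TT p V t g) (Function.update η (a + m) false) ≤ Real.exp (-2 * lam * t) := by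
  have hmean0 : ∀ m, DZi V a m → Av p a m g = 0 := by
    intro m hm
    rw [← Av_absorb p a m a (le_refl _) (by have := hm.1; omega), hga, map_zero]
  have hmean : ∀ m, DZi V a m → ∀ η : Config, ∀ s : ℝ, 0 ≤ s →
      Av p a m (TT p V s g) (Function.update η (a + m) false) = 0 := by
    intro m hm η s hs
    apply le_antisymm
    · exact DZmean hp0 hp1 V a g 0 hg (fun m hm η => by rw [hmean0 m hm]; rfl) m hm η hs
    · have := DZmean hp0 hp1 V a (-g) 0 (fun ω ω' h => by simp [hg ω ω' h])
        (fun m hm η => by rw [map_neg, hmean0 m hm]; simp) m hm η hs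
      rw [map_neg, map_neg] at this
      exact neg_nonpos.mp this
  have hc : Continuous fun s => TT p V s g * TT p V s g := (TT_cont p V g).mul (TT_cont p V g)
  have hexp : ∀ s : ℝ, HasDerivAt (fun s : ℝ => Real.exp (2 * lam * s)) (Real.exp (2 * lam * s) * (2 * lam)) s := by
    intro s
    have := ((hasDerivAt_id s).const_mul (2 * lam)).exp
    simpa using this
  have hc2 : Continuous fun s => Real.exp (2 * lam * s) • (TT p V s g * TT p V s g) :=
    (continuous_iff_continuousAt.mpr fun s => (hexp s).continuousAt).smul hc
  obtain ⟨B, hBd⟩ := norm_bound_Icc hc2 t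
  have key := max_principle
    (fun (i : {m // DZi V a m} × Config) s => Real.exp (2 * lam * s) * Av p a i.1.1 (TT p V s g * TT p V s g) (Function.update i.2 (a + i.1.1) false))
    (fun i s => Real.exp (2 * lam * s) * (2 * lam) * Av p a i.1.1 (TT p V s g * TT p V s g) (Function.update i.2 (a + i.1.1) false)
      + Real.exp (2 * lam * s) * Av p a i.1.1 (gen p V (TT p V s g) * TT p V s g + TT p V s g * gen p V (TT p V s g)) (Function.update i.2 (a + i.1.1) false))
    V.card t B 1 (by positivity)
    (fun i s _ => (hexp s).mul (hasDerivAt_eval (hasDerivAt_clm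
        ((TT_hasDerivAt p V g s).mul (TT_hasDerivAt p V g s)) _) _))
    (fun i s hs => by
      have := Av_le hp0 hp1 a i.1.1 (fun ω => (le_norm_C _ ω).trans (hBd s hs)) (Function.update i.2 (a + i.1.1) false)
      rwa [map_smul] at this)
    (fun i => by
      simp only [mul_zero, Real.exp_zero, TT_zero, one_mul]
      refine Av_le hp0 hp1 a i.1.1 (fun ω => ?_) _
      have := hg1 ω
      show g ω * g ω ≤ 1
      rw [← abs_mul_abs_self]
      nlinarith [abs_nonneg (g ω)])
    (fun S hS s hs hSi i => by
      obtain ⟨⟨m, hm⟩, η⟩ := i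
      simp only at hSi ⊢
      set u := TT p V s g with hu
      set ex := Real.exp (2 * lam * s) with hex
      have hexpos : 0 < ex := Real.exp_pos _
      set ω := Function.update η (a + m) false with hω
      have hdep : DependsOnF u (Set.Ici a) :=
        TT_dep hg (fun x _ hx => by simp only [Set.mem_Ici] at *; omega) s
      have hS' : ∀ m, DZi V a m → ∀ η : Config,
          Av p a m (u * u) (Function.update η (a + m) false) ≤ S / ex := by
        intro m hm η
        rw [le_div_iff₀ hexpos, mul_comm]
        exact hSi (⟨m, hm⟩, η)
      -- split the generator term
      have hsum : Av p a m (gen p V u * u + u * gen p V u) ω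
          = ∑ x ∈ V, Av p a m ((2 : ℝ) • (u * (kk x * (AA p x u - u)))) ω := by
        have e : gen p V u * u + u * gen p V u = ∑ x ∈ V, (2 : ℝ) • (u * (kk x * (AA p x u - u))) := by
          ext ζ
          simp only [ContinuousMap.add_apply, ContinuousMap.mul_apply, gen_apply,
            ContinuousMap.sum_apply, ContinuousMap.smul_apply, ContinuousMap.sub_apply, smul_eq_mul]
          rw [mul_comm, ← two_mul, Finset.mul_sum, Finset.mul_sum]
        rw [e, map_sum, ContinuousMap.sum_apply]
      have hIco : Finset.Ico a (a + m) ⊆ V := fun x hx => by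
        rw [Finset.mem_Ico] at hx
        exact hm.2 x hx.1 hx.2
      have hin : ∀ x ∈ Finset.Ico a (a + (m : ℤ)), Av p a m ((2 : ℝ) • (u * (kk x * (AA p x u - u)))) ω
          = -2 * Av p a m (kk x * (AA p x (u * u) - AA p x u * AA p x u)) ω := by
        intro x hx
        rw [Finset.mem_Ico] at hx
        rw [← Av_absorb p a m x hx.1 hx.2]
        have e : AA p x ((2 : ℝ) • (u * (kk x * (AA p x u - u))))
            = (-2 : ℝ) • (kk x * (AA p x (u * u) - AA p x u * AA p x u)) := by
          ext ζ
          have e1 := AA_upd p x u ζ true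
          have e2 := AA_upd p x u ζ false
          rw [map_smul, ContinuousMap.smul_apply, AA_apply p x (u * (kk x * (AA p x u - u)))]
          simp only [ContinuousMap.mul_apply, ContinuousMap.sub_apply, ContinuousMap.smul_apply,
            smul_eq_mul, e1, e2, kk_update x x (by omega)]
          rw [AA_apply p x (u * u)]
          simp only [ContinuousMap.mul_apply]
          rw [AA_apply p x u]
          ring
        rw [e, map_smul]
        rfl
      have hout : ∀ x ∈ V \ Finset.Ico a (a + (m : ℤ)), Av p a m ((2 : ℝ) • (u * (kk x * (AA p x u - u)))) ω
          ≤ S / ex - Av p a m (u * u) ω := by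
        intro x hx
        refine le_trans (Av_mono hp0 hp1 a m (g := kk x * (AA p x (u * u) - u * u)) ?_ ω)
          (Av_term_le hp0 hp1 V a (u * u) (S / ex) (fun ζ ζ' h => by simp [hdep ζ ζ' h]) hS' m hm x
            (Finset.mem_sdiff.mp hx).1 η)
        intro ζ
        have := AA_sq_ge hp0 hp1 x u ζ
        simp only [ContinuousMap.mul_apply, ContinuousMap.sub_apply, ContinuousMap.smul_apply, smul_eq_mul]
        nlinarith [kk_nonneg x ζ]
      have hgapi := hlam a m u η (hmean m hm η s hs.1)
      rw [← hω] at hgapi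
      have h1 : Av p a m (gen p V u * u + u * gen p V u) ω ≤
          V.card * (S / ex - Av p a m (u * u) ω) - 2 * (lam * Av p a m (u * u) ω) := by
        rw [hsum, ← Finset.sum_sdiff hIco, Finset.sum_congr rfl hin, ← Finset.mul_sum]
        have h2 := Finset.sum_le_card_nsmul _ _ _ hout
        rw [nsmul_eq_mul] at h2
        have h3 : ((V \ Finset.Ico a (a + (m : ℤ))).card : ℝ) ≤ V.card := by
          exact_mod_cast Finset.card_le_card Finset.sdiff_subset
        have h4 := hS' m hm η
        rw [← hω] at h4
        have h5 : ((V \ Finset.Ico a (a + (m : ℤ))).card : ℝ) * (S / ex - Av p a m (u * u) ω)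
          ≤ V.card * (S / ex - Av p a m (u * u) ω) := mul_le_mul_of_nonneg_right h3 (by linarith)
        linarith
      have h6 := mul_le_mul_of_nonneg_left h1 hexpos.le
      have h7 : ex * (S / ex) = S := by field_simp
      calc ex * (2 * lam) * Av p a m (u * u) ω + ex * Av p a m (gen p V u * u + u * gen p V u) ω
          ≤ ex * (2 * lam) * Av p a m (u * u) ω + ex * (V.card * (S / ex - Av p a m (u * u) ω) - 2 * (lam * Av p a m (u * u) ω)) := by linarith
        _ = V.card * (ex * (S / ex) - ex * Av p a m (u * u) ω) := by ring
        _ = _ := by rw [h7]) (⟨m, hm⟩, η) t ⟨ht, le_refl _⟩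
  have h8 : Real.exp (2 * lam * t) * Av p a m (TT p V t g * TT p V t g) (Function.update η (a + m) false) ≤ 1 := key
  have h9 := mul_le_mul_of_nonneg_left h8 (Real.exp_pos (-2 * lam * t)).le
  rw [← mul_assoc, ← Real.exp_add, mul_one] at h9
  have h10 : -2 * lam * t + 2 * lam * t = 0 := by ring
  rw [h10, Real.exp_zero, one_mul] at h9
  exact h9

theorem le_Av {p κ : ℝ} (hp0 : 0 < p) (hp1 : p < 1) (hκ : 0 ≤ κ) (h1 : 1 ≤ κ * p) (h2 : 1 ≤ κ * (1 - p))
    (a : ℤ) (m : ℕ) (v : CC) (hv : ∀ ω, 0 ≤ v ω) (ω : Config) : v ω ≤ κ ^ m * Av p a m v ω := by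
  induction m generalizing ω with
  | zero => simp [Av_zero]
  | succ m ih =>
    have h3 : ∀ (w : CC) (x : ℤ), (∀ ω, 0 ≤ w ω) → w ω ≤ κ * AA p x w ω := by
      intro w x hw
      rw [AA_apply]
      have ht := hw (Function.update ω x true)
      have hf := hw (Function.update ω x false)
      have hq : 0 ≤ κ * (1 - p) := by linarith
      cases hx : ω x
      · have e : w ω = w (Function.update ω x false) := by rw [← hx, Function.update_eq_self]
        rw [e]; nlinarith [mul_nonneg (mul_nonneg hκ hp0.le) ht]
      · have e : w ω = w (Function.update ω x true) := by rw [← hx, Function.update_eq_self]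
        rw [e]; nlinarith [mul_nonneg hq hf]
    have h0 : ∀ ω, 0 ≤ Av p a m v ω := fun ω => by
      have := Av_mono hp0.le hp1.le a m (f := 0) (g := v) hv ω
      rwa [map_zero] at this
    calc v ω ≤ κ ^ m * Av p a m v ω := ih ω
      _ ≤ κ ^ m * (κ * AA p (a + m) (Av p a m v) ω) := by
          gcongr
          exact h3 _ _ h0
      _ = _ := by rw [Av_succ]; ring

theorem DZ {p κ : ℝ} (hp0 : 0 < p) (hp1 : p < 1) (hκ : 0 ≤ κ) (h1 : 1 ≤ κ * p) (h2 : 1 ≤ κ * (1 - p))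
    {lam : ℝ} (hlam : GapIneq p lam)
    (V : Finset ℤ) (a : ℤ) (g : CC) (hg1 : ∀ ω, |g ω| ≤ 1)
    (hg : DependsOnF g (Set.Ici a)) (hga : AA p a g = 0)
    (m : ℕ) (hm : DZi V a m) (ω : Config) (hω : ω (a + m) = false) {t s : ℝ} (ht : 0 ≤ t) (hs : 0 ≤ s) :
    TT p V t (TT p V s g * TT p V s g) ω ≤ κ ^ m * Real.exp (-2 * lam * s) := by
  have hsq : ∀ ω, 0 ≤ (TT p V s g * TT p V s g) ω := fun ω => mul_self_nonneg _
  have hdep : DependsOnF (TT p V s g) (Set.Ici a) :=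
        TT_dep hg (fun x _ hx => by simp only [Set.mem_Ici] at *; omega) s
  have h3 := DZmean hp0.le hp1.le V a (TT p V s g * TT p V s g) (Real.exp (-2 * lam * s))
    (fun ζ ζ' h => by simp [hdep ζ ζ' h])
    (fun m hm η => DZvar hp0.le hp1.le hlam V a g hg1 hg hga m hm η hs) m hm ω ht
  have h4 : Function.update ω (a + m) false = ω := by rw [← hω, Function.update_eq_self]
  rw [h4] at h3
  have h5 := le_Av hp0 hp1 hκ h1 h2 a m (TT p V t (TT p V s g * TT p V s g))
    (fun ζ => TT_ge hp0.le hp1.le V _ 0 hsq ht ζ) ω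
  exact h5.trans (by gcongr)

/-- Finite volume mixing estimate. -/
theorem KEY_fin {p κ : ℝ} (hp0 : 0 < p) (hp1 : p < 1) (hκ : 0 ≤ κ) (h1 : 1 ≤ κ * p) (h2 : 1 ≤ κ * (1 - p))
    {lam : ℝ} (hlam : GapIneq p lam)
    (V : Finset ℤ) (a : ℤ) (F g : CC) (hF1 : ∀ ω, |F ω| ≤ 1) (hg1 : ∀ ω, |g ω| ≤ 1)
    (hg : DependsOnF g (Set.Ici a)) (hga : AA p a g = 0)
    (m : ℕ) (hm : DZi V a m) (ω : Config) (hω : ω (a + m) = false) {t s : ℝ} (ht : 0 ≤ t) (hs : 0 ≤ s)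
    (γ : ℝ) (hγ : ∀ ω, |TT p V s (F * g) ω - TT p V s F ω * TT p V s g ω| ≤ γ) :
    |TT p V (t + s) (F * g) ω| ≤ γ + Real.sqrt (κ ^ m) * Real.exp (-lam * s) := by
  set l := Real.sqrt (κ ^ m) * Real.exp (-lam * s) with hl
  have hκ0 : 0 < κ := by
    rcases hκ.eq_or_lt with h | h
    · rw [← h] at h1; linarith
    · exact h
  have hlpos : 0 < l := by positivity
  have hl2 : l * l = κ ^ m * Real.exp (-2 * lam * s) := by
    rw [hl, show -2 * lam * s = -lam * s + -lam * s by ring, Real.exp_add]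
    have := Real.mul_self_sqrt (by positivity : 0 ≤ κ ^ m)
    calc _ = (Real.sqrt (κ ^ m) * Real.sqrt (κ ^ m)) * (Real.exp (-lam * s) * Real.exp (-lam * s)) := by ring
      _ = _ := by rw [this]
  have hDZ := DZ hp0 hp1 hκ h1 h2 hlam V a g hg1 hg hga m hm ω hω ht hs
  rw [← hl2] at hDZ
  -- pointwise bound at time s
  have hpt : ∀ ζ, |TT p V s (F * g) ζ| ≤ γ + (l / 2 + (TT p V s g * TT p V s g) ζ / (2 * l)) := by
    intro ζ
    have e1 := hγ ζ
    have e2 : |TT p V s F ζ * TT p V s g ζ| ≤ |TT p V s g ζ| := by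
      rw [abs_mul]
      exact mul_le_of_le_one_left (abs_nonneg _) (TT_abs hp0.le hp1.le V F 1 hF1 hs ζ)
    have e3 : |TT p V s g ζ| ≤ l / 2 + (TT p V s g * TT p V s g) ζ / (2 * l) := by
      rw [ContinuousMap.mul_apply, ← abs_mul_abs_self]
      have : l / 2 + |TT p V s g ζ| * |TT p V s g ζ| / (2 * l) - |TT p V s g ζ|
        = (l - |TT p V s g ζ|) ^ 2 / (2 * l) := by field_simp; ring
      have : 0 ≤ (l - |TT p V s g ζ|) ^ 2 / (2 * l) := by positivity
      linarith
    have e4 := abs_sub_abs_le_abs_sub (TT p V s (F * g) ζ) (TT p V s F ζ * TT p V s g ζ)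
    linarith
  set W : CC := (ContinuousMap.const Config (γ + l / 2)) + (2 * l)⁻¹ • (TT p V s g * TT p V s g) with hW
  have hWapp : ∀ ζ, W ζ = γ + (l / 2 + (TT p V s g * TT p V s g) ζ / (2 * l)) := by
    intro ζ
    rw [hW]
    simp only [ContinuousMap.add_apply, ContinuousMap.const_apply, ContinuousMap.smul_apply, smul_eq_mul]
    ring
  have hWT : TT p V t W ω ≤ γ + l := by
    rw [hW, map_add, map_smul]
    have e1 := TT_le hp0.le hp1.le V (ContinuousMap.const Config (γ + l / 2)) (γ + l / 2) (fun _ => le_refl _) ht ω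
    have e2 : (2 * l)⁻¹ * TT p V t (TT p V s g * TT p V s g) ω ≤ (2 * l)⁻¹ * (l * l) := by gcongr
    have e3 : (2 * l)⁻¹ * (l * l) = l / 2 := by field_simp
    rw [ContinuousMap.add_apply, ContinuousMap.smul_apply, smul_eq_mul]
    linarith
  rw [TT_add, abs_le]
  constructor
  · have := TT_mono hp0.le hp1.le V (-W) (TT p V s (F * g)) (fun ζ => by
      rw [ContinuousMap.neg_apply, hWapp]; exact (abs_le.mp (hpt ζ)).1) ht ω
    rw [map_neg, ContinuousMap.neg_apply] at this
    linarith
  · have := TT_mono hp0.le hp1.le V (TT p V s (F * g)) W (fun ζ => by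
      rw [hWapp]; exact (abs_le.mp (hpt ζ)).2) ht ω
    linarith

/-! ### Cylinder functions -/

theorem cyl_continuous {f : Config → ℝ} {S : Finset ℤ} (h : DependsOnF f S) : Continuous f := by
  have e : f = (fun σ : S → Bool => f (fun x => if hx : x ∈ S then σ ⟨x, hx⟩ else true)) ∘
      (fun ω : Config => fun x : S => ω x) := by
    ext ω
    refine h _ _ fun x hx => ?_
    have hx' : x ∈ S := hx
    simp [hx']
  rw [e]
  exact continuous_of_discreteTopology.comp (continuous_pi fun x => continuous_apply _)

/-- Bundle a cylinder function. -/
def cylC {f : Config → ℝ} {S : Finset ℤ} (h : DependsOnF f S) : CC := ⟨f, cyl_continuous h⟩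

/-- The configuration with ones on `T`. -/
def cfg (T : Finset ℤ) : Config := fun x => decide (x ∈ T)

/-- indicator of agreeing with `cfg T` on `S` -/
def ecylF (S T : Finset ℤ) (ω : Config) : ℝ := if ∀ x ∈ S, ω x = cfg T x then 1 else 0

theorem ecylF_dep (S T : Finset ℤ) : DependsOnF (ecylF S T) S := by
  intro ω ω' h
  unfold ecylF
  have : (∀ x ∈ S, ω x = cfg T x) ↔ (∀ x ∈ S, ω' x = cfg T x) :=
    forall₂_congr fun x hx => by rw [h x hx]
  simp only [this]

def ecyl (S T : Finset ℤ) : CC := cylC (ecylF_dep S T)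

theorem ecyl_apply (S T : Finset ℤ) (ω : Config) :
    ecyl S T ω = if ∀ x ∈ S, ω x = cfg T x then 1 else 0 := rfl

theorem cyl_expand {f : Config → ℝ} {S : Finset ℤ} (h : DependsOnF f S) (ω : Config) :
    f ω = ∑ T ∈ S.powerset, f (cfg T) * ecyl S T ω := by
  rw [Finset.sum_eq_single (S.filter fun x => ω x = true)]
  · have h1 : ∀ x ∈ S, ω x = cfg (S.filter fun x => ω x = true) x := by
      intro x hx
      simp only [cfg, Finset.mem_filter, hx, true_and]
      cases ω x <;> simp
    rw [ecyl_apply, if_pos h1, mul_one]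
    exact h _ _ h1
  · intro T hT hne
    rw [ecyl_apply, if_neg, mul_zero]
    intro h1
    apply hne
    ext x
    rw [Finset.mem_filter]
    constructor
    · intro hx
      have hxS := Finset.mem_powerset.mp hT hx
      refine ⟨hxS, ?_⟩
      rw [h1 x hxS]; simpa [cfg] using hx
    · rintro ⟨hxS, hx⟩
      rw [h1 x hxS] at hx
      simpa [cfg] using hx
  · intro hn
    exact absurd (Finset.mem_powerset.mpr (Finset.filter_subset _ _)) hn

theorem cyl_expand' {f : CC} {S : Finset ℤ} (h : DependsOnF f S) :
    f = ∑ T ∈ S.powerset, f (cfg T) • ecyl S T := by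
  ext ω
  rw [ContinuousMap.sum_apply]
  exact cyl_expand h ω

theorem CC_integrable (ν : Measure Config) [IsFiniteMeasure ν] (f : CC) : Integrable f ν :=
  (BoundedContinuousFunction.mkOfCompact f).integrable ν

theorem int_abs_le (ν : Measure Config) [IsProbabilityMeasure ν] (f : Config → ℝ) {M : ℝ}
    (h : ∀ ω, |f ω| ≤ M) : |∫ ω, f ω ∂ν| ≤ M := by
  have := norm_integral_le_of_norm_le_const (μ := ν) (f := f) (C := M) (Eventually.of_forall h)
  simpa using this

theorem eastGen_eq {p : ℝ} {f : CC} {S : Finset ℤ} (h : DependsOnF f S) (ω : Config) :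
    eastGen p f ω = gen p S f ω := by
  have key : ∀ x, (if ω (x + 1) = false then (1 : ℝ) else 0) *
      (if ω x = false then p else 1 - p) * (f (flipAt ω x) - f ω) = kk x ω * (AA p x f ω - f ω) := by
    intro x
    rw [kk_apply, mul_assoc, AA_apply]
    congr 1
    have hf : flipAt ω x = Function.update ω x (!ω x) := by
      ext y
      by_cases hy : y = x
      · subst hy; simp [flipAt]
      · simp [flipAt, hy]
    rw [hf]
    cases hx : ω x
    · have e : f ω = f (Function.update ω x false) := by rw [← hx, Function.update_eq_self]
      rw [e]; simp; ring
    · have e : f ω = f (Function.update ω x true) := by rw [← hx, Function.update_eq_self]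
      rw [e]; simp; ring
  rw [eastGen, gen_apply, tsum_eq_sum (s := S)]
  · exact Finset.sum_congr rfl fun x _ => key x
  · intro x hx
    rw [key, AA_eq_self h (by simpa using hx)]
    simp

/-! ### Product measure and the gap inequality -/

theorem int_ecyl (E : EastProcess) (S T : Finset ℤ) :
    ∫ ω, ecyl S T ω ∂E.μ = ∏ x ∈ S, (if x ∈ T then E.p else 1 - E.p) := by
  have hp0 := E.hp0
  have hp1 := E.hp1
  have hms : MeasurableSet {ω : Config | ∀ x ∈ S, ω x = cfg T x} := by
    have : {ω : Config | ∀ x ∈ S, ω x = cfg T x} = ⋂ x ∈ S, {ω | ω x = cfg T x} := by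
      ext ω; simp
    rw [this]
    exact Finset.measurableSet_biInter S fun x _ => measurableSet_eq_fun (measurable_pi_apply x) measurable_const
  have e : (fun ω => ecyl S T ω) = Set.indicator {ω : Config | ∀ x ∈ S, ω x = cfg T x} 1 := by
    ext ω
    rw [ecyl_apply, Set.indicator_apply]
    rfl
  rw [e, integral_indicator_one hms, Measure.real, E.μprod, ENNReal.toReal_prod]
  refine Finset.prod_congr rfl fun x _ => ?_
  by_cases hx : x ∈ T
  · simp [cfg, hx, hp0.le]
  · simp [cfg, hx]; linarith

theorem int_AA_ecyl (E : EastProcess) (S T : Finset ℤ) (x : ℤ) (hx : x ∈ S) :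
    ∫ ω, AA E.p x (ecyl S T) ω ∂E.μ = ∫ ω, ecyl S T ω ∂E.μ := by
  have e : AA E.p x (ecyl S T) = (if x ∈ T then E.p else 1 - E.p) • ecyl (S.erase x) T := by
    ext ω
    rw [AA_apply, ContinuousMap.smul_apply, smul_eq_mul, ecyl_apply, ecyl_apply, ecyl_apply]
    have h1 : ∀ v, (∀ y ∈ S, Function.update ω x v y = cfg T y) ↔
        (v = cfg T x ∧ ∀ y ∈ S.erase x, ω y = cfg T y) := by
      intro v
      constructor
      · intro h
        refine ⟨by simpa using h x hx, fun y hy => ?_⟩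
        have := h y (Finset.mem_of_mem_erase hy)
        rwa [Function.update_of_ne (Finset.ne_of_mem_erase hy)] at this
      · rintro ⟨h1, h2⟩ y hy
        by_cases hyx : y = x
        · subst hyx; simpa using h1
        · rw [Function.update_of_ne hyx]; exact h2 y (Finset.mem_erase.mpr ⟨hyx, hy⟩)
    by_cases hS : ∀ y ∈ S.erase x, ω y = cfg T y
    · rw [if_pos hS]
      by_cases hT : x ∈ T
      · have h3 : cfg T x = true := by simp [cfg, hT]
        rw [if_pos ((h1 true).mpr ⟨h3.symm, hS⟩), if_neg (fun h => by
          have := ((h1 false).mp h).1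
          rw [h3] at this; simp at this), if_pos hT]
        ring
      · have h3 : cfg T x = false := by simp [cfg, hT]
        rw [if_pos ((h1 false).mpr ⟨h3.symm, hS⟩), if_neg (fun h => by
          have := ((h1 true).mp h).1
          rw [h3] at this; simp at this), if_neg hT]
        ring
    · rw [if_neg hS, if_neg (fun h => hS ((h1 _).mp h).2), if_neg (fun h => hS ((h1 _).mp h).2)]
      ring
  rw [e, int_ecyl, ← Finset.mul_prod_erase S _ hx, ← int_ecyl]
  exact integral_const_mul _ _

theorem int_AA (E : EastProcess) {f : CC} {S : Finset ℤ} (h : DependsOnF f S) (x : ℤ) :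
    ∫ ω, AA E.p x f ω ∂E.μ = ∫ ω, f ω ∂E.μ := by
  have := E.μprob
  have h' : DependsOnF f (insert x S : Finset ℤ) := h.mono (by simp)
  have e := cyl_expand' h'
  set S' := insert x S
  have hf : ∫ ω, f ω ∂E.μ = ∑ T ∈ S'.powerset, f (cfg T) * ∫ ω, ecyl S' T ω ∂E.μ := by
    conv_lhs => rw [e]
    simp only [ContinuousMap.sum_apply, ContinuousMap.smul_apply, smul_eq_mul]
    rw [integral_finsetSum]
    · exact Finset.sum_congr rfl fun T _ => integral_const_mul _ _
    · intro T _
      exact (CC_integrable _ _).const_mul _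
  have hA : ∫ ω, AA E.p x f ω ∂E.μ = ∑ T ∈ S'.powerset, f (cfg T) * ∫ ω, AA E.p x (ecyl S' T) ω ∂E.μ := by
    conv_lhs => rw [e]
    simp only [map_sum, map_smul, ContinuousMap.sum_apply, ContinuousMap.smul_apply, smul_eq_mul]
    rw [integral_finsetSum]
    · exact Finset.sum_congr rfl fun T _ => integral_const_mul _ _
    · intro T _
      exact (CC_integrable _ _).const_mul _
  rw [hf, hA]
  exact Finset.sum_congr rfl fun T _ => by rw [int_AA_ecyl E S' T x (Finset.mem_insert_self _ _)]

theorem AA_dep' {p : ℝ} {f : CC} {S : Set ℤ} (h : DependsOnF f S) (x : ℤ) :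
    DependsOnF (AA p x f) S := (AA_dep h x).mono Set.sdiff_subset

theorem Av_dep' {p : ℝ} {f : CC} {S : Set ℤ} (h : DependsOnF f S) (a : ℤ) (m : ℕ) :
    DependsOnF (Av p a m f) S := by
  induction m with
  | zero => exact h
  | succ m ih => exact AA_dep' ih _

theorem Av_indep (p : ℝ) (f : CC) (a : ℤ) (m : ℕ) :
    DependsOnF (Av p a m f) {x | x < a ∨ a + m ≤ x} := by
  induction m with
  | zero =>
    intro ω ω' h
    have : ω = ω' := by
      ext x
      exact h x (by simp; omega)
    rw [this]
  | succ m ih =>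
    refine (AA_dep ih (a + m)).mono ?_
    rintro x ⟨h1, h2⟩
    simp only [Set.mem_ofPred_eq, Set.mem_singleton_iff] at *
    push_cast
    omega

theorem int_Av (E : EastProcess) {f : CC} {S : Finset ℤ} (h : DependsOnF f S) (a : ℤ) (m : ℕ) :
    ∫ ω, Av E.p a m f ω ∂E.μ = ∫ ω, f ω ∂E.μ := by
  induction m with
  | zero => rfl
  | succ m ih => rw [← ih, Av_succ]; exact int_AA E (Av_dep' h a m) _

/-- keep the sites in `[a,c)`, the others are taken from `ζ` -/
def mg (a c : ℤ) (ζ : Config) : C(Config, Config) :=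
  ⟨fun ω x => if a ≤ x ∧ x < c then ω x else ζ x, by
    refine continuous_pi fun x => ?_
    by_cases h : a ≤ x ∧ x < c
    · simp only [h, and_self, if_true]; exact continuous_apply x
    · simp only [h, if_false]; exact continuous_const⟩

theorem mg_apply (a c : ℤ) (ζ ω : Config) (x : ℤ) :
    mg a c ζ ω x = if a ≤ x ∧ x < c then ω x else ζ x := rfl

theorem pull_mg_dep (a c : ℤ) (ζ : Config) (u : CC) :
    DependsOnF (pull (mg a c ζ) u) (Finset.Ico a c : Finset ℤ) := by
  intro ω ω' h
  rw [pull_apply, pull_apply]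
  congr 1
  ext x
  rw [mg_apply, mg_apply]
  split_ifs with hx
  · exact h x (by simpa using hx)
  · rfl

theorem pull_mg_AA (p : ℝ) (a c : ℤ) (ζ : Config) (u : CC) (x : ℤ) (h1 : a ≤ x) (h2 : x < c) :
    pull (mg a c ζ) (AA p x u) = AA p x (pull (mg a c ζ) u) := by
  have e : ∀ ω v, Function.update (mg a c ζ ω) x v = mg a c ζ (Function.update ω x v) := by
    intro ω v
    ext y
    by_cases hy : y = x
    · subst hy; simp [mg_apply, h1, h2]
    · simp [mg_apply, hy]
  ext ω
  rw [pull_apply, AA_apply, AA_apply, pull_apply, pull_apply, e, e]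

theorem pull_mg_Av (p : ℝ) (a c : ℤ) (ζ : Config) (u : CC) (m : ℕ) (h : a + m ≤ c) :
    pull (mg a c ζ) (Av p a m u) = Av p a m (pull (mg a c ζ) u) := by
  induction m with
  | zero => rfl
  | succ m ih =>
    push_cast at h
    rw [Av_succ, Av_succ, pull_mg_AA p a c ζ _ _ (by omega) (by omega), ih (by omega)]

theorem Av_eq_int (E : EastProcess) (a : ℤ) (m : ℕ) (ζ : Config) (u : CC) :
    Av E.p a m u ζ = ∫ ω, pull (mg a (a + m) ζ) u ω ∂E.μ := by
  have := E.μprob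
  rw [← int_Av E (pull_mg_dep a (a + m) ζ u) a m, ← pull_mg_Av E.p a (a + m) ζ u m le_rfl]
  have : ∀ ω, pull (mg a (a + m) ζ) (Av E.p a m u) ω = Av E.p a m u ζ := by
    intro ω
    rw [pull_apply]
    refine Av_indep E.p u a m _ _ fun x hx => ?_
    simp only [Set.mem_ofPred_eq] at hx
    rw [mg_apply, if_neg (by omega)]
  simp only [this]
  simp

theorem AA_var_nonneg {p : ℝ} (hp0 : 0 ≤ p) (hp1 : p ≤ 1) (x : ℤ) (u : CC) (ω : Config) :
    0 ≤ AA p x (u * u) ω - AA p x u ω * AA p x u ω := by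
  simp only [AA_apply, ContinuousMap.mul_apply]
  nlinarith [mul_nonneg (mul_nonneg hp0 (by linarith : 0 ≤ 1 - p))
    (sq_nonneg (u (Function.update ω x true) - u (Function.update ω x false)))]

theorem AA_dirichlet (p : ℝ) (x : ℤ) (u : CC) :
    AA p x (u * (kk x * (AA p x u - u))) = -(kk x * (AA p x (u * u) - AA p x u * AA p x u)) := by
  ext ζ
  have e1 := AA_upd p x u ζ true
  have e2 := AA_upd p x u ζ false
  rw [AA_apply p x (u * (kk x * (AA p x u - u)))]
  simp only [ContinuousMap.mul_apply, ContinuousMap.sub_apply, ContinuousMap.neg_apply,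
    e1, e2, kk_update x x (by omega)]
  rw [AA_apply p x (u * u)]
  simp only [ContinuousMap.mul_apply]
  rw [AA_apply p x u]
  ring

theorem kk_dep (x : ℤ) : DependsOnF (kk x) ({x + 1} : Finset ℤ) := by
  intro ω ω' h
  rw [kk_apply, kk_apply, h (x + 1) (by simp)]

theorem DependsOnF.mulC {f g : CC} {S : Set ℤ} (hf : DependsOnF f S) (hg : DependsOnF g S) :
    DependsOnF (f * g : CC) S := fun ω ω' h => by
  rw [ContinuousMap.mul_apply, ContinuousMap.mul_apply, hf ω ω' h, hg ω ω' h]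

theorem DependsOnF.subC {f g : CC} {S : Set ℤ} (hf : DependsOnF f S) (hg : DependsOnF g S) :
    DependsOnF (f - g : CC) S := fun ω ω' h => by
  rw [ContinuousMap.sub_apply, ContinuousMap.sub_apply, hf ω ω' h, hg ω ω' h]

theorem gapIneq (E : EastProcess) (hgap : 0 < gap E) : GapIneq E.p (gap E) := by
  intro a m u η h0
  have hμ := E.μprob
  have hp0 := E.hp0.le
  have hp1 := E.hp1.le
  set c := a + (m : ℤ) with hc
  set ζ := Function.update η c false with hζ
  have hζc : ζ c = false := by simp [hζ]
  set f := pull (mg a c ζ) u with hf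
  have hfdep : DependsOnF f (Finset.Ico a c : Finset ℤ) := pull_mg_dep a c ζ u
  have hmean : ∫ ω, f ω ∂E.μ = 0 := by rw [← h0]; exact (Av_eq_int E a m ζ u).symm
  have hsq : Av E.p a m (u * u) ζ = ∫ ω, f ω ^ 2 ∂E.μ := by
    rw [Av_eq_int]
    refine integral_congr_ae (Eventually.of_forall fun ω => ?_)
    simp only [sq]
    rfl
  have hvar : variance f E.μ = ∫ ω, f ω ^ 2 ∂E.μ := by
    rw [variance_of_integral_eq_zero f.continuous.measurable.aemeasurable hmean]
  -- comparison of Dirichlet forms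
  have hterm : ∀ x ∈ Finset.Ico a c, -∫ ω, f ω * (kk x ω * (AA E.p x f ω - f ω)) ∂E.μ ≤
      Av E.p a m (kk x * (AA E.p x (u * u) - AA E.p x u * AA E.p x u)) ζ := by
    intro x hx
    rw [Finset.mem_Ico] at hx
    have e1 : ∫ ω, f ω * (kk x ω * (AA E.p x f ω - f ω)) ∂E.μ
        = ∫ ω, AA E.p x (f * (kk x * (AA E.p x f - f))) ω ∂E.μ := by
      have hd : DependsOnF (f * (kk x * (AA E.p x f - f)) : CC) ((Finset.Ico a c ∪ {x + 1} : Finset ℤ) : Set ℤ) := by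
        have h1 := hfdep.mono (S' := ((Finset.Ico a c ∪ {x + 1} : Finset ℤ) : Set ℤ)) (by
          rw [Finset.coe_union]; exact Set.subset_union_left)
        have h2 := (kk_dep x).mono (S' := ((Finset.Ico a c ∪ {x + 1} : Finset ℤ) : Set ℤ)) (by
          rw [Finset.coe_union]; exact Set.subset_union_right)
        exact h1.mulC (h2.mulC ((AA_dep' h1 x).subC h1))
      rw [int_AA E hd x]
      rfl
    rw [e1, AA_dirichlet, ← integral_neg, Av_eq_int]
    refine integral_mono ((CC_integrable _ _).neg) (CC_integrable _ _) fun ω => ?_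
    rw [pull_apply]
    simp only [ContinuousMap.neg_apply, neg_neg, ContinuousMap.mul_apply, ContinuousMap.sub_apply]
    have e2 : ∀ w : CC, AA E.p x w (mg a c ζ ω) = AA E.p x (pull (mg a c ζ) w) ω := fun w => by
      rw [← pull_mg_AA E.p a c ζ w x hx.1 hx.2]; rfl
    rw [e2, e2]
    have e3 : pull (mg a c ζ) (u * u) = f * f := rfl
    rw [e3]
    refine mul_le_mul_of_nonneg_right ?_ (AA_var_nonneg hp0 hp1 x f ω)
    rw [kk_apply x (mg a c ζ ω), mg_apply]
    by_cases hxc : x + 1 < c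
    · have h4 : a ≤ x + 1 ∧ x + 1 < c := ⟨by omega, hxc⟩
      simp only [h4, and_self, if_true]; exact le_of_eq rfl
    · have : x + 1 = c := by omega
      have h4 : ¬ (a ≤ x + 1 ∧ x + 1 < c) := by omega
      simp only [h4, if_false]
      rw [this, if_pos hζc]
      exact kk_le_one x ω
  have hDir : -∫ ω, f ω * eastGen E.p f ω ∂E.μ = ∑ x ∈ Finset.Ico a c,
      -∫ ω, f ω * (kk x ω * (AA E.p x f ω - f ω)) ∂E.μ := by
    rw [Finset.sum_neg_distrib, ← integral_finsetSum]
    · congr 1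
      refine integral_congr_ae (Eventually.of_forall fun ω => ?_)
      simp only
      rw [eastGen_eq hfdep, gen_apply, Finset.mul_sum]
    · intro x _
      exact CC_integrable _ (f * (kk x * (AA E.p x f - f)))
  have hle : -∫ ω, f ω * eastGen E.p f ω ∂E.μ ≤ ∑ x ∈ Finset.Ico a c,
      Av E.p a m (kk x * (AA E.p x (u * u) - AA E.p x u * AA E.p x u)) ζ := by
    rw [hDir]; exact Finset.sum_le_sum hterm
  refine le_trans ?_ hle
  rw [hsq, ← hvar]
  have hvn : 0 ≤ variance f E.μ := variance_nonneg _ _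
  rcases hvn.eq_or_lt with hv | hv
  · rw [← hv, mul_zero, hDir]
    -- nonnegativity of the Dirichlet form
    refine Finset.sum_nonneg fun x hx => ?_
    have hd : DependsOnF (f * (kk x * (AA E.p x f - f)) : CC) ((Finset.Ico a c ∪ {x + 1} : Finset ℤ) : Set ℤ) := by
      have h1 := hfdep.mono (S' := ((Finset.Ico a c ∪ {x + 1} : Finset ℤ) : Set ℤ)) (by
        rw [Finset.coe_union]; exact Set.subset_union_left)
      have h2 := (kk_dep x).mono (S' := ((Finset.Ico a c ∪ {x + 1} : Finset ℤ) : Set ℤ)) (by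
        rw [Finset.coe_union]; exact Set.subset_union_right)
      exact h1.mulC (h2.mulC ((AA_dep' h1 x).subC h1))
    have e1 : ∫ ω, f ω * (kk x ω * (AA E.p x f ω - f ω)) ∂E.μ
        = ∫ ω, AA E.p x (f * (kk x * (AA E.p x f - f))) ω ∂E.μ := by
      rw [int_AA E hd x]
      rfl
    rw [e1, AA_dirichlet, ← integral_neg]
    refine integral_nonneg fun ω => ?_
    simp only [ContinuousMap.neg_apply, neg_neg, ContinuousMap.mul_apply, ContinuousMap.sub_apply]
    exact mul_nonneg (kk_nonneg x ω) (AA_var_nonneg hp0 hp1 x f ω)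
  · have hbdd : BddBelow (gapSet E) := by
      by_contra hb
      rw [gap, Real.sInf_of_not_bddBelow hb] at hgap
      exact lt_irrefl _ hgap
    have := csInf_le hbdd (⟨f, ⟨_, hfdep⟩, hv, rfl⟩ : _ ∈ gapSet E)
    rwa [← gap, le_div_iff₀ hv] at this

/-! ### The infinite volume semigroup -/

instance instMarkovEast (E : EastProcess) (t : ℝ) : IsMarkovKernel (E.P t) := E.markov t

/-- Expectation at time `t`. -/
def EP (E : EastProcess) (t : ℝ) (f : Config → ℝ) (ω : Config) : ℝ := ∫ η, f η ∂(E.P t ω)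

theorem EP_zero (E : EastProcess) (f : CC) (ω : Config) : EP E 0 f ω = f ω := by
  rw [EP, E.P0, Kernel.id_apply, integral_dirac]

theorem EP_add (E : EastProcess) {t s : ℝ} (ht : 0 ≤ t) (hs : 0 ≤ s) {f : Config → ℝ}
    (hf : Measurable f) {M : ℝ} (hM : ∀ ω, |f ω| ≤ M) (ω : Config) :
    EP E (t + s) f ω = EP E t (EP E s f) ω := by
  unfold EP
  rw [E.semigroup s t hs ht, Kernel.integral_comp]
  exact Integrable.of_bound hf.aestronglyMeasurable M (Eventually.of_forall hM)

theorem EP_cont (E : EastProcess) {t : ℝ} (ht : 0 ≤ t) (f : CC) : Continuous (EP E t f) :=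
  E.feller t ht f f.continuous

theorem EP_abs (E : EastProcess) (t : ℝ) {f : Config → ℝ} {M : ℝ} (hM : ∀ ω, |f ω| ≤ M) (ω : Config) :
    |EP E t f ω| ≤ M := int_abs_le _ _ hM

/-- For a pointwise right derivative at `0` and a maximum. -/
theorem deriv_nonpos_of_le {φ : ℝ → ℝ} {d : ℝ} (h : HasDerivWithinAt φ d (Set.Ici 0) 0)
    (hle : ∀ t, 0 ≤ t → φ t ≤ φ 0) : d ≤ 0 := by
  have h1 := h.mono Set.Ioi_subset_Ici_self
  rw [hasDerivWithinAt_iff_tendsto_slope' (by simp)] at h1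
  refine le_of_tendsto h1 ?_
  filter_upwards [self_mem_nhdsWithin] with t ht
  rw [slope_def_field]
  exact div_nonpos_of_nonpos_of_nonneg (by linarith [hle t (le_of_lt ht)]) (by
    have : (0 : ℝ) < t := ht
    linarith)

theorem exp_int (E : EastProcess) (h : CC) (ω : Config) {a : ℝ} :
    IntegrableOn (fun s => Real.exp (-s) * EP E s h ω) (Set.Ioi a) := by
  have h1 : IntegrableOn (fun s : ℝ => Real.exp (-s) * ‖h‖) (Set.Ioi a) :=
    (integrableOn_exp_neg_Ioi a).mul_const _
  refine h1.mono' ?_ (Eventually.of_forall fun s => ?_)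
  · exact ((Real.continuous_exp.comp continuous_neg).mul (E.timeCont h h.continuous ω)).aestronglyMeasurable
  · rw [norm_mul, Real.norm_of_nonneg (Real.exp_pos _).le]
    gcongr
    exact EP_abs E s (fun ζ => h.norm_coe_le_norm ζ) ω

theorem EP_meas (E : EastProcess) (t : ℝ) {f : Config → ℝ} (hf : Measurable f) : Measurable (EP E t f) :=
  (hf.stronglyMeasurable.integral_kernel).measurable

theorem resolvent_shift (E : EastProcess) (h : CC) (ω : Config) {t : ℝ} (ht : 0 ≤ t) :
    EP E t (fun η => ∫ s in Set.Ioi (0 : ℝ), Real.exp (-s) * EP E s h η) ω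
      = Real.exp t * ((∫ s in Set.Ioi (0 : ℝ), Real.exp (-s) * EP E s h ω)
        - ∫ s in (0 : ℝ)..t, Real.exp (-s) * EP E s h ω) := by
  have hmeas : Measurable (Function.uncurry fun (s : ℝ) (η : Config) => Real.exp (-s) * EP E s h η) := by
    refine measurable_uncurry_of_continuous_of_measurable ?_ ?_
    · intro η
      exact (Real.continuous_exp.comp continuous_neg).mul (E.timeCont h h.continuous η)
    · intro s
      exact (EP_meas E s h.continuous.measurable).const_mul _
  have hswap : EP E t (fun η => ∫ s in Set.Ioi (0 : ℝ), Real.exp (-s) * EP E s h η) ω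
      = ∫ s in Set.Ioi (0 : ℝ), Real.exp (-s) * EP E (t + s) h ω := by
    rw [EP, integral_integral_swap]
    · refine setIntegral_congr_fun measurableSet_Ioi fun s hs => ?_
      rw [integral_const_mul]
      congr 1
      exact (EP_add E ht (le_of_lt hs) h.continuous.measurable (fun ζ => h.norm_coe_le_norm ζ) ω).symm
    · have h1 : Integrable (fun s : ℝ => Real.exp (-s) * ‖h‖) (volume.restrict (Set.Ioi 0)) :=
        (integrableOn_exp_neg_Ioi 0).mul_const _
      have h2 := h1.comp_snd (E.P t ω)
      refine h2.mono' ?_ (Eventually.of_forall fun z => ?_)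
      · exact (hmeas.comp measurable_swap).aestronglyMeasurable
      · obtain ⟨η, s⟩ := z
        simp only [Function.uncurry]
        rw [norm_mul, Real.norm_of_nonneg (Real.exp_pos _).le]
        gcongr
        exact EP_abs E s (fun ζ => h.norm_coe_le_norm ζ) η
  rw [hswap, intervalIntegral.integral_Ioi_sub_Ioi' (exp_int E h ω) (exp_int E h ω) |>.symm]
  have h2 := (measurePreserving_add_right volume t).setIntegral_preimage_emb
    (measurableEmbedding_addRight t) (fun s => Real.exp (-s) * EP E s h ω) (Set.Ioi t)
  have h3 : (fun x => x + t) ⁻¹' Set.Ioi t = Set.Ioi 0 := by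
    ext x; simp
  rw [h3] at h2
  rw [sub_sub_cancel, ← h2, ← integral_const_mul]
  refine setIntegral_congr_fun measurableSet_Ioi fun s hs => ?_
  rw [← mul_assoc, ← Real.exp_add, add_comm t s]
  congr 2
  ring

theorem EP_sub (E : EastProcess) (t : ℝ) (f g : CC) (ω : Config) :
    EP E t (f - g : CC) ω = EP E t f ω - EP E t g ω :=
  integral_sub (CC_integrable _ f) (CC_integrable _ g)

theorem EP_addC (E : EastProcess) (t : ℝ) (f g : CC) (ω : Config) :
    EP E t (f + g : CC) ω = EP E t f ω + EP E t g ω :=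
  integral_add (CC_integrable _ f) (CC_integrable _ g)

theorem EP_smul (E : EastProcess) (t : ℝ) (c : ℝ) (f : CC) (ω : Config) :
    EP E t (c • f : CC) ω = c * EP E t f ω :=
  integral_const_mul _ _

theorem EP_mono (E : EastProcess) (t : ℝ) {f g : CC} (h : ∀ ω, f ω ≤ g ω) (ω : Config) :
    EP E t f ω ≤ EP E t g ω :=
  integral_mono (CC_integrable _ f) (CC_integrable _ g) h

theorem EP_integral_form (E : EastProcess) {f : CC} {S : Finset ℤ} (hf : DependsOnF f S)
    (ω : Config) {t : ℝ} (ht : 0 ≤ t) :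
    EP E t f ω = Real.exp t * (f ω - ∫ s in (0 : ℝ)..t, Real.exp (-s) * EP E s (f - gen E.p S f : CC) ω) := by
  set h : CC := f - gen E.p S f with hh
  have hucont : Continuous fun η => ∫ s in Set.Ioi (0 : ℝ), Real.exp (-s) * EP E s h η := by
    refine continuous_of_dominated (bound := fun s : ℝ => Real.exp (-s) * ‖h‖) ?_ ?_ ?_ ?_
    · intro η
      exact ((Real.continuous_exp.comp continuous_neg).mul (E.timeCont h h.continuous η)).aestronglyMeasurable
    · intro η
      refine Eventually.of_forall fun s => ?_
      rw [norm_mul, Real.norm_of_nonneg (Real.exp_pos _).le]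
      gcongr
      exact EP_abs E s (fun ζ => h.norm_coe_le_norm ζ) η
    · exact (integrableOn_exp_neg_Ioi 0).mul_const _
    · refine (ae_restrict_iff' measurableSet_Ioi).mpr (Eventually.of_forall fun s hs => ?_)
      exact (EP_cont E (le_of_lt hs) h).const_mul _ 
  set u : CC := ⟨_, hucont⟩ with hu
  have huapp : ∀ η, u η = ∫ s in Set.Ioi (0 : ℝ), Real.exp (-s) * EP E s h η := fun _ => rfl
  have hPu : ∀ η, ∀ t, 0 ≤ t → EP E t u η = Real.exp t * (u η - ∫ s in (0 : ℝ)..t, Real.exp (-s) * EP E s h η) :=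
    fun η t ht => resolvent_shift E h η ht
  have hder : ∀ η, HasDerivWithinAt (fun t => EP E t u η) (u η - h η) (Set.Ici 0) 0 := by
    intro η
    have hc : Continuous fun s => Real.exp (-s) * EP E s h η :=
      (Real.continuous_exp.comp continuous_neg).mul (E.timeCont h h.continuous η)
    have h1 : HasDerivAt (fun t => ∫ s in (0 : ℝ)..t, Real.exp (-s) * EP E s h η)
        (Real.exp (-0) * EP E 0 h η) 0 :=
      intervalIntegral.integral_hasDerivAt_right (hc.intervalIntegrable _ _)
        (hc.stronglyMeasurableAtFilter _ _) hc.continuousAt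
    have h2 := (Real.hasDerivAt_exp 0).mul (h1.const_sub (u η))
    have h3 : HasDerivWithinAt (fun t => Real.exp t * (u η - ∫ s in (0 : ℝ)..t, Real.exp (-s) * EP E s h η))
        (u η - h η) (Set.Ici 0) 0 := by
      have h4 := h2.hasDerivWithinAt (s := Set.Ici 0)
      refine h4.congr_deriv ?_
      rw [EP_zero]
      simp
      try ring
    exact h3.congr (fun t ht => hPu η t ht) (hPu η 0 le_rfl)
  have hfd : ∀ η, HasDerivWithinAt (fun t => EP E t f η) (gen E.p S f η) (Set.Ici 0) 0 := by
    intro η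
    rw [← eastGen_eq hf]
    exact E.generator f ⟨S, hf⟩ η
  have key : ∀ w : CC, (∀ η, HasDerivWithinAt (fun t => EP E t w η) (w η) (Set.Ici 0) 0) → ∀ η, w η ≤ 0 := by
    intro w hw η
    obtain ⟨η0, -, hmax⟩ := isCompact_univ.exists_isMaxOn (Set.univ_nonempty (α := Config)) w.continuous.continuousOn
    have hm : ∀ ζ, w ζ ≤ w η0 := fun ζ => hmax (Set.mem_univ ζ)
    refine (hm η).trans (deriv_nonpos_of_le (hw η0) fun t ht => ?_)
    rw [EP_zero]
    have := EP_mono E t (f := w) (g := ContinuousMap.const Config (w η0)) hm η0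
    simpa [EP] using this
  have hfu : ∀ η, f η = u η := by
    intro η
    have h1 := key (f - u) (fun η => by
      have := (hfd η).sub (hder η)
      have e : (fun t => EP E t (f - u : CC) η) = (fun t => EP E t f η) - fun t => EP E t u η := by
        ext t; exact EP_sub E t f u η
      rw [e]
      refine this.congr_deriv ?_
      rw [hh]; simp; ring) η
    have h2 := key (u - f) (fun η => by
      have := (hder η).sub (hfd η)
      have e : (fun t => EP E t (u - f : CC) η) = (fun t => EP E t u η) - fun t => EP E t f η := by
        ext t; exact EP_sub E t u f η
      rw [e]
      refine this.congr_deriv ?_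
      rw [hh]; simp; try ring) η
    rw [ContinuousMap.sub_apply] at h1 h2
    linarith
  have hfu' : f = u := by ext η; exact hfu η
  have := hPu ω t ht
  rw [← hfu'] at this
  exact this

/-- Kolmogorov equation for cylinder functions. -/
theorem EP_hasDerivAt (E : EastProcess) {f : CC} {S : Finset ℤ} (hf : DependsOnF f S)
    (ω : Config) {t : ℝ} (ht : 0 < t) :
    HasDerivAt (fun t => EP E t f ω) (EP E t (gen E.p S f) ω) t := by
  set h : CC := f - gen E.p S f with hh
  have hc : Continuous fun s => Real.exp (-s) * EP E s h ω :=
    (Real.continuous_exp.comp continuous_neg).mul (E.timeCont h h.continuous ω)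
  have h1 : HasDerivAt (fun t => ∫ s in (0 : ℝ)..t, Real.exp (-s) * EP E s h ω)
      (Real.exp (-t) * EP E t h ω) t :=
    intervalIntegral.integral_hasDerivAt_right (hc.intervalIntegrable _ _)
      (hc.stronglyMeasurableAtFilter _ _) hc.continuousAt
  have h2 := (Real.hasDerivAt_exp t).mul (h1.const_sub (f ω))
  have h3 : HasDerivAt (fun t => Real.exp t * (f ω - ∫ s in (0 : ℝ)..t, Real.exp (-s) * EP E s h ω))
      (EP E t (gen E.p S f) ω) t := by
    refine h2.congr_deriv ?_
    have e1 := EP_integral_form E hf ω ht.le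
    rw [← e1, hh, EP_sub, mul_neg, ← mul_assoc, ← Real.exp_add]
    simp
  refine h3.congr_of_eventuallyEq ?_
  filter_upwards [lt_mem_nhds ht] with s hs
  exact EP_integral_form E hf ω hs.le

theorem EP_tcont (E : EastProcess) (f : CC) (ω : Config) : Continuous fun t => EP E t f ω :=
  E.timeCont f f.continuous ω

theorem EP_sum (E : EastProcess) (t : ℝ) {ι : Type*} (s : Finset ι) (f : ι → CC) (ω : Config) :
    EP E t (∑ i ∈ s, f i : CC) ω = ∑ i ∈ s, EP E t (f i) ω := by
  unfold EP
  simp only [ContinuousMap.sum_apply]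
  exact integral_finsetSum _ fun i _ => CC_integrable _ _

/-- Pairing a time dependent cylinder function with the semigroup. -/
theorem PAIR (E : EastProcess) (S : Finset ℤ) (u u' : ℝ → CC) (hS : ∀ s, DependsOnF (u s) S)
    (hu : ∀ s, HasDerivAt u (u' s) s) (ω : Config) {t s : ℝ} (hs : s < t) :
    HasDerivAt (fun s => EP E (t - s) (u s) ω) (EP E (t - s) (u' s - gen E.p S (u s) : CC) ω) s := by
  have e : ∀ s, u s = ∑ T ∈ S.powerset, u s (cfg T) • ecyl S T := fun s => cyl_expand' (hS s)
  have e1 : (fun s => EP E (t - s) (u s) ω) = fun s => ∑ T ∈ S.powerset, u s (cfg T) * EP E (t - s) (ecyl S T) ω := by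
    ext r
    conv_lhs => rw [e r]
    rw [EP_sum]
    exact Finset.sum_congr rfl fun T _ => EP_smul _ _ _ _ _
  have hS' : DependsOnF (u' s) S := by
    intro ζ ζ' h
    have h1 := hasDerivAt_eval (hu s) ζ
    have h2 := hasDerivAt_eval (hu s) ζ'
    have h3 : (fun r => u r ζ) = fun r => u r ζ' := by
      ext r; exact hS r ζ ζ' h
    rw [h3] at h1
    exact h1.unique h2
  have hd : ∀ T ∈ S.powerset, HasDerivAt (fun s => u s (cfg T) * EP E (t - s) (ecyl S T) ω)
      (u' s (cfg T) * EP E (t - s) (ecyl S T) ω + u s (cfg T) * (-(EP E (t - s) (gen E.p S (ecyl S T)) ω))) s := by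
    intro T _
    have h1 := hasDerivAt_eval (hu s) (cfg T)
    have h2 := (EP_hasDerivAt E (ecylF_dep S T) ω (sub_pos.mpr hs) (f := ecyl S T))
    have h3 := HasDerivAt.comp s h2 ((hasDerivAt_id s).const_sub t)
    have h4 := h1.mul h3
    refine h4.congr_deriv ?_
    simp
  have h5 := HasDerivAt.fun_sum hd
  rw [e1]
  refine h5.congr_deriv (Eq.symm ?_)
  rw [EP_sub, Finset.sum_add_distrib]
  have e2 : EP E (t - s) (u' s) ω = ∑ T ∈ S.powerset, u' s (cfg T) * EP E (t - s) (ecyl S T) ω := by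
    conv_lhs => rw [cyl_expand' hS']
    rw [EP_sum]
    exact Finset.sum_congr rfl fun T _ => EP_smul _ _ _ _ _
  have e3 : EP E (t - s) (gen E.p S (u s)) ω = ∑ T ∈ S.powerset, u s (cfg T) * EP E (t - s) (gen E.p S (ecyl S T)) ω := by
    conv_lhs => rw [e s, map_sum]
    rw [EP_sum]
    refine Finset.sum_congr rfl fun T _ => ?_
    rw [map_smul, EP_smul]
  rw [e2, e3, sub_eq_add_neg, ← Finset.sum_neg_distrib]
  congr 1
  exact Finset.sum_congr rfl fun T _ => by ring

theorem PAIR_cont (E : EastProcess) (S : Finset ℤ) (u : ℝ → CC) (hS : ∀ s, DependsOnF (u s) S)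
    (hu : Continuous u) (ω : Config) (t : ℝ) :
    Continuous (fun s => EP E (t - s) (u s) ω) := by
  have e1 : (fun s => EP E (t - s) (u s) ω) = fun s => ∑ T ∈ S.powerset, u s (cfg T) * EP E (t - s) (ecyl S T) ω := by
    ext r
    conv_lhs => rw [cyl_expand' (hS r)]
    rw [EP_sum]
    exact Finset.sum_congr rfl fun T _ => EP_smul _ _ _ _ _
  rw [e1]
  refine continuous_finsetSum _ fun T _ => ?_
  exact ((evC (cfg T)).continuous.comp hu).mul ((EP_tcont E _ ω).comp (continuous_const.sub continuous_id))

/-- Comparison: approximate subsolutions. -/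
theorem subsol (E : EastProcess) (S : Finset ℤ) (u u' : ℝ → CC) (hS : ∀ s, DependsOnF (u s) S)
    (hu : ∀ s, HasDerivAt u (u' s) s) {t ε : ℝ} (ht : 0 ≤ t)
    (hle : ∀ s ∈ Set.Ioo 0 t, ∀ ζ, u' s ζ ≤ gen E.p S (u s) ζ + ε) (ω : Config) :
    u t ω ≤ EP E t (u 0) ω + ε * t := by
  have hc : Continuous u := continuous_iff_continuousAt.mpr fun s => (hu s).continuousAt
  have hanti : AntitoneOn (fun s => EP E (t - s) (u s) ω - ε * s) (Set.Icc 0 t) := by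
    apply antitoneOn_of_deriv_nonpos (convex_Icc 0 t)
    · exact ((PAIR_cont E S u hS hc ω t).sub (continuous_const.mul continuous_id)).continuousOn
    · intro s hs
      rw [interior_Icc] at hs
      exact ((PAIR E S u u' hS hu ω hs.2).sub ((hasDerivAt_id s).const_mul ε)).differentiableAt.differentiableWithinAt
    · intro s hs
      rw [interior_Icc] at hs
      have hd : HasDerivAt (fun s => EP E (t - s) (u s) ω - ε * s)
          (EP E (t - s) (u' s - gen E.p S (u s) : CC) ω - ε * 1) s :=
        (PAIR E S u u' hS hu ω hs.2).sub ((hasDerivAt_id s).const_mul ε)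
      rw [hd.deriv]
      have := EP_mono E (t - s) (f := u' s - gen E.p S (u s)) (g := ContinuousMap.const Config ε) (fun ζ => by
        have := hle s hs ζ
        rw [ContinuousMap.sub_apply, ContinuousMap.const_apply]
        linarith) ω
      have h2 : EP E (t - s) (ContinuousMap.const Config ε) ω = ε := by simp [EP]
      rw [h2] at this
      simpa using this
  have h := hanti (⟨le_rfl, ht⟩ : (0 : ℝ) ∈ Set.Icc 0 t) (⟨ht, le_rfl⟩ : t ∈ Set.Icc 0 t) ht
  simp only [sub_self, sub_zero, mul_zero] at h
  rw [EP_zero] at h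
  linarith

/-- Finite volume approximation, quantitative. -/
theorem TT_approx_one (E : EastProcess) (f : CC) (M : ℝ) (hM : ∀ ω, |f ω| ≤ M) (a : ℤ) (n : ℕ) (k : ℕ)
    (hf : DependsOnF f (Finset.Icc (-(n : ℤ)) (n + 1) : Finset ℤ)) (ha : DependsOnF f (Set.Iic a)) (hk : (n : ℤ) + 1 = a + k)
    {t : ℝ} (ht : 0 ≤ t) (ω : Config) :
    TT E.p (Finset.Icc (-(n : ℤ)) n) t f ω ≤ EP E t f ω + 2 * M * (t ^ k / k.factorial) * t := by
  have hp0 := E.hp0.le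
  have hp1 := E.hp1.le
  have hM0 : 0 ≤ M := (abs_nonneg _).trans (hM ω)
  set V := Finset.Icc (-(n : ℤ)) n with hV
  have h := subsol E (Finset.Icc (-(n : ℤ)) (n + 1)) (fun s => TT E.p V s f) (fun s => gen E.p V (TT E.p V s f))
    (fun s => TT_dep hf (fun x hx _ => by
      rw [hV, Finset.mem_Icc] at hx
      rw [Finset.mem_coe, Finset.mem_Icc]; omega) s)
    (fun s => TT_hasDerivAt E.p V f s) ht (ε := 2 * M * (t ^ k / k.factorial)) (fun s hs ζ => by
      have hins : Finset.Icc (-(n : ℤ)) (n + 1) = insert ((n : ℤ) + 1) V := by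
        ext x
        rw [hV, Finset.mem_insert, Finset.mem_Icc, Finset.mem_Icc]; omega
      rw [gen_apply, gen_apply, hins, Finset.sum_insert (by rw [hV, Finset.mem_Icc]; omega)]
      have h1 := AA_sub_abs hp0 hp1 ((n : ℤ) + 1) (TT E.p V s f) ζ
      have h2 := FS hp0 hp1 V a M k f hM ha s hs.1.le ζ
      rw [← hk] at h2
      have h3 : 2 * M * (s ^ k / k.factorial) ≤ 2 * M * (t ^ k / k.factorial) := by
        have := pow_le_pow_left₀ hs.1.le hs.2.le k
        gcongr
      have h4 := (abs_le.mp (h1.trans (h2.trans h3))).1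
      have h5 : 0 ≤ 2 * M * (t ^ k / k.factorial) := by positivity
      nlinarith [kk_nonneg ((n : ℤ) + 1) ζ, kk_le_one ((n : ℤ) + 1) ζ]) ω
  simpa [TT_zero] using h

theorem TT_tendsto (E : EastProcess) (f : CC) {S : Finset ℤ} (hf : DependsOnF f S)
    {t : ℝ} (ht : 0 ≤ t) (ω : Config) :
    Tendsto (fun n : ℕ => TT E.p (Finset.Icc (-(n : ℤ)) n) t f ω) atTop (𝓝 (EP E t f ω)) := by
  obtain ⟨a, ha⟩ : ∃ a : ℕ, ∀ x ∈ S, |x| ≤ a := by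
    obtain ⟨B, hB⟩ := (S.image fun x => x.natAbs).bddAbove
    refine ⟨B, fun x hx => ?_⟩
    have := hB (Finset.mem_coe.mpr (Finset.mem_image_of_mem (fun x : ℤ => x.natAbs) hx))
    change x.natAbs ≤ B at this
    rw [abs_le]
    omega
  have hlim : Tendsto (fun k : ℕ => 2 * ‖f‖ * (t ^ k / k.factorial) * t) atTop (𝓝 (2 * ‖f‖ * 0 * t)) :=
    ((FloorSemiring.tendsto_pow_div_factorial_atTop t).const_mul _).mul_const _
  rw [mul_zero, zero_mul] at hlim
  have hlim2 : Tendsto (fun n : ℕ => 2 * ‖f‖ * (t ^ (n + 1 - a) / (n + 1 - a).factorial) * t) atTop (𝓝 0) :=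
    hlim.comp (tendsto_atTop_atTop.mpr fun b => ⟨b + a, fun n hn => by omega⟩)
  rw [tendsto_iff_dist_tendsto_zero]
  refine squeeze_zero' (Eventually.of_forall fun n => dist_nonneg) ?_ hlim2
  filter_upwards [eventually_ge_atTop a] with n hn
  have hk : (n : ℤ) + 1 = a + (n + 1 - a : ℕ) := by omega
  have hd1 : DependsOnF f (Finset.Icc (-(n : ℤ)) (n + 1) : Finset ℤ) := hf.mono fun x hx => by
    have := abs_le.mp (ha x hx)
    rw [Finset.mem_coe, Finset.mem_Icc]; omega
  have hd2 : DependsOnF f (Set.Iic (a : ℤ)) := hf.mono fun x hx => (abs_le.mp (ha x hx)).2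
  have h1 := TT_approx_one E f ‖f‖ (fun ζ => f.norm_coe_le_norm ζ) a n _ hd1 hd2 hk ht ω
  have h2 := TT_approx_one E (-f) ‖f‖ (fun ζ => by simpa using f.norm_coe_le_norm ζ) a n _
    (fun ζ ζ' h => by simp [hd1 ζ ζ' h]) (fun ζ ζ' h => by simp [hd2 ζ ζ' h]) hk ht ω
  rw [map_neg, ContinuousMap.neg_apply] at h2
  have h3 : EP E t (-f : CC) ω = - EP E t f ω := integral_neg _
  rw [h3] at h2
  rw [Real.dist_eq, abs_le]
  constructor <;> linarith

/-! ### Key estimate in infinite volume -/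

def kap (E : EastProcess) : ℝ := E.p⁻¹ + (1 - E.p)⁻¹

theorem kap_facts (E : EastProcess) : 1 ≤ kap E ∧ 1 ≤ kap E * E.p ∧ 1 ≤ kap E * (1 - E.p) := by
  have h0 := E.hp0
  have h1 : 0 < 1 - E.p := by linarith [E.hp1]
  have i0 : 0 < E.p⁻¹ := inv_pos.mpr h0
  have i1 : 0 < (1 - E.p)⁻¹ := inv_pos.mpr h1
  have e0 : E.p⁻¹ * E.p = 1 := inv_mul_cancel₀ h0.ne'
  have e1 : (1 - E.p)⁻¹ * (1 - E.p) = 1 := inv_mul_cancel₀ h1.ne'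
  have p0 := mul_pos i1 h0
  have p1 := mul_pos i0 h1
  unfold kap
  refine ⟨?_, ?_, ?_⟩ <;> nlinarith

theorem TT_one {p : ℝ} (hp0 : 0 ≤ p) (hp1 : p ≤ 1) (V : Finset ℤ) {t : ℝ} (ht : 0 ≤ t) (ω : Config) :
    TT p V t (1 : CC) ω = 1 :=
  le_antisymm (TT_le hp0 hp1 V 1 1 (fun _ => le_rfl) ht ω) (TT_ge hp0 hp1 V 1 1 (fun _ => le_rfl) ht ω)

theorem DZi_ev (a : ℤ) (m : ℕ) (hm : 1 ≤ m) : ∀ᶠ n : ℕ in atTop, DZi (Finset.Icc (-(n : ℤ)) n) a m := by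
  filter_upwards [eventually_ge_atTop (a.natAbs + m)] with n hn
  refine ⟨hm, fun x h1 h2 => ?_⟩
  rw [Finset.mem_Icc]; omega

theorem KEYI (E : EastProcess) (hgap : 0 < gap E) (F g : CC) {S : Finset ℤ} (hFS : DependsOnF F S)
    (hgS : DependsOnF g S) (y : ℤ) (L : ℕ) (hF : DependsOnF F (Set.Iic y))
    (hg : DependsOnF g (Set.Ici (y + L))) (hF1 : ∀ ω, |F ω| ≤ 1) (hg1 : ∀ ω, |g ω| ≤ 1)
    (hga : AA E.p (y + L) g = 0) (m : ℕ) (hm : 1 ≤ m) (ω : Config) (hω : ω (y + L + m) = false)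
    {r1 r2 : ℝ} (h1 : 0 ≤ r1) (h2 : 0 ≤ r2) (h2L : r2 ≤ L / 8) :
    |EP E (r1 + r2) (F * g : CC) ω| ≤ 8 * (1 / 2 : ℝ) ^ L * r2 + Real.sqrt (kap E ^ m) * Real.exp (-gap E * r2) := by
  obtain ⟨k0, k1, k2⟩ := kap_facts E
  have hl := (TT_tendsto E (F * g) (hFS.mulC hgS) (add_nonneg h1 h2) ω).abs
  refine le_of_tendsto hl ?_
  filter_upwards [DZi_ev (y + L) m hm] with n hn
  exact KEY_fin E.hp0 E.hp1 (by linarith) k1 k2 (gapIneq E hgap) _ (y + L) F g hF1 hg1 hg hga m hn ω hω h1 h2 _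
    (fun ζ => DEC E.hp0.le E.hp1.le _ F g y L hF hg hF1 hg1 h2 h2L ζ)

theorem KEYI1 (E : EastProcess) (hgap : 0 < gap E) (g : CC) {S : Finset ℤ}
    (hgS : DependsOnF g S) (a : ℤ)
    (hg : DependsOnF g (Set.Ici a)) (hg1 : ∀ ω, |g ω| ≤ 1)
    (hga : AA E.p a g = 0) (m : ℕ) (hm : 1 ≤ m) (ω : Config) (hω : ω (a + m) = false)
    {r : ℝ} (h1 : 0 ≤ r) :
    |EP E r g ω| ≤ Real.sqrt (kap E ^ m) * Real.exp (-gap E * r) := by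
  obtain ⟨k0, k1, k2⟩ := kap_facts E
  have hl := (TT_tendsto E g hgS h1 ω).abs
  refine le_of_tendsto hl ?_
  filter_upwards [DZi_ev a m hm] with n hn
  have := KEY_fin E.hp0 E.hp1 (by linarith) k1 k2 (gapIneq E hgap) _ a 1 g (by simp) hg1 hg hga m hn ω hω le_rfl h1 0
    (fun ζ => by rw [one_mul, TT_one E.hp0.le E.hp1.le _ h1, one_mul, sub_self, abs_zero])
  simpa using this

/-! ### Finite speed of the front -/

theorem gen_le_ind {p : ℝ} (hp0 : 0 ≤ p) (hp1 : p ≤ 1) (S : Finset ℤ) (f : CC) (h0 : ∀ ω, 0 ≤ f ω) (h1 : ∀ ω, f ω ≤ 1)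
    (ω : Config) (x0 : ℤ) (b : ℝ) (hb : 0 ≤ b) (hω : f ω = 0 ∨ f ω = 1)
    (h : f ω = 0 → ∀ x v, ω (x + 1) = false → f (Function.update ω x v) ≠ 0 → x = x0 ∧ b = 1) :
    gen p S f ω ≤ b := by
  rw [gen_apply]
  rcases hω with hω | hω
  · have ht : ∀ x ∈ S, kk x ω * (AA p x f ω - f ω) ≤ if x = x0 then b else 0 := by
      intro x _
      rw [kk_apply]
      by_cases hx : ω (x + 1) = false
      · rw [if_pos hx, one_mul, hω, sub_zero, AA_apply]
        by_cases hz : f (Function.update ω x true) ≠ 0 ∨ f (Function.update ω x false) ≠ 0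
        · have : x = x0 ∧ b = 1 := by
            rcases hz with hz | hz
            · exact h hω x _ hx hz
            · exact h hω x _ hx hz
          rw [if_pos this.1, this.2]
          nlinarith [h1 (Function.update ω x true), h1 (Function.update ω x false)]
        · push Not at hz
          rw [hz.1, hz.2]
          split_ifs <;> simp [hb]
      · rw [if_neg hx, zero_mul]; split_ifs <;> simp [hb]
    refine (Finset.sum_le_sum ht).trans ?_
    rw [Finset.sum_ite_eq']
    split_ifs <;> simp [hb]
  · refine (Finset.sum_nonpos fun x _ => ?_).trans hb
    refine mul_nonpos_of_nonneg_of_nonpos (kk_nonneg x ω) ?_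
    rw [AA_apply, hω]
    nlinarith [h1 (Function.update ω x true), h1 (Function.update ω x false)]

theorem fact_chain (E : EastProcess) (u : ℕ → CC) (S : ℕ → Finset ℤ) (hS : ∀ k, DependsOnF (u k) (S k))
    (h0 : ∀ ω, u 0 ω ≤ 1) (hg : ∀ k ω, gen E.p (S (k + 1)) (u (k + 1)) ω ≤ u k ω) (ω : Config)
    (hω : ∀ k, u (k + 1) ω ≤ 0) (k : ℕ) : ∀ t : ℝ, 0 ≤ t → EP E t (u k) ω ≤ t ^ k / k.factorial := by
  induction k with
  | zero =>
    intro t _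
    have := EP_mono E t (f := u 0) (g := ContinuousMap.const Config 1) h0 ω
    simpa [EP] using this
  | succ k ih =>
    intro t ht
    have hd : ∀ s, HasDerivAt (fun s : ℝ => s ^ (k + 1) / (k + 1).factorial) (s ^ k / k.factorial) s := by
      intro s
      have := (hasDerivAt_pow (k + 1) s).div_const ((k + 1).factorial : ℝ)
      refine this.congr_deriv ?_
      rw [Nat.factorial_succ]
      push_cast
      field_simp
    have hanti : AntitoneOn (fun s => EP E s (u (k + 1)) ω - s ^ (k + 1) / (k + 1).factorial) (Set.Icc 0 t) := by
      have hd2 : ∀ s, 0 < s → HasDerivAt (fun s => EP E s (u (k + 1)) ω - s ^ (k + 1) / (k + 1).factorial)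
          (EP E s (gen E.p (S (k + 1)) (u (k + 1))) ω - s ^ k / k.factorial) s := fun s hs =>
        (EP_hasDerivAt E (hS (k + 1)) ω hs).sub (hd s)
      apply antitoneOn_of_deriv_nonpos (convex_Icc 0 t)
      · refine ContinuousOn.sub (EP_tcont E _ ω).continuousOn ?_
        fun_prop
      · intro s hs
        rw [interior_Icc] at hs
        exact (hd2 s hs.1).differentiableAt.differentiableWithinAt
      · intro s hs
        rw [interior_Icc] at hs
        rw [(hd2 s hs.1).deriv]
        have h1 := EP_mono E s (hg k) ω
        have h2 := ih s hs.1.le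
        linarith
    have h := hanti (⟨le_rfl, ht⟩ : (0 : ℝ) ∈ Set.Icc 0 t) (⟨ht, le_rfl⟩ : t ∈ Set.Icc 0 t) ht
    simp only [EP_zero] at h
    have := hω k
    have e : (0 : ℝ) ^ (k + 1) / (k + 1).factorial = 0 := by simp
    rw [e] at h
    linarith

/-- Indicator that some site of `S` is empty. -/
def exF (S : Finset ℤ) (ω : Config) : ℝ := if ∃ z ∈ S, ω z = false then 1 else 0
theorem exF_dep (S : Finset ℤ) : DependsOnF (exF S) S := by
  intro ω ω' h
  unfold exF
  have : (∃ z ∈ S, ω z = false) ↔ (∃ z ∈ S, ω' z = false) :=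
    exists_congr fun x => and_congr_right fun hx => by rw [h x hx]
  simp only [this]
def exC (S : Finset ℤ) : CC := cylC (exF_dep S)
theorem exC_apply (S : Finset ℤ) (ω : Config) : exC S ω = if ∃ z ∈ S, ω z = false then 1 else 0 := rfl

/-- Indicator that all sites of `S` are occupied. -/
def onF (S : Finset ℤ) (ω : Config) : ℝ := if ∀ z ∈ S, ω z = true then 1 else 0
theorem onF_dep (S : Finset ℤ) : DependsOnF (onF S) S := by
  intro ω ω' h
  unfold onF
  have : (∀ z ∈ S, ω z = true) ↔ (∀ z ∈ S, ω' z = true) :=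
    forall₂_congr fun x hx => by rw [h x hx]
  simp only [this]
def onC (S : Finset ℤ) : CC := cylC (onF_dep S)
theorem onC_apply (S : Finset ℤ) (ω : Config) : onC S ω = if ∀ z ∈ S, ω z = true then 1 else 0 := rfl

theorem left_fin (E : EastProcess) (c : ℤ) (N : ℕ) (ω : Config) (hω : ∀ x < c, ω x = true) (k : ℕ) {t : ℝ} (ht : 0 ≤ t) :
    EP E t (exC (Finset.Icc (c - N) (c - k))) ω ≤ t ^ k / k.factorial := by
  refine fact_chain E (fun k => exC (Finset.Icc (c - N) (c - k))) (fun k => Finset.Icc (c - N) (c - k))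
    (fun k => exF_dep _) ?_ ?_ ω ?_ k t ht
  · intro ω; simp only [exC_apply]; split_ifs <;> norm_num
  · intro k ω
    refine gen_le_ind E.hp0.le E.hp1.le _ _ (fun ω => ?_) (fun ω => ?_) ω (c - (k + 1)) _ ?_ ?_ ?_
    · rw [exC_apply]; split_ifs <;> norm_num
    · rw [exC_apply]; split_ifs <;> norm_num
    · rw [exC_apply]; split_ifs <;> norm_num
    · rw [exC_apply]; split_ifs <;> norm_num
    · intro h x v hx hf
      have h1 : ¬ ∃ z ∈ Finset.Icc (c - N) (c - ((k + 1 : ℕ) : ℤ)), ω z = false := by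
        intro hh; rw [exC_apply, if_pos hh] at h; norm_num at h
      have h2 : ∃ z ∈ Finset.Icc (c - N) (c - ((k + 1 : ℕ) : ℤ)), Function.update ω x v z = false := by
        by_contra hh; rw [exC_apply, if_neg hh] at hf; exact hf rfl
      obtain ⟨z, hz, hz2⟩ := h2
      have hzx : z = x := by
        by_contra hne
        rw [Function.update_of_ne hne] at hz2
        exact h1 ⟨z, hz, hz2⟩
      subst hzx
      rw [Finset.mem_Icc] at hz
      have hlast : z = c - (k + 1) := by
        by_contra hne
        exact h1 ⟨z + 1, by rw [Finset.mem_Icc]; push_cast at hz ⊢; omega, hx⟩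
      refine ⟨hlast, ?_⟩
      rw [exC_apply, if_pos]
      exact ⟨z + 1, by rw [Finset.mem_Icc]; push_cast at hz ⊢; omega, hx⟩
  · intro k
    rw [exC_apply, if_neg]
    rintro ⟨z, hz, hz2⟩
    rw [Finset.mem_Icc] at hz
    rw [hω z (by push_cast at hz; omega)] at hz2
    exact absurd hz2 (by simp)

theorem right_fin (E : EastProcess) (c : ℤ) (N : ℕ) (ω : Config) (hω : ω c = false) (m : ℕ) {t : ℝ} (ht : 0 ≤ t) :
    EP E t (onC (Finset.Ico (c - N) (c + m))) ω ≤ t ^ m / m.factorial := by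
  refine fact_chain E (fun m => onC (Finset.Ico (c - N) (c + m))) (fun m => Finset.Ico (c - N) (c + m))
    (fun k => onF_dep _) ?_ ?_ ω ?_ m t ht
  · intro ω; simp only [onC_apply]; split_ifs <;> norm_num
  · intro k ω
    refine gen_le_ind E.hp0.le E.hp1.le _ _ (fun ω => ?_) (fun ω => ?_) ω (c + k) _ ?_ ?_ ?_
    · rw [onC_apply]; split_ifs <;> norm_num
    · rw [onC_apply]; split_ifs <;> norm_num
    · rw [onC_apply]; split_ifs <;> norm_num
    · rw [onC_apply]; split_ifs <;> norm_num
    · intro h x v hx hf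
      have h1 : ¬ ∀ z ∈ Finset.Ico (c - N) (c + ((k + 1 : ℕ) : ℤ)), ω z = true := by
        intro hh; rw [onC_apply, if_pos hh] at h; norm_num at h
      have h2 : ∀ z ∈ Finset.Ico (c - N) (c + ((k + 1 : ℕ) : ℤ)), Function.update ω x v z = true := by
        by_contra hh; rw [onC_apply, if_neg hh] at hf; exact hf rfl
      have h3 : ∀ z ∈ Finset.Ico (c - N) (c + ((k + 1 : ℕ) : ℤ)), z ≠ x → ω z = true := by
        intro z hz hne
        have := h2 z hz
        rwa [Function.update_of_ne hne] at this
      have hxin : x ∈ Finset.Ico (c - N) (c + ((k + 1 : ℕ) : ℤ)) := by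
        by_contra hne
        exact h1 fun z hz => h3 z hz (fun e => hne (e ▸ hz))
      rw [Finset.mem_Ico] at hxin
      have hlast : x = c + k := by
        by_contra hne
        have := h3 (x + 1) (by rw [Finset.mem_Ico]; push_cast at hxin ⊢; omega) (by omega)
        rw [hx] at this
        exact absurd this (by simp)
      refine ⟨hlast, ?_⟩
      rw [onC_apply, if_pos]
      intro z hz
      rw [Finset.mem_Ico] at hz
      exact h3 z (by rw [Finset.mem_Ico]; push_cast; omega) (by omega)
  · intro k
    rw [onC_apply, if_neg]
    intro h
    have := h c (by rw [Finset.mem_Ico]; push_cast; omega)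
    rw [hω] at this
    exact absurd this (by simp)

/-! ### The front -/

theorem front_spec {ω : Config} (h : ω ∈ LO) : ω (front ω) = false ∧ ∀ x < front ω, ω x = true := by
  obtain ⟨⟨y, hy⟩, x0, hx0⟩ := h
  have hb : BddBelow {x : ℤ | ω x = false} := ⟨y, fun x hx => by
    by_contra hlt
    have := hy x (by omega)
    rw [hx] at this; exact absurd this (by simp)⟩
  have hn : {x : ℤ | ω x = false}.Nonempty := ⟨x0, hx0⟩
  refine ⟨Int.csInf_mem hn hb, fun x hx => ?_⟩
  by_contra hne
  have hxf : ω x = false := by simpa using hne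
  have : front ω ≤ x := csInf_le hb hxf
  omega

/-- the leftmost zero is at `y` -/
def isZ (y : ℤ) (ω : Config) : Prop := ω y = false ∧ ∀ x < y, ω x = true

theorem isZ_LO {y : ℤ} {ω : Config} (h : isZ y ω) : ω ∈ LO := ⟨⟨y, h.2⟩, y, h.1⟩

theorem isZ_unique {y y' : ℤ} {ω : Config} (h : isZ y ω) (h' : isZ y' ω) : y = y' := by
  rcases lt_trichotomy y y' with hl | hl | hl
  · have := h'.2 y hl; rw [h.1] at this; exact absurd this (by simp)
  · exact hl
  · have := h.2 y' hl; rw [h'.1] at this; exact absurd this (by simp)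

theorem isZ_front {ω : Config} (h : ω ∈ LO) : isZ (front ω) ω := front_spec h

theorem isZ_iff {y : ℤ} {ω : Config} (h : ω ∈ LO) : isZ y ω ↔ front ω = y :=
  ⟨fun h' => isZ_unique (isZ_front h) h', fun e => e ▸ isZ_front h⟩

theorem isZ_front_eq {y : ℤ} {ω : Config} (h : isZ y ω) : front ω = y := (isZ_iff (isZ_LO h)).mp h

theorem le_front_iff {ω : Config} (h : ω ∈ LO) (y : ℤ) : y ≤ front ω ↔ ∀ x < y, ω x = true := by
  have hs := front_spec h
  constructor
  · intro hy x hx; exact hs.2 x (by omega)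
  · intro hy; by_contra hlt
    have := hy (front ω) (by omega)
    rw [hs.1] at this; exact absurd this (by simp)

theorem front_le_iff {ω : Config} (h : ω ∈ LO) (y : ℤ) : front ω ≤ y ↔ ∃ x ≤ y, ω x = false := by
  have hs := front_spec h
  constructor
  · intro hy; exact ⟨_, hy, hs.1⟩
  · rintro ⟨x, hx, hf⟩; by_contra hlt
    have := hs.2 x (by omega)
    rw [hf] at this; exact absurd this (by simp)

theorem coord_meas (x : ℤ) (b : Bool) : MeasurableSet {ω : Config | ω x = b} :=
  measurableSet_eq_fun (measurable_pi_apply x) measurable_const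

theorem allone_meas (y : ℤ) : MeasurableSet {ω : Config | ∀ x < y, ω x = true} := by
  have : {ω : Config | ∀ x < y, ω x = true} = ⋂ x : ℤ, ⋂ _ : x < y, {ω : Config | ω x = true} := by
    ext ω; simp
  rw [this]
  exact MeasurableSet.iInter fun x => MeasurableSet.iInter fun _ => coord_meas x true

theorem isZ_meas (y : ℤ) : MeasurableSet {ω : Config | isZ y ω} :=
  (coord_meas y false).inter (allone_meas y)

theorem LO_eq : LO = ⋃ y : ℤ, {ω : Config | isZ y ω} := by
  ext ω
  rw [Set.mem_iUnion]
  exact ⟨fun h => ⟨_, isZ_front h⟩, fun ⟨y, h⟩ => isZ_LO h⟩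

theorem LO_meas : MeasurableSet LO := by
  rw [LO_eq]; exact MeasurableSet.iUnion isZ_meas

theorem front_not_LO {ω : Config} (h : ω ∉ LO) : front ω = 0 := by
  unfold front
  by_cases hn : {x : ℤ | ω x = false}.Nonempty
  · refine Int.csInf_of_not_bddBelow ?_
    rintro ⟨y, hy⟩
    refine h ⟨⟨y, fun x hx => ?_⟩, hn⟩
    by_contra hne
    have : y ≤ x := hy (show ω x = false by simpa using hne)
    omega
  · rw [Set.not_nonempty_iff_eq_empty] at hn
    rw [hn]; exact Int.csInf_empty

theorem front_meas : Measurable front := by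
  refine measurable_to_countable' fun y => ?_
  have : front ⁻¹' {y} = {ω | isZ y ω} ∪ (if y = 0 then LOᶜ else ∅) := by
    ext ω
    by_cases h : ω ∈ LO
    · rw [Set.mem_union]
      have : ω ∉ (if y = 0 then LOᶜ else ∅) := by split_ifs <;> simp [h]
      simp only [this, or_false]
      exact (isZ_iff h).symm
    · have h1 : ω ∉ {ω | isZ y ω} := fun h' => h (isZ_LO h')
      rw [Set.mem_union, Set.mem_preimage, Set.mem_singleton_iff, front_not_LO h]
      simp only [h1, false_or]
      by_cases hy : y = 0
      · simp [hy, h]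
      · simp [hy, Ne.symm hy]
  rw [this]
  refine (isZ_meas y).union ?_
  split_ifs
  · exact LO_meas.compl
  · exact MeasurableSet.empty

theorem θ_meas : Measurable (θL 0) := by
  refine measurable_pi_iff.mpr fun x => ?_
  unfold θL
  split_ifs
  · exact measurable_const
  · exact measurable_const
  · refine measurable_to_countable' fun b => ?_
    have : (fun ω : Config => ω (front ω + 0 + x)) ⁻¹' {b} = ⋃ y : ℤ, (front ⁻¹' {y}) ∩ {ω | ω (y + x) = b} := by
      ext ω; simp
    rw [this]
    exact MeasurableSet.iUnion fun y => (front_meas (measurableSet_singleton y)).inter (coord_meas _ b)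

theorem LO₀_eq : LO₀ = {ω | isZ 0 ω} := by
  ext ω
  exact ⟨fun h => (isZ_iff h.1).mpr h.2, fun h => ⟨isZ_LO h, isZ_front_eq h⟩⟩

theorem LO₀_meas : MeasurableSet LO₀ := by rw [LO₀_eq]; exact isZ_meas 0

theorem θ_mem (ω : Config) : θL 0 ω ∈ LO₀ := by
  rw [LO₀_eq]
  refine ⟨by simp [θL], fun x hx => by simp [θL, hx]⟩

theorem θ_eq {ω : Config} (h : ω ∈ LO) : θL 0 ω = shift (front ω) ω := by
  have hs := front_spec h
  ext x
  unfold θL shift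
  split_ifs with h1 h2
  · exact (hs.2 _ (by omega)).symm
  · rw [h2, zero_add]; exact hs.1.symm
  · rw [add_zero, add_comm]

theorem θ_id {ω : Config} (h : ω ∈ LO₀) : θL 0 ω = ω := by
  rw [θ_eq h.1, h.2]; ext x; simp [shift]

theorem isZ_shift {y z : ℤ} {ω : Config} : isZ z (shift y ω) ↔ isZ (z + y) ω := by
  unfold isZ shift
  refine and_congr_right fun _ => ⟨fun h x hx => ?_, fun h x hx => h _ (by omega)⟩
  have := h (x - y) (by omega)
  simpa using this

theorem shift_LO {y : ℤ} {ω : Config} (h : ω ∈ LO) : shift y ω ∈ LO :=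
  isZ_LO (isZ_shift.mpr (by rw [sub_add_cancel]; exact isZ_front h) : isZ (front ω - y) (shift y ω))

theorem shift_front {y : ℤ} {ω : Config} (h : ω ∈ LO) : front (shift y ω) = front ω - y :=
  isZ_front_eq (isZ_shift.mpr (by rw [sub_add_cancel]; exact isZ_front h))

theorem θ_shift {y : ℤ} {ω : Config} (h : ω ∈ LO) : θL 0 (shift y ω) = θL 0 ω := by
  rw [θ_eq h, θ_eq (shift_LO h), shift_front h]
  ext x; simp only [shift]; congr 1; ring

theorem shift_cont (y : ℤ) : Continuous (shift y) := continuous_pi fun x => continuous_apply (x + y)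

/-! ### Expectations on LO -/

theorem LO_ae (E : EastProcess) {t : ℝ} (ht : 0 ≤ t) {ω : Config} (h : ω ∈ LO) : ∀ᵐ η ∂(E.P t ω), η ∈ LO :=
  (mem_ae_iff_prob_eq_one LO_meas).mpr (E.loStable t ht ω h)

theorem bdd_int (ν : Measure Config) [IsFiniteMeasure ν] {f : Config → ℝ} (hf : Measurable f) {M : ℝ} (hM : ∀ ω, |f ω| ≤ M) :
    Integrable f ν := Integrable.of_bound hf.aestronglyMeasurable M (Eventually.of_forall hM)

theorem EP_mono_LO (E : EastProcess) {t : ℝ} (ht : 0 ≤ t) {ω : Config} (h : ω ∈ LO) {f g : Config → ℝ}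
    (hf : Measurable f) (hg : Measurable g) {M M' : ℝ} (hM : ∀ ω, |f ω| ≤ M) (hM' : ∀ ω, |g ω| ≤ M')
    (hle : ∀ η ∈ LO, f η ≤ g η) : EP E t f ω ≤ EP E t g ω := by
  refine integral_mono_ae (bdd_int _ hf hM) (bdd_int _ hg hM') ?_
  filter_upwards [LO_ae E ht h] with η hη using hle η hη

theorem EP_congr_LO (E : EastProcess) {t : ℝ} (ht : 0 ≤ t) {ω : Config} (h : ω ∈ LO) {f g : Config → ℝ}
    (hle : ∀ η ∈ LO, f η = g η) : EP E t f ω = EP E t g ω := by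
  refine integral_congr_ae ?_
  filter_upwards [LO_ae E ht h] with η hη using hle η hη

theorem EP_const (E : EastProcess) (t : ℝ) (c : ℝ) (ω : Config) : EP E t (fun _ => c) ω = c := by simp [EP]

theorem EP_le_LO (E : EastProcess) {t : ℝ} (ht : 0 ≤ t) {ω : Config} (h : ω ∈ LO) {f : Config → ℝ}
    (hf : Measurable f) {M c : ℝ} (hM : ∀ ω, |f ω| ≤ M)
    (hle : ∀ η ∈ LO, f η ≤ c) : EP E t f ω ≤ c := by
  have := EP_mono_LO E ht h hf (measurable_const (a := c)) hM (fun _ => le_rfl) hle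
  rwa [EP_const] at this

theorem EP_ge_LO (E : EastProcess) {t : ℝ} (ht : 0 ≤ t) {ω : Config} (h : ω ∈ LO) {f : Config → ℝ}
    (hf : Measurable f) {M c : ℝ} (hM : ∀ ω, |f ω| ≤ M)
    (hle : ∀ η ∈ LO, c ≤ f η) : c ≤ EP E t f ω := by
  have := EP_mono_LO E ht h (measurable_const (a := c)) hf (fun _ => le_rfl) hM hle
  rwa [EP_const] at this

theorem EP_abs_LO (E : EastProcess) {t : ℝ} (ht : 0 ≤ t) {ω : Config} (h : ω ∈ LO) {f : Config → ℝ}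
    (hf : Measurable f) {M c : ℝ} (hM : ∀ ω, |f ω| ≤ M)
    (hle : ∀ η ∈ LO, |f η| ≤ c) : |EP E t f ω| ≤ c :=
  abs_le.mpr ⟨EP_ge_LO E ht h hf hM fun η hη => (abs_le.mp (hle η hη)).1,
    EP_le_LO E ht h hf hM fun η hη => (abs_le.mp (hle η hη)).2⟩

theorem EP_shift (E : EastProcess) {t : ℝ} (ht : 0 ≤ t) {f : Config → ℝ} (hf : Measurable f) (y : ℤ) (ω : Config) :
    EP E t f (shift y ω) = EP E t (fun η => f (shift y η)) ω := by
  unfold EP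
  rw [E.shiftComm t ht, integral_map (shift_cont y).measurable.aemeasurable hf.aestronglyMeasurable]

/-- For functions seen from the front, the value only depends on the configuration seen from the front. -/
theorem EP_θ_shift (E : EastProcess) {t : ℝ} (ht : 0 ≤ t) {f : Config → ℝ} (hf : Measurable f) (y : ℤ) {ω : Config}
    (h : ω ∈ LO) :
    EP E t (fun η => f (θL 0 η)) (shift y ω) = EP E t (fun η => f (θL 0 η)) ω := by
  have e := EP_shift E ht (f := fun η => f (θL 0 η)) (hf.comp θ_meas) y ω
  rw [e]
  exact EP_congr_LO E ht h fun η hη => by rw [θ_shift hη]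

theorem EP_θ_θ (E : EastProcess) {t : ℝ} (ht : 0 ≤ t) {f : Config → ℝ} (hf : Measurable f) {ω : Config}
    (h : ω ∈ LO) :
    EP E t (fun η => f (θL 0 η)) (θL 0 ω) = EP E t (fun η => f (θL 0 η)) ω := by
  rw [θ_eq h]; exact EP_θ_shift E ht hf _ h

/-- indicator of a set -/
theorem EP_ind (E : EastProcess) (t : ℝ) {A : Set Config} (hA : MeasurableSet A) (ω : Config) :
    EP E t (A.indicator fun _ => 1) ω = (E.P t ω).real A := by
  unfold EP
  rw [integral_indicator hA]; simp

theorem left_bound (E : EastProcess) (c : ℤ) (ω : Config) (hω : ∀ x < c, ω x = true) (k : ℕ) {t : ℝ} (ht : 0 ≤ t) :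
    (E.P t ω).real {η | ∃ z ≤ c - k, η z = false} ≤ t ^ k / k.factorial := by
  have hU : {η : Config | ∃ z ≤ c - k, η z = false} = ⋃ N : ℕ, {η : Config | ∃ z ∈ Finset.Icc (c - N) (c - k), η z = false} := by
    ext η
    simp only [Set.mem_iUnion, Set.mem_ofPred_eq, Finset.mem_Icc]
    constructor
    · rintro ⟨z, hz, h⟩; exact ⟨(c - z).toNat, z, by omega, h⟩
    · rintro ⟨N, z, hz, h⟩; exact ⟨z, hz.2, h⟩
  have hmono : Monotone fun N : ℕ => {η : Config | ∃ z ∈ Finset.Icc (c - N) (c - k), η z = false} := by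
    intro N N' h η ⟨z, hz, h2⟩
    rw [Finset.mem_Icc] at hz
    exact ⟨z, by rw [Finset.mem_Icc]; omega, h2⟩
  have hmeas : ∀ N : ℕ, MeasurableSet {η : Config | ∃ z ∈ Finset.Icc (c - N) (c - k), η z = false} := by
    intro N
    have : {η : Config | ∃ z ∈ Finset.Icc (c - N) (c - k), η z = false} =
      ⋃ z ∈ Finset.Icc (c - N) (c - k), {η : Config | η z = false} := by ext η; simp
    rw [this]
    exact Finset.measurableSet_biUnion _ fun z _ => coord_meas z false
  have hl := tendsto_measure_iUnion_atTop (μ := E.P t ω) hmono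
  rw [← hU] at hl
  have hl2 := (ENNReal.tendsto_toReal (measure_ne_top _ _)).comp hl
  refine le_of_tendsto hl2 (Eventually.of_forall fun N => ?_)
  have := left_fin E c N ω hω k ht
  have e : EP E t (exC (Finset.Icc (c - N) (c - k))) ω = (E.P t ω).real {η : Config | ∃ z ∈ Finset.Icc (c - N) (c - k), η z = false} := by
    rw [← EP_ind E t (hmeas N)]
    congr 1
    ext η
    rw [exC_apply, Set.indicator_apply]
    rfl
  rw [e] at this
  exact this

theorem right_bound (E : EastProcess) (c : ℤ) (ω : Config) (hω : ω c = false) (m : ℕ) {t : ℝ} (ht : 0 ≤ t) :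
    (E.P t ω).real {η | ∀ z < c + m, η z = true} ≤ t ^ m / m.factorial := by
  refine le_trans ?_ (right_fin E c 0 ω hω m ht)
  rw [← EP_ind E t (allone_meas _)]
  refine integral_mono ((integrable_const 1).indicator (allone_meas _)) (CC_integrable _ _) fun η => ?_
  classical
  rw [onC_apply, Set.indicator_apply]
  split_ifs with h1 h2
  · exact le_rfl
  · exact absurd (fun z hz => h1 z (Finset.mem_Ico.mp hz).2) h2
  · norm_num
  · norm_num

/-! ### Contribution of a fixed front position -/

theorem EP_abs_LO2 (E : EastProcess) {t : ℝ} (ht : 0 ≤ t) {ω : Config} (h : ω ∈ LO) {f : Config → ℝ}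
    (hf : Measurable f) {M c : ℝ} (hM : ∀ ω, |f ω| ≤ M) {A : Set Config} (hA : MeasurableSet A)
    (hle : ∀ η ∈ LO, |f η| ≤ c + A.indicator (fun _ => 1) η) : |EP E t f ω| ≤ c + (E.P t ω).real A := by
  have hAi : Integrable (A.indicator fun _ => (1 : ℝ)) (E.P t ω) := (integrable_const 1).indicator hA
  rw [← EP_ind E t hA]
  have e : EP E t (fun η => c + A.indicator (fun _ => (1 : ℝ)) η) ω = c + EP E t (A.indicator fun _ => 1) ω := by
    unfold EP
    rw [integral_add (integrable_const c) hAi]; simp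
  rw [← e]
  refine (abs_integral_le_integral_abs).trans ?_
  refine integral_mono_ae (bdd_int _ hf hM).abs ((integrable_const c).add hAi) ?_
  filter_upwards [LO_ae E ht h] with η hη using hle η hη

/-- indicator that the front is at `y` -/
def zI (y : ℤ) : Config → ℝ := Set.indicator {ω | isZ y ω} (fun _ => 1)

theorem zI_pos {y : ℤ} {ω : Config} (h : isZ y ω) : zI y ω = 1 := Set.indicator_of_mem (s := {ω | isZ y ω}) h _
theorem zI_neg {y : ℤ} {ω : Config} (h : ¬ isZ y ω) : zI y ω = 0 := Set.indicator_of_notMem (s := {ω | isZ y ω}) h _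

theorem zI_meas (y : ℤ) : Measurable (zI y) := measurable_const.indicator (isZ_meas y)

/-- cylinder approximation -/
def zNF (N : ℕ) (y : ℤ) (ω : Config) : ℝ := if ω y = false ∧ ∀ x ∈ Finset.Ico (y - N) y, ω x = true then 1 else 0

theorem zNF_dep (N : ℕ) (y : ℤ) : DependsOnF (zNF N y) (Finset.Icc (y - N) y : Finset ℤ) := by
  intro ω ω' h
  unfold zNF
  have : (ω y = false ∧ ∀ x ∈ Finset.Ico (y - N) y, ω x = true) ↔ (ω' y = false ∧ ∀ x ∈ Finset.Ico (y - N) y, ω' x = true) := by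
    refine and_congr (by rw [h y (by simp)]) (forall₂_congr fun x hx => by
      rw [Finset.mem_Ico] at hx
      rw [h x (by rw [Finset.mem_coe, Finset.mem_Icc]; omega)])
  simp only [this]

def zN (N : ℕ) (y : ℤ) : CC := cylC (zNF_dep N y)

theorem zN_apply (N : ℕ) (y : ℤ) (ω : Config) :
    zN N y ω = if ω y = false ∧ ∀ x ∈ Finset.Ico (y - N) y, ω x = true then 1 else 0 := rfl

theorem zN_abs (N : ℕ) (y : ℤ) (ω : Config) : |zN N y ω| ≤ 1 := by
  rw [zN_apply]; split_ifs <;> norm_num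

theorem zN_tendsto (y : ℤ) (ω : Config) : Tendsto (fun N => zN N y ω) atTop (𝓝 (zI y ω)) := by
  by_cases h : isZ y ω
  · rw [zI_pos h]
    refine tendsto_const_nhds.congr fun N => ?_
    rw [zN_apply, if_pos]
    exact ⟨h.1, fun x hx => h.2 x (Finset.mem_Ico.mp hx).2⟩
  · rw [zI_neg h]
    refine tendsto_const_nhds.congr' ?_
    by_cases hy : ω y = false
    · have : ¬ ∀ x < y, ω x = true := fun h' => h ⟨hy, h'⟩
      push Not at this
      obtain ⟨x, hx, hx2⟩ := this
      filter_upwards [eventually_ge_atTop (y - x).toNat] with N hN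
      rw [zN_apply, if_neg]
      rintro ⟨-, h2⟩
      exact hx2 (h2 x (by rw [Finset.mem_Ico]; omega))
    · filter_upwards with N
      rw [zN_apply, if_neg]
      rintro ⟨h1, -⟩; exact hy h1

theorem EP_zI (E : EastProcess) (t : ℝ) (y : ℤ) (g : CC) (ω : Config) :
    Tendsto (fun N => EP E t (zN N y * g : CC) ω) atTop (𝓝 (EP E t (fun η => zI y η * g η) ω)) := by
  unfold EP
  refine tendsto_integral_of_dominated_convergence (fun _ => ‖g‖) (fun N => (zN N y * g).continuous.aestronglyMeasurable)
    (integrable_const _) (fun N => Eventually.of_forall fun η => ?_) (Eventually.of_forall fun η => ?_)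
  · rw [ContinuousMap.mul_apply, norm_mul]
    have := zN_abs N y η
    have h2 := g.norm_coe_le_norm η
    calc ‖zN N y η‖ * ‖g η‖ ≤ 1 * ‖g‖ := by gcongr; exact this
      _ = ‖g‖ := one_mul _
  · exact (zN_tendsto y η).mul_const _

theorem KEYZ (E : EastProcess) (hgap : 0 < gap E) (g : CC) {S : Finset ℤ}
    (hgS : DependsOnF g S) (y : ℤ) (L : ℕ)
    (hg : DependsOnF g (Set.Ici (y + L))) (hg1 : ∀ ω, |g ω| ≤ 1)
    (hga : AA E.p (y + L) g = 0) (m : ℕ) (hm : 1 ≤ m) (ω : Config) (hω : ω (y + L + m) = false)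
    {r1 r2 : ℝ} (h1 : 0 ≤ r1) (h2 : 0 ≤ r2) (h2L : r2 ≤ L / 8) :
    |EP E (r1 + r2) (fun η => zI y η * g η) ω| ≤ 8 * (1 / 2 : ℝ) ^ L * r2 + Real.sqrt (kap E ^ m) * Real.exp (-gap E * r2) := by
  refine le_of_tendsto (EP_zI E (r1 + r2) y g ω).abs (Eventually.of_forall fun N => ?_)
  refine KEYI E hgap (zN N y) g (S := Finset.Icc (y - N) y ∪ S) ((zNF_dep N y).mono (by simp)) (hgS.mono (by simp)) y L
    ((zNF_dep N y).mono fun x hx => ?_) hg (zN_abs N y) hg1 hga m hm ω hω h1 h2 h2L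
  exact (Finset.mem_Icc.mp hx).2

def bet (E : EastProcess) (L J : ℕ) : ℝ :=
  (1 / 2 : ℝ) ^ L + L * (1 / 2 : ℝ) ^ L + Real.sqrt (kap E ^ (J + 1)) * Real.exp (-gap E * (L / 8))

theorem exset_meas (c : ℤ) : MeasurableSet {η : Config | ∃ z ≤ c, η z = false} := by
  have : {η : Config | ∃ z ≤ c, η z = false} = ⋃ z : ℤ, ⋃ _ : z ≤ c, {η : Config | η z = false} := by
    ext η; simp
  rw [this]
  exact MeasurableSet.iUnion fun z => MeasurableSet.iUnion fun _ => coord_meas z false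

theorem zI_abs (y : ℤ) (ω : Config) : |zI y ω| ≤ 1 := by
  by_cases h : isZ y ω
  · rw [zI_pos h]; simp
  · rw [zI_neg h]; simp

theorem FIXY (E : EastProcess) (hgap : 0 < gap E) (g : CC) {S : Finset ℤ}
    (hgS : DependsOnF g S) (y : ℤ) (L J : ℕ) (hL : 1 ≤ L)
    (hg : DependsOnF g (Set.Ici (y + L))) (hg1 : ∀ ω, |g ω| ≤ 1)
    (hga : AA E.p (y + L) g = 0) (r : ℕ) : ∀ ω ∈ LO, y + L + 1 ≤ front ω →
    |EP E r (fun η => zI y η * g η) ω| ≤ bet E L J + r / (J + 1).factorial := by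
  have hk := (kap_facts E).1
  have hβ : 0 ≤ bet E L J := by unfold bet; positivity
  have hHm : Measurable fun η => zI y η * g η := (zI_meas y).mul g.continuous.measurable
  have hH1 : ∀ η, |zI y η * g η| ≤ 1 := fun η => by
    rw [abs_mul]
    exact mul_le_one₀ (zI_abs y η) (abs_nonneg _) (hg1 η)
  induction r with
  | zero =>
    intro ω hω hX
    have : EP E ((0 : ℕ) : ℝ) (fun η => zI y η * g η) ω = 0 := by
      rw [Nat.cast_zero, EP, E.P0, Kernel.id_apply, integral_dirac' _ _ hHm.stronglyMeasurable, zI_neg, zero_mul]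
      rw [isZ_iff hω]; omega
    rw [this]
    simpa using hβ
  | succ r ih =>
    intro ω hω hX
    have hs := front_spec hω
    by_cases hJ : front ω ≤ y + L + J + 1
    · refine le_trans ?_ (le_add_of_nonneg_right (by positivity))
      obtain ⟨m, hm⟩ : ∃ m : ℕ, front ω = y + L + m := ⟨(front ω - (y + L)).toNat, by omega⟩
      have hm1 : 1 ≤ m := by omega
      have hmJ : m ≤ J + 1 := by omega
      by_cases hr : ((r + 1 : ℕ) : ℝ) ≤ L / 8
      · have h1 := EP_abs_LO2 E (t := ((r + 1 : ℕ) : ℝ)) (by positivity) hω hHm hH1 (c := 0) (exset_meas (front ω - ((L + m : ℕ) : ℤ))) (by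
          intro η _
          by_cases hz : isZ y η
          · rw [Set.indicator_of_mem, zero_add]
            · exact hH1 η
            · exact ⟨y, by push_cast; omega, hz.1⟩
          · rw [zI_neg hz]
            simp only [zero_mul, abs_zero, zero_add]
            exact Set.indicator_nonneg (fun _ _ => zero_le_one) _)
        have h2 := left_bound E (front ω) ω hs.2 (L + m) (t := ((r + 1 : ℕ) : ℝ)) (by positivity)
        have h3 := pow_fact_half (s := ((r + 1 : ℕ) : ℝ)) (k := L + m) (by positivity) (hr.trans (by push_cast; gcongr; simp))
        have h4 : (1 / 2 : ℝ) ^ (L + m) ≤ (1 / 2 : ℝ) ^ L :=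
          pow_le_pow_of_le_one (by norm_num) (by norm_num) (by omega)
        have h5 : (1 / 2 : ℝ) ^ L ≤ bet E L J := by
          unfold bet
          have : 0 ≤ L * (1 / 2 : ℝ) ^ L + Real.sqrt (kap E ^ (J + 1)) * Real.exp (-gap E * (L / 8)) := by positivity
          linarith
        linarith
      · push Not at hr
        have h1 := KEYZ E hgap g hgS y L hg hg1 hga m hm1 ω (by rw [← hm]; exact hs.1)
          (r1 := ((r + 1 : ℕ) : ℝ) - L / 8) (r2 := L / 8) (by linarith) (by positivity) le_rfl
        rw [sub_add_cancel] at h1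
        refine h1.trans ?_
        unfold bet
        have h2 : Real.sqrt (kap E ^ m) ≤ Real.sqrt (kap E ^ (J + 1)) :=
          Real.sqrt_le_sqrt (pow_le_pow_right₀ hk hmJ)
        have h3 := mul_le_mul_of_nonneg_right h2 (Real.exp_pos (-gap E * (L / 8))).le
        have h4 : (0 : ℝ) ≤ (1 / 2 : ℝ) ^ L := by positivity
        linarith
    · have e : EP E ((r + 1 : ℕ) : ℝ) (fun η => zI y η * g η) ω = EP E 1 (EP E r (fun η => zI y η * g η)) ω := by
        rw [← EP_add E zero_le_one (Nat.cast_nonneg r) hHm hH1]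
        congr 1; push_cast; ring
      rw [e]
      have h1 := EP_abs_LO2 E (t := 1) zero_le_one hω (EP_meas E r hHm) (fun ζ => EP_abs E r hH1 ζ)
        (c := bet E L J + r / (J + 1).factorial) (exset_meas (front ω - ((J + 1 : ℕ) : ℤ))) (by
          intro η hη
          by_cases hA : ∃ z ≤ front ω - ((J + 1 : ℕ) : ℤ), η z = false
          · rw [Set.indicator_of_mem (show η ∈ {η : Config | ∃ z ≤ front ω - ((J + 1 : ℕ) : ℤ), η z = false} from hA)]
            have := EP_abs E r hH1 η
            have h0 : 0 ≤ bet E L J + r / (J + 1).factorial := by positivity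
            linarith
          · rw [Set.indicator_of_notMem (show η ∉ {η : Config | ∃ z ≤ front ω - ((J + 1 : ℕ) : ℤ), η z = false} from hA), add_zero]
            refine ih η hη ?_
            rw [← front_le_iff hη] at hA
            push_cast at hA
            omega)
      have h2 := left_bound E (front ω) ω hs.2 (J + 1) (t := 1) zero_le_one
      rw [one_pow] at h2
      refine h1.trans ?_
      have e2 : ((r + 1 : ℕ) : ℝ) / (J + 1).factorial = r / (J + 1).factorial + 1 / (J + 1).factorial := by
        rw [Nat.cast_add, Nat.cast_one, add_div]
      rw [e2]
      linarith

theorem onC_succ (c : ℤ) (n : ℕ) (ω : Config) :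
    onC (Finset.Ico (c - (n + 1 : ℕ)) c) ω = if ω (c - (n + 1 : ℕ)) = true then onC (Finset.Ico (c - n) c) ω else 0 := by
  rw [onC_apply, onC_apply]
  by_cases h : ω (c - (n + 1 : ℕ)) = true
  · rw [if_pos h]
    have : (∀ z ∈ Finset.Ico (c - (n + 1 : ℕ)) c, ω z = true) ↔ ∀ z ∈ Finset.Ico (c - n) c, ω z = true := by
      constructor
      · intro h2 z hz
        rw [Finset.mem_Ico] at hz
        exact h2 z (by rw [Finset.mem_Ico]; push_cast; omega)
      · intro h2 z hz
        rw [Finset.mem_Ico] at hz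
        by_cases e : z = c - (n + 1 : ℕ)
        · rw [e]; exact h
        · exact h2 z (by rw [Finset.mem_Ico]; push_cast at hz e ⊢; omega)
    simp only [this]
  · rw [if_neg h, if_neg]
    intro h2
    exact h (h2 _ (by rw [Finset.mem_Ico]; push_cast; omega))

theorem onC_nonneg (S : Finset ℤ) (ω : Config) : 0 ≤ onC S ω := by rw [onC_apply]; split_ifs <;> norm_num
theorem onC_le_one (S : Finset ℤ) (ω : Config) : onC S ω ≤ 1 := by rw [onC_apply]; split_ifs <;> norm_num

/-- Probability that a block of sites left of a zero is fully occupied. -/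
theorem BLOCK (E : EastProcess) (hgap : 0 < gap E) (c : ℤ) (L : ℕ) (ω : Config) (hω : ω (c + L) = false)
    {r : ℝ} (hr : 0 ≤ r) (n : ℕ) (hn : n ≤ L) :
    EP E r (onC (Finset.Ico (c - n) c)) ω ≤ E.p ^ n + n * (kap E ^ L * Real.exp (-gap E * r)) := by
  have hk := (kap_facts E).1
  induction n with
  | zero =>
    have := EP_mono E r (f := onC (Finset.Ico (c - (0 : ℕ)) c)) (g := ContinuousMap.const Config 1) (onC_le_one _) ω
    simpa [EP] using this
  | succ n ih =>
    have ih := ih (by omega)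
    set a : ℤ := c - (n + 1 : ℕ) with ha
    have hdep : DependsOnF (onC (Finset.Ico (c - n) c)) (Finset.Ico (c - n) c : Finset ℤ) := onF_dep _
    have hupd : ∀ v ζ, onC (Finset.Ico (c - n) c) (Function.update ζ a v) = onC (Finset.Ico (c - n) c) ζ := by
      intro v ζ
      refine hdep _ _ fun x hx => Function.update_of_ne ?_ _ _
      rw [Finset.mem_coe, Finset.mem_Ico] at hx
      rw [ha]; push_cast; omega
    set g : CC := onC (Finset.Ico a c) - E.p • onC (Finset.Ico (c - n) c) with hg
    have hgapp : ∀ ζ, g ζ = onC (Finset.Ico a c) ζ - E.p * onC (Finset.Ico (c - n) c) ζ := fun ζ => rfl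
    have hgS : DependsOnF g (Finset.Ico a c : Finset ℤ) := by
      intro ζ ζ' h
      rw [hgapp, hgapp, onF_dep _ ζ ζ' h |> (fun e : onC (Finset.Ico a c) ζ = onC (Finset.Ico a c) ζ' => e),
        hdep ζ ζ' (fun x hx => h x (by
          rw [Finset.mem_coe, Finset.mem_Ico] at hx ⊢; rw [ha]; push_cast; omega))]
    have hg1 : ∀ ζ, |g ζ| ≤ 1 := by
      intro ζ
      rw [hgapp, onC_succ]
      have h1 := onC_nonneg (Finset.Ico (c - n) c) ζ
      have h2 := onC_le_one (Finset.Ico (c - n) c) ζ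
      have hp0 := E.hp0
      have hp1 := E.hp1
      rw [abs_le]
      split_ifs <;> constructor <;> nlinarith
    have hga : AA E.p a g = 0 := by
      ext ζ
      rw [AA_apply, hgapp, hgapp, onC_succ, onC_succ, hupd, hupd, ← ha, Function.update_self, Function.update_self]
      simp
      ring
    have h1 := KEYI1 E hgap g hgS a (hgS.mono fun x hx => (Finset.mem_Ico.mp hx).1) hg1 hga (L + (n + 1)) (by omega) ω
      (by rw [ha, ← hω]; congr 1; push_cast; ring) hr
    have h2 : Real.sqrt (kap E ^ (L + (n + 1))) ≤ kap E ^ L := by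
      rw [Real.sqrt_le_left (by positivity), ← pow_mul]
      exact pow_le_pow_right₀ hk (by omega)
    have h3 : EP E r g ω = EP E r (onC (Finset.Ico a c)) ω - E.p * EP E r (onC (Finset.Ico (c - n) c)) ω := by
      rw [hg, EP_sub, EP_smul]
    have h4 := (abs_le.mp h1).2
    have h5 := mul_le_mul_of_nonneg_right h2 (Real.exp_pos (-gap E * r)).le
    have h6 := mul_le_mul_of_nonneg_left ih E.hp0.le
    have h7 : 0 ≤ n * (kap E ^ L * Real.exp (-gap E * r)) := by positivity
    have h8 := mul_le_mul_of_nonneg_right E.hp1.le h7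
    push_cast
    rw [pow_succ]
    nlinarith

def shC (y : ℤ) : C(Config, Config) := ⟨shift y, shift_cont y⟩

theorem WINOW (E : EastProcess) (hgap : 0 < gap E) (g : CC) {S : Finset ℤ}
    (hgS : DependsOnF g S) (L J R : ℕ) (hL : 1 ≤ L) (hR : L ≤ R)
    (hg : DependsOnF g (Set.Ici (L : ℤ))) (hg1 : ∀ ω, |g ω| ≤ 1)
    (hga : AA E.p L g = 0) (ω : Config) (hω : ω ∈ LO) :
    |EP E R (fun η => g (θL 0 η)) ω| ≤ 8 * R * (bet E L J + R / (J + 1).factorial) + (1 / 2 : ℝ) ^ L + E.p ^ L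
      + L * (kap E ^ L * Real.exp (-gap E * R)) := by
  have hk := (kap_facts E).1
  have hβ : 0 ≤ bet E L J := by unfold bet; positivity
  have hs := front_spec hω
  set X := front ω with hX
  set W := Finset.Icc (X - (8 * R : ℕ)) (X - L - 1) with hW
  have hWc : (W.card : ℝ) ≤ 8 * R := by
    have : W.card ≤ 8 * R := by rw [hW, Int.card_Icc]; push_cast; omega
    exact_mod_cast this
  set gy : ℤ → CC := fun y => pull (shC y) g with hgy
  have hgyapp : ∀ y η, gy y η = g (shift y η) := fun _ _ => rfl
  have hterm : ∀ y ∈ W, |EP E R (fun η => zI y η * gy y η) ω| ≤ bet E L J + R / (J + 1).factorial := by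
    intro y hy
    rw [hW, Finset.mem_Icc] at hy
    refine FIXY E hgap (gy y) (S := S.image (fun x => x + y)) ?_ y L J hL ?_ (fun ζ => hg1 _) ?_ R ω hω (by omega)
    · intro ζ ζ' h
      exact hgS _ _ fun x hx => h (x + y) (by
        rw [Finset.mem_coe, Finset.mem_image]; exact ⟨x, hx, rfl⟩)
    · intro ζ ζ' h
      refine hg _ _ fun x hx => h (x + y) ?_
      have : (L : ℤ) ≤ x := hx
      show y + L ≤ x + y
      omega
    · ext ζ
      have hu : ∀ v, shift y (Function.update ζ (y + L) v) = Function.update (shift y ζ) L v := by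
        intro v
        ext x
        simp only [shift, Function.update_apply]
        by_cases e : x = L
        · rw [if_pos e, if_pos (by omega)]
        · rw [if_neg e, if_neg (by omega)]
      rw [AA_apply, hgyapp, hgyapp, hu, hu, ← AA_apply, hga]
      rfl
  have hzm : ∀ y, Measurable fun η => zI y η * gy y η := fun y => (zI_meas y).mul (gy y).continuous.measurable
  have hz1 : ∀ y η, |zI y η * gy y η| ≤ 1 := fun y η => by
    rw [abs_mul]
    exact mul_le_one₀ (zI_abs y η) (abs_nonneg _) (hg1 _)
  have hgm : Measurable fun η => g (θL 0 η) := g.continuous.measurable.comp θ_meas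
  set f : Config → ℝ := fun η => g (θL 0 η) - ∑ y ∈ W, zI y η * gy y η with hf
  have hfm : Measurable f := hgm.sub (Finset.measurable_sum _ fun y _ => hzm y)
  have hfb : ∀ η, |f η| ≤ 1 + W.card := by
    intro η
    refine (abs_sub _ _).trans (add_le_add (hg1 _) ?_)
    refine (Finset.abs_sum_le_sum_abs _ _).trans ((Finset.sum_le_sum fun y _ => hz1 y η).trans ?_)
    simp
  set A : Set Config := {η : Config | ∃ z ≤ X - (8 * R : ℕ), η z = false} with hA
  set B : Set Config := {η : Config | ∀ z ∈ Finset.Ico (X - L - L) (X - L), η z = true} with hB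
  have hBm : MeasurableSet B := by
    have : B = ⋂ z ∈ Finset.Ico (X - L - L) (X - L), {η : Config | η z = true} := by
      ext η; rw [hB]; simp
    rw [this]
    exact Finset.measurableSet_biInter _ fun z _ => coord_meas z true
  have hAm : MeasurableSet A := exset_meas _
  have hfle : ∀ η ∈ LO, |f η| ≤ 0 + (A ∪ B).indicator (fun _ => 1) η := by
    intro η hη
    rw [zero_add]
    by_cases hin : front η ∈ W
    · have : f η = 0 := by
        rw [hf]
        simp only
        rw [Finset.sum_eq_single (front η)]
        · rw [zI_pos (isZ_front hη), one_mul, hgyapp, θ_eq hη, sub_self]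
        · intro y _ hne
          rw [zI_neg, zero_mul]
          rw [isZ_iff hη]; exact Ne.symm hne
        · intro h; exact absurd hin h
      rw [this, abs_zero]
      exact Set.indicator_nonneg (fun _ _ => zero_le_one) _
    · have : f η = g (θL 0 η) := by
        rw [hf]
        simp only
        rw [Finset.sum_eq_zero, sub_zero]
        intro y hy
        rw [zI_neg, zero_mul]
        rw [isZ_iff hη]; rintro rfl; exact hin hy
      rw [this, Set.indicator_of_mem]
      · exact hg1 _
      · rw [hW, Finset.mem_Icc] at hin
        by_cases h1 : front η ≤ X - (8 * R : ℕ)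
        · left; exact (front_le_iff hη _).mp h1
        · right
          have h2 : X - L ≤ front η := by omega
          intro z hz
          exact (le_front_iff hη _).mp h2 z (Finset.mem_Ico.mp hz).2
  have hmain := EP_abs_LO2 E (t := R) (Nat.cast_nonneg R) hω hfm hfb (hAm.union hBm) hfle
  have hPA : (E.P R ω).real A ≤ (1 / 2 : ℝ) ^ L := by
    refine (left_bound E X ω hs.2 (8 * R) (Nat.cast_nonneg R)).trans ?_
    refine (pow_fact_half (Nat.cast_nonneg R) (8 * R) (by push_cast; linarith)).trans ?_
    exact pow_le_pow_of_le_one (by norm_num) (by norm_num) (by omega)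
  have hPB : (E.P R ω).real B ≤ E.p ^ L + L * (kap E ^ L * Real.exp (-gap E * R)) := by
    have h := BLOCK E hgap (X - L) L ω (by rw [sub_add_cancel]; exact hs.1) (r := R) (Nat.cast_nonneg R) L le_rfl
    rw [← EP_ind E R hBm]
    refine le_trans (le_of_eq ?_) h
    congr 1
    ext η
    classical
    rw [onC_apply, Set.indicator_apply]
    rfl
  have hU := measureReal_union_le (μ := E.P R ω) A B
  have hsplit : EP E R (fun η => g (θL 0 η)) ω = EP E R f ω + ∑ y ∈ W, EP E R (fun η => zI y η * gy y η) ω := by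
    have h1 : EP E R f ω = EP E R (fun η => g (θL 0 η)) ω - ∑ y ∈ W, EP E R (fun η => zI y η * gy y η) ω := by
      unfold EP
      rw [hf, integral_sub (bdd_int _ hgm fun _ => hg1 _) (integrable_finsetSum _ fun y _ => bdd_int _ (hzm y) (hz1 y)),
        integral_finsetSum _ fun y _ => bdd_int _ (hzm y) (hz1 y)]
    rw [h1]; ring
  have hsum : |∑ y ∈ W, EP E R (fun η => zI y η * gy y η) ω| ≤ 8 * R * (bet E L J + R / (J + 1).factorial) := by
    refine (Finset.abs_sum_le_sum_abs _ _).trans ((Finset.sum_le_sum hterm).trans ?_)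
    rw [Finset.sum_const, nsmul_eq_mul]
    exact mul_le_mul_of_nonneg_right hWc (by positivity)
  rw [hsplit]
  refine (abs_add_le _ _).trans ?_
  linarith

theorem WIN (E : EastProcess) (hgap : 0 < gap E) : ∃ (K : ℕ) (et : ℕ → ℝ), 1 ≤ K ∧ Summable et ∧ (∀ n, 0 ≤ et n) ∧
    ∀ (L : ℕ), 1 ≤ L → ∀ (g : CC) (S : Finset ℤ), DependsOnF g S → DependsOnF g (Set.Ici (L : ℤ)) →
      (∀ ω, |g ω| ≤ 1) → AA E.p L g = 0 → ∀ ω ∈ LO, |EP E ((K * L : ℕ) : ℝ) (fun η => g (θL 0 η)) ω| ≤ et L := by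
  have hk := (kap_facts E).1
  have hk0 : 0 < kap E := by linarith
  have hp0 := E.hp0
  have hp1 := E.hp1
  obtain ⟨lam, hlam⟩ : ∃ lam : ℕ, kap E ≤ Real.exp (lam * (gap E / 8)) := by
    obtain ⟨n, hn⟩ := exists_nat_ge (kap E / (gap E / 8))
    refine ⟨n, ?_⟩
    rw [div_le_iff₀ (by positivity)] at hn
    linarith [Real.add_one_le_exp ((n : ℝ) * (gap E / 8))]
  obtain ⟨K, hK1, hK⟩ : ∃ K : ℕ, 1 ≤ K ∧ kap E * Real.exp (-gap E * K) ≤ 1 / 2 := by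
    obtain ⟨n, hn⟩ := exists_nat_ge (2 * kap E / gap E)
    refine ⟨n + 1, by omega, ?_⟩
    rw [div_le_iff₀ hgap] at hn
    have h1 := Real.add_one_le_exp (gap E * (n + 1 : ℕ))
    have h2 : 2 * kap E ≤ Real.exp (gap E * (n + 1 : ℕ)) := by
      push_cast at h1 ⊢
      nlinarith
    rw [neg_mul, Real.exp_neg, ← div_eq_mul_inv, div_le_iff₀ (Real.exp_pos _)]
    linarith
  set lam' := lam + 1
  have hlam' : kap E ≤ Real.exp (lam' * (gap E / 8)) := by
    refine hlam.trans (Real.exp_le_exp.mpr (mul_le_mul_of_nonneg_right ?_ (by positivity)))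
    simp [lam']
  set rho : ℝ := max (1 / 2) (max E.p (Real.exp (-gap E / 16))) with hrho
  have hr1 : 1 / 2 ≤ rho := le_max_left _ _
  have hr2 : E.p ≤ rho := (le_max_left _ _).trans (le_max_right _ _)
  have hr3 : Real.exp (-gap E / 16) ≤ rho := (le_max_right _ _).trans (le_max_right _ _)
  have hr0 : 0 < rho := by linarith
  have hrlt : rho < 1 := by
    refine max_lt (by norm_num) (max_lt hp1 ?_)
    rw [Real.exp_lt_one_iff]
    linarith
  set C : ℝ := Real.exp (2 ^ lam') with hC
  have hC0 : 0 < C := Real.exp_pos _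
  have hn : ‖rho‖ < 1 := by rw [Real.norm_of_nonneg hr0.le]; exact hrlt
  refine ⟨K, fun L => 8 * K * (1 + kap E) * ((L : ℝ) ^ 1 * rho ^ L) + 8 * K * (1 + K * C) * ((L : ℝ) ^ 2 * rho ^ L)
    + 2 * ((L : ℝ) ^ 0 * rho ^ L) + (L : ℝ) ^ 1 * rho ^ L, hK1, ?_, fun n => by positivity, ?_⟩
  · have h1 := summable_pow_mul_geometric_of_norm_lt_one (R := ℝ) 1 hn
    have h2 := summable_pow_mul_geometric_of_norm_lt_one (R := ℝ) 2 hn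
    have h0 := summable_pow_mul_geometric_of_norm_lt_one (R := ℝ) 0 hn
    exact (((h1.mul_left _).add (h2.mul_left _)).add (h0.mul_left _)).add h1
  intro L hL g S hgS hg hg1 hga ω hω
  set J := L / lam' with hJ
  have hJ1 : lam' * J ≤ L := Nat.mul_div_le _ _
  have hJ2 : L ≤ lam' * (J + 1) := by
    have := Nat.div_add_mod L lam'
    have h2 := Nat.mod_lt L (Nat.succ_pos lam)
    rw [mul_add, mul_one]
    change L % lam' < lam' at h2
    rw [← hJ] at this
    omega
  have hmain := WINOW E hgap g hgS L J (K * L) hL (Nat.le_mul_of_pos_left _ hK1) hg hg1 hga ω hω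
  have hhalf : (1 / 2 : ℝ) ^ L ≤ rho ^ L := pow_le_pow_left₀ (by norm_num) hr1 _
  have hpp : E.p ^ L ≤ rho ^ L := pow_le_pow_left₀ hp0.le hr2 _
  have hb : Real.sqrt (kap E ^ (J + 1)) * Real.exp (-gap E * (L / 8)) ≤ kap E * rho ^ L := by
    have h1 : kap E ^ J ≤ Real.exp (L * (gap E / 8)) := by
      refine (pow_le_pow_left₀ hk0.le hlam' J).trans ?_
      rw [← Real.exp_nat_mul, Real.exp_le_exp, ← mul_assoc]
      refine mul_le_mul_of_nonneg_right ?_ (by positivity)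
      rw [mul_comm]
      exact_mod_cast hJ1
    have h2 : Real.sqrt (kap E ^ (J + 1)) ≤ kap E * Real.exp (L * (gap E / 16)) := by
      rw [Real.sqrt_le_left (by positivity), mul_pow, ← Real.exp_nat_mul]
      have e : ((2 : ℕ) : ℝ) * (L * (gap E / 16)) = L * (gap E / 8) := by push_cast; ring
      rw [e, pow_succ]
      have h3 := Real.exp_pos (L * (gap E / 8))
      calc kap E ^ J * kap E ≤ Real.exp (L * (gap E / 8)) * kap E := mul_le_mul_of_nonneg_right h1 hk0.le
        _ ≤ kap E ^ 2 * Real.exp (L * (gap E / 8)) := by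
            rw [mul_comm]
            refine mul_le_mul_of_nonneg_right ?_ h3.le
            nlinarith
    refine (mul_le_mul_of_nonneg_right h2 (Real.exp_pos _).le).trans ?_
    rw [mul_assoc, ← Real.exp_add]
    refine mul_le_mul_of_nonneg_left ?_ hk0.le
    refine le_trans (le_of_eq ?_) (pow_le_pow_left₀ (Real.exp_pos _).le hr3 L)
    rw [← Real.exp_nat_mul]
    congr 1
    ring
  have hf : 1 / ((J + 1).factorial : ℝ) ≤ C * rho ^ L := by
    have h1 := Real.pow_div_factorial_le_exp (2 ^ lam') (by positivity) (J + 1)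
    rw [← pow_mul] at h1
    have h2 : (2 : ℝ) ^ L ≤ 2 ^ (lam' * (J + 1)) := pow_le_pow_right₀ (by norm_num) hJ2
    have h3 : (2 : ℝ) ^ L / (J + 1).factorial ≤ C := by
      refine le_trans ?_ h1
      gcongr
    have h4 : 1 / ((J + 1).factorial : ℝ) = (2 : ℝ) ^ L / (J + 1).factorial * (1 / 2) ^ L := by
      rw [one_div_pow]; field_simp
    rw [h4]
    exact mul_le_mul h3 hhalf (by positivity) hC0.le
  have hlast : kap E ^ L * Real.exp (-gap E * ((K * L : ℕ) : ℝ)) ≤ rho ^ L := by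
    have h1 : kap E ^ L * Real.exp (-gap E * ((K * L : ℕ) : ℝ)) = (kap E * Real.exp (-gap E * K)) ^ L := by
      rw [mul_pow, ← Real.exp_nat_mul]
      congr 2
      push_cast; ring
    rw [h1]
    exact pow_le_pow_left₀ (by positivity) (hK.trans hr1) _
  refine hmain.trans ?_
  have hbet : bet E L J ≤ (1 + L + kap E) * rho ^ L := by
    unfold bet
    have : (L : ℝ) * (1 / 2) ^ L ≤ L * rho ^ L := mul_le_mul_of_nonneg_left hhalf (Nat.cast_nonneg _)
    linarith
  have hsum : bet E L J + ((K * L : ℕ) : ℝ) / (J + 1).factorial ≤ (1 + L + kap E) * rho ^ L + K * L * (C * rho ^ L) := by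
    refine add_le_add hbet ?_
    rw [div_eq_mul_one_div]
    push_cast
    exact mul_le_mul_of_nonneg_left hf (by positivity)
  have h8 := mul_le_mul_of_nonneg_left hsum (show (0 : ℝ) ≤ 8 * ((K * L : ℕ) : ℝ) by positivity)
  have h9 := mul_le_mul_of_nonneg_left hlast (show (0 : ℝ) ≤ (L : ℝ) by positivity)
  have : 8 * ((K * L : ℕ) : ℝ) * ((1 + L + kap E) * rho ^ L + K * L * (C * rho ^ L)) =
     8 * K * (1 + kap E) * ((L : ℝ) ^ 1 * rho ^ L) + 8 * K * (1 + K * C) * ((L : ℝ) ^ 2 * rho ^ L) := by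
    push_cast; ring
  simp only [pow_zero, pow_one, one_mul] at *
  linarith

/-- Expectation of `f` seen from the front at time `t`. -/
def QQ (E : EastProcess) (t : ℝ) (f : CC) (ω : Config) : ℝ := EP E t (fun η => f (θL 0 η)) ω

theorem fθ_meas (f : CC) : Measurable fun η => f (θL 0 η) := f.continuous.measurable.comp θ_meas

theorem fθ_bdd (f : CC) (η : Config) : |f (θL 0 η)| ≤ ‖f‖ := f.norm_coe_le_norm _

theorem fθ_int (f : CC) (ν : Measure Config) [IsFiniteMeasure ν] : Integrable (fun η => f (θL 0 η)) ν :=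
  bdd_int _ (fθ_meas f) (fθ_bdd f)

theorem QQ_addf (E : EastProcess) (t : ℝ) (f g : CC) (ω : Config) : QQ E t (f + g) ω = QQ E t f ω + QQ E t g ω :=
  integral_add (fθ_int f _) (fθ_int g _)

theorem QQ_subf (E : EastProcess) (t : ℝ) (f g : CC) (ω : Config) : QQ E t (f - g) ω = QQ E t f ω - QQ E t g ω :=
  integral_sub (fθ_int f _) (fθ_int g _)

theorem QQ_smul (E : EastProcess) (t : ℝ) (c : ℝ) (f : CC) (ω : Config) : QQ E t (c • f) ω = c * QQ E t f ω :=
  integral_const_mul _ _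

theorem QQ_sum (E : EastProcess) (t : ℝ) {ι : Type*} (s : Finset ι) (f : ι → CC) (ω : Config) :
    QQ E t (∑ i ∈ s, f i) ω = ∑ i ∈ s, QQ E t (f i) ω := by
  classical
  induction s using Finset.induction_on with
  | empty =>
    simp [QQ, EP]
  | insert a s ha ih => rw [Finset.sum_insert ha, Finset.sum_insert ha, QQ_addf, ih]

theorem QQ_mono (E : EastProcess) (t : ℝ) {f g : CC} (h : ∀ ω ∈ LO₀, f ω ≤ g ω) (ω : Config) : QQ E t f ω ≤ QQ E t g ω :=
  integral_mono (fθ_int f _) (fθ_int g _) fun η => h _ (θ_mem η)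

theorem QQ_congr (E : EastProcess) (t : ℝ) {f g : CC} (h : ∀ ω ∈ LO₀, f ω = g ω) (ω : Config) : QQ E t f ω = QQ E t g ω :=
  le_antisymm (QQ_mono E t (fun ω hω => (h ω hω).le) ω) (QQ_mono E t (fun ω hω => (h ω hω).ge) ω)

theorem QQ_const (E : EastProcess) (t : ℝ) (c : ℝ) (ω : Config) : QQ E t (ContinuousMap.const _ c) ω = c := EP_const E t c ω

theorem QQ_abs (E : EastProcess) (t : ℝ) (f : CC) {M : ℝ} (hM : ∀ ω ∈ LO₀, |f ω| ≤ M) (ω : Config) : |QQ E t f ω| ≤ M :=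
  EP_abs E t (fun η => hM _ (θ_mem η)) ω

theorem QQ_le (E : EastProcess) (t : ℝ) (f : CC) {M : ℝ} (hM : ∀ ω ∈ LO₀, f ω ≤ M) (ω : Config) : QQ E t f ω ≤ M := by
  have := QQ_mono E t (g := ContinuousMap.const _ M) hM ω
  rwa [QQ_const] at this

theorem QQ_ge (E : EastProcess) (t : ℝ) (f : CC) {M : ℝ} (hM : ∀ ω ∈ LO₀, M ≤ f ω) (ω : Config) : M ≤ QQ E t f ω := by
  have := QQ_mono E t (f := ContinuousMap.const _ M) hM ω
  rwa [QQ_const] at this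

theorem QQ_meas (E : EastProcess) (t : ℝ) (f : CC) : Measurable (QQ E t f) := EP_meas E t (fθ_meas f)

theorem QQ_bdd (E : EastProcess) (t : ℝ) (f : CC) (ω : Config) : |QQ E t f ω| ≤ ‖f‖ :=
  QQ_abs E t f (fun ω _ => f.norm_coe_le_norm ω) ω

theorem QQ_add (E : EastProcess) {t s : ℝ} (ht : 0 ≤ t) (hs : 0 ≤ s) (f : CC) (ω : Config) :
    QQ E (t + s) f ω = EP E t (QQ E s f) ω := EP_add E ht hs (fθ_meas f) (fθ_bdd f) ω

theorem QQ_θ (E : EastProcess) {t : ℝ} (ht : 0 ≤ t) (f : CC) {ω : Config} (h : ω ∈ LO) :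
    QQ E t f (θL 0 ω) = QQ E t f ω := EP_θ_θ E ht f.continuous.measurable h

/-- monotonicity of bounds in time -/
theorem QQ_abs_later (E : EastProcess) {s t : ℝ} (hs : 0 ≤ s) (hst : s ≤ t) (f : CC) {c : ℝ}
    (h : ∀ ω ∈ LO, |QQ E s f ω| ≤ c) : ∀ ω ∈ LO, |QQ E t f ω| ≤ c := by
  intro ω hω
  have e : t = (t - s) + s := by ring
  rw [e, QQ_add E (by linarith) hs]
  exact EP_abs_LO E (by linarith) hω (QQ_meas E s f) (QQ_bdd E s f) h

theorem MIX (E : EastProcess) (hgap : 0 < gap E) : ∃ (K : ℕ) (tl : ℕ → ℝ), Tendsto tl atTop (𝓝 0) ∧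
    ∀ (L : ℕ), 1 ≤ L → ∀ (m : ℕ) (G : CC), DependsOnF G (Finset.Ico (L : ℤ) (L + m) : Finset ℤ) →
      (∀ ω, |G ω| ≤ 1) → ∀ ω ∈ LO, ∀ s : ℝ, ((K * (L + m) : ℕ) : ℝ) ≤ s → ∀ ζ,
        |QQ E s G ω - Av E.p L m G ζ| ≤ tl L := by
  obtain ⟨K, et, hK, hsum, het, hW⟩ := WIN E hgap
  refine ⟨K, fun L => 2 * ∑' j, et (j + L), ?_, ?_⟩
  · simpa using (tendsto_sum_nat_add et).const_mul 2
  intro L hL m G hG hG1 ω hω s hs ζ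
  have hp0 := E.hp0.le
  have hp1 := E.hp1.le
  have hAb : ∀ j ζ, |Av E.p L j G ζ| ≤ 1 := by
    intro j ζ
    rw [abs_le]
    refine ⟨?_, Av_le hp0 hp1 L j (fun ω => (abs_le.mp (hG1 ω)).2) ζ⟩
    have := Av_le hp0 hp1 L j (f := -G) (S := 1) (fun ω => by have := (abs_le.mp (hG1 ω)).1; simp; linarith) ζ
    rw [map_neg, ContinuousMap.neg_apply] at this
    linarith
  set d : ℕ → CC := fun j => Av E.p L j G - Av E.p L (j + 1) G with hd
  have hdsum : G = (∑ j ∈ Finset.range m, d j) + Av E.p L m G := by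
    rw [hd, Finset.sum_range_sub' (fun j => Av E.p L j G), Av_zero]; abel
  have hconst : ∀ η, Av E.p L m G η = Av E.p L m G ζ := by
    intro η
    set η' : Config := fun x => if (L : ℤ) ≤ x ∧ x < L + m then η x else ζ x
    have a1 : Av E.p L m G η = Av E.p L m G η' := Av_dep' hG L m _ _ fun x hx => by
      rw [Finset.mem_coe, Finset.mem_Ico] at hx
      simp [η', hx]
    have a2 : Av E.p L m G η' = Av E.p L m G ζ := Av_indep E.p G L m _ _ fun x hx => by
      have hx : x < L ∨ (L : ℤ) + m ≤ x := hx
      simp only [η']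
      rw [if_neg (by omega)]
    rw [a1, a2]
  have hdj : ∀ j ∈ Finset.range m, |QQ E s (d j) ω| ≤ 2 * et (j + L) := by
    intro j hj
    rw [Finset.mem_range] at hj
    have hdep : DependsOnF (d j) (Finset.Ico (L : ℤ) (L + m) : Finset ℤ) :=
      (Av_dep' hG L j).subC (Av_dep' hG L (j + 1))
    have hdep2 : DependsOnF (d j) (Set.Ici ((j + L : ℕ) : ℤ)) := by
      intro ζ1 ζ2 h
      have b1 : ∀ i, i = j ∨ i = j + 1 → Av E.p L i G ζ1 = Av E.p L i G ζ2 := by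
        intro i hi
        have hGL : DependsOnF (Av E.p L i G) (Set.Ici (L : ℤ)) :=
          (Av_dep' hG L i).mono fun x hx => (Finset.mem_Ico.mp hx).1
        have c1 : Av E.p L i G ζ1 = Av E.p L i G (fun x => if x < L then ζ2 x else ζ1 x) :=
          hGL _ _ fun x hx => by
            have hx : (L : ℤ) ≤ x := hx
            rw [if_neg (by omega)]
        rw [c1]
        refine Av_indep E.p G L i _ _ fun x hx => ?_
        have hx : x < L ∨ (L : ℤ) + i ≤ x := hx
        by_cases hxL : x < L
        · rw [if_pos hxL]
        · rw [if_neg hxL]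
          refine h x ?_
          show ((j + L : ℕ) : ℤ) ≤ x
          push_cast
          omega
      rw [hd, ContinuousMap.sub_apply, ContinuousMap.sub_apply, b1 j (Or.inl rfl), b1 (j + 1) (Or.inr rfl)]
    have hAA : AA E.p ((j + L : ℕ) : ℤ) (d j) = 0 := by
      rw [hd]
      simp only
      have e : ((j + L : ℕ) : ℤ) = (L : ℤ) + j := by push_cast; ring
      rw [map_sub, Av_succ, e, AA_idem, sub_self]
    have hmain := hW (j + L) (by omega) ((1 / 2 : ℝ) • d j) (Finset.Ico (L : ℤ) (L + m))
      (fun ζ1 ζ2 h => by rw [ContinuousMap.smul_apply, ContinuousMap.smul_apply, hdep _ _ h])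
      (fun ζ1 ζ2 h => by rw [ContinuousMap.smul_apply, ContinuousMap.smul_apply, hdep2 _ _ h])
      (fun ζ1 => by
        rw [ContinuousMap.smul_apply, hd, ContinuousMap.sub_apply, smul_eq_mul, abs_mul]
        have := (abs_sub (Av E.p L j G ζ1) (Av E.p L (j + 1) G ζ1))
        have h1 := hAb j ζ1
        have h2 := hAb (j + 1) ζ1
        rw [abs_of_pos (by norm_num : (0 : ℝ) < 1 / 2)]
        linarith)
      (by rw [map_smul, hAA, smul_zero])
    have h2 := QQ_abs_later E (s := ((K * (j + L) : ℕ) : ℝ)) (t := s) (Nat.cast_nonneg _)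
      (le_trans (by exact_mod_cast Nat.mul_le_mul_left K (by omega)) hs) _ hmain ω hω
    rw [QQ_smul, abs_mul, abs_of_pos (by norm_num : (0 : ℝ) < 1 / 2)] at h2
    linarith
  have h1 : QQ E s G ω = (∑ j ∈ Finset.range m, QQ E s (d j) ω) + Av E.p L m G ζ := by
    conv_lhs => rw [hdsum]
    rw [QQ_addf, QQ_sum]
    congr 1
    have : Av E.p L m G = ContinuousMap.const _ (Av E.p L m G ζ) := by ext η; exact hconst η
    rw [this, QQ_const]; rfl
  rw [h1, add_sub_cancel_right]
  refine (Finset.abs_sum_le_sum_abs _ _).trans ((Finset.sum_le_sum hdj).trans ?_)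
  rw [← Finset.mul_sum]
  refine mul_le_mul_of_nonneg_left ?_ (by norm_num)
  exact ((summable_nat_add_iff L).mpr hsum).sum_le_tsum _ fun j _ => het _

/-- all zeros on `S` -/
def zerF (S : Finset ℤ) (ω : Config) : ℝ := if ∀ z ∈ S, ω z = false then 1 else 0
theorem zerF_dep (S : Finset ℤ) : DependsOnF (zerF S) S := by
  intro ω ω' h
  unfold zerF
  have : (∀ z ∈ S, ω z = false) ↔ (∀ z ∈ S, ω' z = false) :=
    forall₂_congr fun x hx => by rw [h x hx]
  simp only [this]
def zerC (S : Finset ℤ) : CC := cylC (zerF_dep S)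
theorem zerC_apply (S : Finset ℤ) (ω : Config) : zerC S ω = if ∀ z ∈ S, ω z = false then 1 else 0 := rfl
theorem zerC_dep (S : Finset ℤ) : DependsOnF (zerC S) S := zerF_dep S
theorem zN_dep (N : ℕ) (y : ℤ) : DependsOnF (zN N y) (Finset.Icc (y - N) y : Finset ℤ) := zNF_dep N y
theorem zerC_nonneg (S : Finset ℤ) (ω : Config) : 0 ≤ zerC S ω := by
  rw [zerC_apply]; split_ifs <;> norm_num
theorem zN_nonneg (N : ℕ) (y : ℤ) (ω : Config) : 0 ≤ zN N y ω := by
  rw [zN_apply]; split_ifs <;> norm_num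
theorem zerC_le (S : Finset ℤ) (ω : Config) : zerC S ω ≤ 1 := by
  rw [zerC_apply]; split_ifs <;> norm_num

theorem zerC_succ (j L : ℤ) (h : j ≤ L) : zerC (Finset.Icc j L) = zerC (Finset.Icc (j + 1) L) * zerC {j} := by
  ext ω
  rw [ContinuousMap.mul_apply, zerC_apply, zerC_apply, zerC_apply]
  by_cases h1 : ω j = false
  · have : (∀ z ∈ Finset.Icc j L, ω z = false) ↔ (∀ z ∈ Finset.Icc (j + 1) L, ω z = false) := by
      constructor
      · intro h2 z hz
        rw [Finset.mem_Icc] at hz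
        exact h2 z (by rw [Finset.mem_Icc]; omega)
      · intro h2 z hz
        rw [Finset.mem_Icc] at hz
        by_cases e : z = j
        · rw [e]; exact h1
        · exact h2 z (by rw [Finset.mem_Icc]; omega)
    simp only [this]
    simp [h1]
  · rw [if_neg]
    · simp [h1]
    · intro h2
      exact h1 (h2 j (by rw [Finset.mem_Icc]; omega))

theorem DependsOnF.addC {f g : CC} {S : Set ℤ} (hf : DependsOnF f S) (hg : DependsOnF g S) :
    DependsOnF (f + g : CC) S := fun ω ω' h => by
  rw [ContinuousMap.add_apply, ContinuousMap.add_apply, hf ω ω' h, hg ω ω' h]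

theorem DependsOnF.smulC {f : CC} {S : Set ℤ} (hf : DependsOnF f S) (c : ℝ) :
    DependsOnF (c • f : CC) S := fun ω ω' h => by
  rw [ContinuousMap.smul_apply, ContinuousMap.smul_apply, hf ω ω' h]

theorem dep_upd {f : CC} {S : Set ℤ} (hf : DependsOnF f S) {x : ℤ} (hx : x ∉ S) (ω : Config) (v : Bool) :
    f (Function.update ω x v) = f ω := hf _ _ fun y hy => by
  rw [Function.update_of_ne]; rintro rfl; exact hx hy

theorem AA_nonneg {p : ℝ} (hp0 : 0 ≤ p) (hp1 : p ≤ 1) (x : ℤ) {f : CC} (hf : ∀ ω, 0 ≤ f ω) (ω : Config) :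
    0 ≤ AA p x f ω := by
  rw [AA_apply]
  have := mul_nonneg hp0 (hf (Function.update ω x true))
  have := mul_nonneg (sub_nonneg.mpr hp1) (hf (Function.update ω x false))
  linarith

theorem gen_low {p : ℝ} (hp0 : 0 ≤ p) (hp1 : p ≤ 1) (L n N : ℕ) (j : ℤ) (hj1 : 1 ≤ j) (hjL : j ≤ L) (hn : L + 1 ≤ n)
    (φ : CC) (hφ : ∀ ω, 0 ≤ φ ω) (hφd : DependsOnF φ (Finset.Icc (L + 2 : ℤ) (n + 1) : Finset ℤ)) (s : ℝ) (hs : 0 ≤ s)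
    (ζ : Config) (Z B : CC) (hZ : Z = zN N 0 * zerC (Finset.Icc (j + 1) (L + 1)))
    (hB : B = Z * zerC {j} + ((1 - p) * s) • Z) :
    Z ζ * φ ζ * ((1 - p) - zerC {j} ζ) + B ζ * gen p (Finset.Icc (L + 2 : ℤ) n) φ ζ - (L + 4) * (B ζ * φ ζ)
      ≤ gen p (Finset.Icc (-(N : ℤ)) (n + 1)) (B * φ) ζ := by
  have hq : 0 ≤ 1 - p := by linarith
  have hZ0 : ∀ ω, 0 ≤ Z ω := fun ω => by
    rw [hZ, ContinuousMap.mul_apply]; exact mul_nonneg (zN_nonneg _ _ _) (zerC_nonneg _ _)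
  have hBa : ∀ ω, B ω = Z ω * (zerC {j} ω + (1 - p) * s) := fun ω => by
    rw [hB, ContinuousMap.add_apply, ContinuousMap.mul_apply, ContinuousMap.smul_apply, smul_eq_mul]; ring
  have hB0 : ∀ ω, 0 ≤ B ω := fun ω => by
    rw [hBa]; exact mul_nonneg (hZ0 _) (add_nonneg (zerC_nonneg _ _) (mul_nonneg hq hs))
  have hf0 : ∀ ω, 0 ≤ (B * φ) ω := fun ω => by
    rw [ContinuousMap.mul_apply]; exact mul_nonneg (hB0 ω) (hφ ω)
  have hZd : DependsOnF Z (Set.Icc (-(N : ℤ)) 0 ∪ Set.Icc (j + 1) (L + 1)) := by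
    rw [hZ]
    refine DependsOnF.mulC ((zN_dep N 0).mono ?_) ((zerC_dep _).mono ?_)
    · intro x hx
      rw [Finset.mem_coe, Finset.mem_Icc] at hx
      left; constructor <;> omega
    · intro x hx
      rw [Finset.mem_coe, Finset.mem_Icc] at hx
      right; constructor <;> omega
  have had : DependsOnF (zerC {j}) (Set.Iic (L + 1 : ℤ)) := (zerC_dep _).mono fun x hx => by
    rw [Finset.mem_coe, Finset.mem_singleton] at hx
    show x ≤ L + 1
    omega
  have hBd : DependsOnF B (Set.Iic (L + 1 : ℤ)) := by
    have hZ' : DependsOnF Z (Set.Iic (L + 1 : ℤ)) := hZd.mono (by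
      rintro x (⟨_, hx⟩ | ⟨_, hx⟩)
      · show x ≤ L + 1
        omega
      · exact hx)
    rw [hB]
    exact (hZ'.mulC had).addC (hZ'.smulC _)
  set T : Finset ℤ := insert (n + 1 : ℤ) (Finset.Icc (-1) (L + 1 : ℤ)) with hT
  have hTc : (T.card : ℝ) ≤ L + 4 := by
    have h1 : T.card ≤ L + 4 := by
      refine (Finset.card_insert_le _ _).trans ?_
      rw [Int.card_Icc]
      omega
    exact_mod_cast h1
  set V : Finset ℤ := Finset.Icc (L + 2 : ℤ) n with hV
  set S : Finset ℤ := Finset.Icc (-(N : ℤ)) (n + 1) with hS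
  have hterm : ∀ x ∈ S, (if x = j then Z ζ * φ ζ * ((1 - p) - zerC {j} ζ) else 0)
      + (if x ∈ V then B ζ * (kk x ζ * (AA p x φ ζ - φ ζ)) else 0) + (if x ∈ T then -(B ζ * φ ζ) else 0)
      ≤ kk x ζ * (AA p x (B * φ) ζ - (B * φ) ζ) := by
    intro x hx
    rw [hS, Finset.mem_Icc] at hx
    have hk0 := kk_nonneg x ζ
    have hk1 := kk_le_one x ζ
    have hAA := AA_nonneg hp0 hp1 x hf0 ζ
    have hfζ := hf0 ζ
    have hgen : -(B ζ * φ ζ) ≤ kk x ζ * (AA p x (B * φ) ζ - (B * φ) ζ) := by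
      rw [ContinuousMap.mul_apply] at *
      nlinarith [mul_nonneg hk0 hAA, mul_le_mul_of_nonneg_right hk1 hfζ]
    by_cases hxj : x = j
    · subst hxj
      have hxV : x ∉ V := by rw [hV, Finset.mem_Icc]; omega
      have hxT : x ∈ T := by rw [hT, Finset.mem_insert, Finset.mem_Icc]; omega
      rw [if_pos rfl, if_neg hxV, if_pos hxT]
      by_cases hz : Z ζ = 0
      · have hBz : B ζ = 0 := by rw [hBa, hz, zero_mul]
        rw [hz]
        rw [hBz] at hgen ⊢
        linarith
      · have hk : kk x ζ = 1 := by
          rw [kk_apply, if_pos]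
          rw [hZ, ContinuousMap.mul_apply, zerC_apply] at hz
          by_contra hne
          apply hz
          rw [if_neg, mul_zero]
          intro hall
          exact hne (hall (x + 1) (by rw [Finset.mem_Icc]; omega))
        have hZu : ∀ v, Z (Function.update ζ x v) = Z ζ := dep_upd hZd (by
          rintro (⟨_, h2⟩ | ⟨h2, _⟩) <;> omega) ζ
        have hφu : ∀ v, φ (Function.update ζ x v) = φ ζ := dep_upd hφd (by
          rw [Finset.mem_coe, Finset.mem_Icc]; omega) ζ
        have ha1 : zerC {x} (Function.update ζ x true) = 0 := by rw [zerC_apply]; simp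
        have ha0 : zerC {x} (Function.update ζ x false) = 1 := by rw [zerC_apply]; simp
        have e : AA p x (B * φ) ζ = Z ζ * φ ζ * ((1 - p) + (1 - p) * s) := by
          rw [AA_apply, ContinuousMap.mul_apply, ContinuousMap.mul_apply, hBa, hBa, hZu, hZu, hφu, hφu, ha1, ha0]
          ring
        rw [hk, e, ContinuousMap.mul_apply]
        have h1 := mul_nonneg (hB0 ζ) (hφ ζ)
        rw [hBa] at h1 ⊢
        nlinarith
    · rw [if_neg hxj]
      by_cases hxV : x ∈ V
      · have hxT : x ∉ T := by
          rw [hV, Finset.mem_Icc] at hxV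
          rw [hT, Finset.mem_insert, Finset.mem_Icc]; omega
        rw [if_pos hxV, if_neg hxT]
        have hBu : ∀ v, B (Function.update ζ x v) = B ζ := dep_upd hBd (by
          rw [hV, Finset.mem_Icc] at hxV
          intro h2
          have h2 : x ≤ L + 1 := h2
          omega) ζ
        apply le_of_eq
        rw [AA_apply, AA_apply]
        simp only [ContinuousMap.mul_apply, hBu]
        ring
      · rw [if_neg hxV]
        by_cases hxT : x ∈ T
        · rw [if_pos hxT]; linarith
        · rw [if_neg hxT]
          have hx2 : x ≤ -2 := by
            rw [hV, Finset.mem_Icc] at hxV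
            rw [hT, Finset.mem_insert, Finset.mem_Icc] at hxT
            omega
          by_cases hz : Z ζ = 0
          · have hBz : (B * φ) ζ = 0 := by rw [ContinuousMap.mul_apply, hBa, hz, zero_mul, zero_mul]
            rw [hBz]
            simpa using mul_nonneg hk0 hAA
          · have hk : kk x ζ = 0 := by
              rw [kk_apply, if_neg]
              rw [hZ, ContinuousMap.mul_apply, zN_apply] at hz
              intro hne
              apply hz
              rw [if_neg, zero_mul]
              rintro ⟨_, hall⟩
              have := hall (x + 1) (by rw [Finset.mem_Ico]; omega)
              rw [hne] at this
              exact absurd this (by decide)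
            rw [hk]; simp
  rw [gen_apply p S]
  refine le_trans ?_ (Finset.sum_le_sum hterm)
  rw [Finset.sum_add_distrib, Finset.sum_add_distrib, Finset.sum_ite_eq' S j, if_pos (by rw [hS, Finset.mem_Icc]; omega),
    Finset.sum_ite_mem, Finset.sum_ite_mem]
  have e1 : S ∩ V = V := Finset.inter_eq_right.mpr fun x hx => by
    rw [hV, Finset.mem_Icc] at hx
    rw [hS, Finset.mem_Icc]; omega
  rw [e1, ← Finset.mul_sum, ← gen_apply, Finset.sum_const, nsmul_eq_mul]
  have h3 : ((S ∩ T).card : ℝ) ≤ L + 4 :=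
    le_trans (by exact_mod_cast Finset.card_le_card Finset.inter_subset_right) hTc
  have h4 := mul_le_mul_of_nonneg_right h3 (mul_nonneg (hB0 ζ) (hφ ζ))
  linarith

theorem STEP (E : EastProcess) (L n N : ℕ) (j : ℤ) (hj1 : 1 ≤ j) (hjL : j ≤ L) (hn : L + 1 ≤ n)
    (φ : CC) (hφ : ∀ ω, 0 ≤ φ ω) (hφd : DependsOnF φ (Finset.Icc (L + 2 : ℤ) (n + 1) : Finset ℤ)) (ζ : Config) :
    (Real.exp (-(L + 5 : ℝ)) * (1 - E.p)) * ((zN N 0 * zerC (Finset.Icc (j + 1) (L + 1))) ζ * TT E.p (Finset.Icc (L + 2 : ℤ) n) 1 φ ζ)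
      ≤ EP E 1 (zN N 0 * zerC (Finset.Icc j (L + 1)) * φ : CC) ζ := by
  have hp0 := E.hp0.le
  have hp1 := E.hp1.le
  have hq : 0 ≤ 1 - E.p := by linarith
  set V : Finset ℤ := Finset.Icc (L + 2 : ℤ) n with hV
  set S : Finset ℤ := Finset.Icc (-(N : ℤ)) (n + 1) with hS
  set Z : CC := zN N 0 * zerC (Finset.Icc (j + 1) (L + 1)) with hZ
  set a : CC := zerC {j} with ha
  set q := 1 - E.p with hqd
  set c : ℝ := L + 5 with hc
  set B : ℝ → CC := fun s => Z * a + (q * s) • Z with hB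
  set u : ℝ → CC := fun s => Real.exp (-c * s) • (B s * TT E.p V s φ) with hu
  set u' : ℝ → CC := fun s => Real.exp (-c * s) • (B s * gen E.p V (TT E.p V s φ) + (q • Z) * TT E.p V s φ)
    + (Real.exp (-c * s) * (-c)) • (B s * TT E.p V s φ) with hu'
  have hTd : ∀ s, DependsOnF (TT E.p V s φ) (Finset.Icc (L + 2 : ℤ) (n + 1) : Finset ℤ) := fun s =>
    TT_dep hφd (fun x hx _ => by
      rw [hV, Finset.mem_Icc] at hx
      rw [Finset.mem_coe, Finset.mem_Icc]; omega) s
  have hZd : DependsOnF Z (S : Set ℤ) := by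
    refine DependsOnF.mulC ((zN_dep N 0).mono ?_) ((zerC_dep _).mono ?_) <;> intro x hx <;>
      rw [Finset.mem_coe, Finset.mem_Icc] at hx <;> rw [Finset.mem_coe, hS, Finset.mem_Icc] <;> omega
  have had : DependsOnF a (S : Set ℤ) := (zerC_dep _).mono (by
    intro x hx
    rw [Finset.mem_coe, Finset.mem_singleton] at hx
    rw [Finset.mem_coe, hS, Finset.mem_Icc]; omega)
  have hder : ∀ s, HasDerivAt u (u' s) s := by
    intro s
    have h1 : HasDerivAt (fun s : ℝ => Real.exp (-c * s)) (Real.exp (-c * s) * (-c)) s := by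
      have := ((hasDerivAt_id s).const_mul (-c)).exp
      simpa using this
    have h2 : HasDerivAt B (q • Z) s := by
      have h3 : HasDerivAt (fun s : ℝ => q * s) q s := by simpa using (hasDerivAt_id s).const_mul q
      exact (h3.smul_const Z).const_add _
    have h4 := h2.mul (TT_hasDerivAt E.p V φ s)
    have h5 := h1.smul h4
    refine h5.congr_deriv ?_
    rw [hu']
    simp only [add_comm]
    rfl
  have hmain := subsol E S u u' ?_ hder (t := 1) (ε := 0) zero_le_one ?_ ζ
  · have e0 : u 0 = zN N 0 * zerC (Finset.Icc j (L + 1)) * φ := by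
      rw [hu, zerC_succ j (L + 1) (by omega)]
      simp only [hB, mul_zero, Real.exp_zero, one_smul, zero_smul, add_zero, TT_zero]
      rw [hZ, ← mul_assoc]; rfl
    rw [e0, zero_mul, add_zero] at hmain
    refine le_trans ?_ hmain
    rw [hu]
    simp only [ContinuousMap.smul_apply, ContinuousMap.mul_apply, hB, ContinuousMap.add_apply, smul_eq_mul, mul_one]
    have hT0 : 0 ≤ TT E.p V 1 φ ζ := TT_ge hp0 hp1 V φ 0 hφ zero_le_one ζ
    have hZ0 : 0 ≤ Z ζ := by
      rw [hZ, ContinuousMap.mul_apply]; exact mul_nonneg (zN_nonneg _ _ _) (zerC_nonneg _ _)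
    rw [mul_assoc]
    refine mul_le_mul_of_nonneg_left ?_ (Real.exp_pos _).le
    have := mul_nonneg (mul_nonneg hZ0 (zerC_nonneg {j} ζ)) hT0
    rw [← ha] at this
    nlinarith
  · intro s
    refine DependsOnF.smulC (DependsOnF.mulC ((hZd.mulC had).addC (hZd.smulC _)) ((hTd s).mono ?_)) _
    intro x hx
    rw [Finset.mem_coe, Finset.mem_Icc] at hx
    rw [Finset.mem_coe, hS, Finset.mem_Icc]; omega
  · intro s hs η
    have hT0 : ∀ ω, 0 ≤ TT E.p V s φ ω := TT_ge hp0 hp1 V φ 0 hφ hs.1.le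
    have hl := gen_low hp0 hp1 L n N j hj1 hjL hn (TT E.p V s φ) hT0 (hTd s) s hs.1.le η Z (B s) hZ rfl
    rw [hu, hu', map_smul]
    simp only [ContinuousMap.smul_apply, ContinuousMap.mul_apply, ContinuousMap.add_apply, smul_eq_mul, add_zero]
    rw [← hV, ← hS, ← ha] at hl
    have hex := (Real.exp_pos (-c * s)).le
    have hZ0 : 0 ≤ Z η := by
      rw [hZ, ContinuousMap.mul_apply]; exact mul_nonneg (zN_nonneg _ _ _) (zerC_nonneg _ _)
    have hBe : B s η = Z η * (a η + q * s) := by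
      rw [hB]
      simp only [ContinuousMap.smul_apply, ContinuousMap.mul_apply, ContinuousMap.add_apply, smul_eq_mul]; ring
    have key : (B s η * gen E.p V (TT E.p V s φ) η + q * Z η * TT E.p V s φ η) + (-c) * (B s η * TT E.p V s φ η)
        ≤ gen E.p S (B s * TT E.p V s φ) η := by
      refine le_trans ?_ hl
      have h1 : 0 ≤ Z η * TT E.p V s φ η * (q * s) := mul_nonneg (mul_nonneg hZ0 (hT0 η)) (mul_nonneg hq hs.1.le)
      rw [hBe, hc]
      nlinarith
    have := mul_le_mul_of_nonneg_left key hex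
    linarith

def epC (E : EastProcess) {t : ℝ} (ht : 0 ≤ t) (f : CC) : CC := ⟨EP E t f, EP_cont E ht f⟩

theorem ITER (E : EastProcess) (L n N : ℕ) (hn : L + 1 ≤ n)
    (φ : CC) (hφ : ∀ ω, 0 ≤ φ ω) (hφd : DependsOnF φ (Finset.Icc (L + 2 : ℤ) (n + 1) : Finset ℤ)) (k : ℕ) (hk : k ≤ L) (ζ : Config) :
    (Real.exp (-(L + 5 : ℝ)) * (1 - E.p)) ^ k * ((zN N 0 * zerC (Finset.Icc (k + 1 : ℤ) (L + 1))) ζ * TT E.p (Finset.Icc (L + 2 : ℤ) n) k φ ζ)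
      ≤ EP E k (zN N 0 * zerC (Finset.Icc 1 (L + 1 : ℤ)) * φ : CC) ζ := by
  have hp0 := E.hp0.le
  have hp1 := E.hp1.le
  induction k generalizing ζ with
  | zero =>
    rw [Nat.cast_zero (R := ℝ), Nat.cast_zero (R := ℤ), EP_zero, pow_zero, one_mul, zero_add, TT_zero]
    rfl
  | succ k ih =>
    set d := Real.exp (-(L + 5 : ℝ)) * (1 - E.p) with hd
    set V := Finset.Icc (L + 2 : ℤ) n with hV
    set F : CC := zN N 0 * zerC (Finset.Icc 1 (L + 1 : ℤ)) * φ with hF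
    have hd0 : 0 ≤ d := mul_nonneg (Real.exp_pos _).le (by linarith)
    have hφk : ∀ ω, 0 ≤ TT E.p V k φ ω := TT_ge hp0 hp1 V φ 0 hφ (Nat.cast_nonneg k)
    have hφkd : DependsOnF (TT E.p V k φ) (Finset.Icc (L + 2 : ℤ) (n + 1) : Finset ℤ) :=
      TT_dep hφd (fun x hx _ => by
        rw [hV, Finset.mem_Icc] at hx
        rw [Finset.mem_coe, Finset.mem_Icc]; omega) _
    have h1 := STEP E L n N (k + 1) (by omega) (by omega) hn _ hφk hφkd ζ
    have e1 : ((k + 1 : ℕ) : ℝ) = 1 + k := by push_cast; ring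
    have h2 : EP E ((k + 1 : ℕ) : ℝ) F ζ = EP E 1 (EP E k F) ζ := by
      rw [e1]
      exact EP_add E zero_le_one (Nat.cast_nonneg k) F.continuous.measurable (fun ω => F.norm_coe_le_norm ω) ζ
    have h3 := EP_mono E 1 (f := d ^ k • (zN N 0 * zerC (Finset.Icc (k + 1 : ℤ) (L + 1)) * TT E.p V k φ))
      (g := epC E (Nat.cast_nonneg k) F) (fun ω => ih (by omega) ω) ζ
    rw [EP_smul] at h3
    rw [h2]
    refine le_trans ?_ h3
    rw [pow_succ, mul_assoc]
    refine mul_le_mul_of_nonneg_left ?_ (pow_nonneg hd0 k)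
    refine le_trans (le_of_eq ?_) h1
    rw [← hd, e1, TT_add]
    push_cast
    rfl

/-- set the sites `1..L+1` to zero -/
def szC (L : ℕ) : C(Config, Config) :=
  ⟨fun ω x => if 1 ≤ x ∧ x ≤ L + 1 then false else ω x, by
    refine continuous_pi fun x => ?_
    by_cases h : 1 ≤ x ∧ x ≤ (L : ℤ) + 1
    · simp only [h, and_self, if_true]; exact continuous_const
    · simp only [h, if_false]; exact continuous_apply x⟩

theorem szC_apply (L : ℕ) (ω : Config) (x : ℤ) : szC L ω x = if 1 ≤ x ∧ x ≤ (L : ℤ) + 1 then false else ω x := rfl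

theorem DOEB (E : EastProcess) (L n : ℕ) (hn : L + 1 ≤ n) (h : CC) (hh : ∀ ω, 0 ≤ h ω)
    (hd : DependsOnF h (Finset.Icc 1 (n + 1 : ℤ) : Finset ℤ)) (ζ : Config) (hζ : ζ ∈ LO₀) :
    (Real.exp (-(L + 5 : ℝ)) * (1 - E.p)) ^ L *
      (zerC {(L + 1 : ℤ)} * TT E.p (Finset.Icc (L + 2 : ℤ) n) L (pull (szC L) h)) ζ ≤ QQ E L h ζ := by
  have hφd : DependsOnF (pull (szC L) h) (Finset.Icc (L + 2 : ℤ) (n + 1) : Finset ℤ) := by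
    intro ω ω' hω
    refine hd _ _ fun x hx => ?_
    rw [Finset.mem_coe, Finset.mem_Icc] at hx
    rw [szC_apply, szC_apply]
    split_ifs with hc
    · rfl
    · exact hω x (by rw [Finset.mem_coe, Finset.mem_Icc]; omega)
  have hZ : isZ 0 ζ := by rw [LO₀_eq] at hζ; exact hζ
  have hlo := isZ_LO hZ
  have h1 : ∀ N, (Real.exp (-(L + 5 : ℝ)) * (1 - E.p)) ^ L *
      (zerC {(L + 1 : ℤ)} * TT E.p (Finset.Icc (L + 2 : ℤ) n) L (pull (szC L) h)) ζ ≤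
      EP E L (zN N 0 * h : CC) ζ := by
    intro N
    refine le_trans (le_trans (le_of_eq ?_) (ITER E L n N hn (pull (szC L) h) (fun ω => hh _) hφd L le_rfl ζ)) ?_
    · have : zN N 0 ζ = 1 := by
        rw [zN_apply, if_pos]
        exact ⟨hZ.1, fun x hx => hZ.2 x (Finset.mem_Ico.mp hx).2⟩
      rw [ContinuousMap.mul_apply, ContinuousMap.mul_apply, this, one_mul, Finset.Icc_self]
    · refine EP_mono E L (fun ω => ?_) ζ
      rw [ContinuousMap.mul_apply, ContinuousMap.mul_apply, ContinuousMap.mul_apply, mul_assoc]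
      refine mul_le_mul_of_nonneg_left ?_ (zN_nonneg _ _ _)
      rw [zerC_apply]
      split_ifs with hc
      · rw [one_mul, pull_apply]
        refine le_of_eq (congrArg h ?_)
        funext x
        rw [szC_apply]
        split_ifs with hx
        · exact (hc x (Finset.mem_Icc.mpr hx)).symm
        · rfl
      · rw [zero_mul]; exact hh ω
  have h2 := ge_of_tendsto' (EP_zI E L 0 h ζ) h1
  refine h2.trans ?_
  refine EP_mono_LO E (Nat.cast_nonneg L) hlo ((zI_meas 0).mul h.continuous.measurable) (fθ_meas h) (M := ‖h‖) ?_ (fθ_bdd h) ?_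
  · intro ω
    rw [abs_mul]
    calc |zI 0 ω| * |h ω| ≤ 1 * ‖h‖ := mul_le_mul (zI_abs 0 ω) (h.norm_coe_le_norm ω) (abs_nonneg _) zero_le_one
      _ = ‖h‖ := one_mul _
  · intro η hη
    by_cases hz : isZ 0 η
    · rw [zI_pos hz, one_mul, θ_id]
      rw [LO₀_eq]; exact hz
    · rw [zI_neg hz, zero_mul]; exact hh _

theorem Av_const (p : ℝ) (a : ℤ) (m : ℕ) (c : ℝ) : Av p a m (ContinuousMap.const _ c) = ContinuousMap.const _ c := by
  induction m with
  | zero => rfl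
  | succ m ih =>
    rw [Av_succ, ih]
    ext ω
    rw [AA_apply]
    simp
    try ring

theorem Av_zer (p : ℝ) (a : ℤ) (m : ℕ) : Av p a (m + 1) (zerC {a}) = ContinuousMap.const _ (1 - p) := by
  induction m with
  | zero =>
    rw [Av_succ, Av_zero]
    ext ω
    rw [AA_apply, zerC_apply, zerC_apply]
    simp
    try ring
  | succ m ih =>
    rw [Av_succ, ih]
    ext ω
    rw [AA_apply]
    simp
    try ring

theorem CON (E : EastProcess) (hgap : 0 < gap E) : ∃ δ : ℝ, 0 < δ ∧ ∀ (h : CC) (M : ℕ),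
    DependsOnF h (Finset.Icc 1 (M : ℤ) : Finset ℤ) → (∀ ω, 0 ≤ h ω) → (∀ ω, h ω ≤ 1) →
      ∃ s : ℝ, 0 ≤ s ∧ ∀ ω ∈ LO, ∀ ω' ∈ LO, QQ E s h ω - QQ E s h ω' ≤ 1 - δ := by
  have hp0 := E.hp0.le
  have hp1 := E.hp1.le
  have hq : 0 < 1 - E.p := by linarith [E.hp1]
  obtain ⟨K, tl, htl, hmix⟩ := MIX E hgap
  obtain ⟨L, hL⟩ : ∃ L : ℕ, tl (L + 1) < (1 - E.p) / 4 := by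
    have := (tendsto_order.1 ((tendsto_add_atTop_iff_nat 1).mpr htl)).2 ((1 - E.p) / 4) (by linarith)
    exact this.exists
  set d := (Real.exp (-(L + 5 : ℝ)) * (1 - E.p)) ^ L with hd
  have hd0 : 0 < d := by positivity
  refine ⟨d * ((1 - E.p) / 2), by positivity, ?_⟩
  intro h M hM h0 h1
  set n := M + L + 1 with hn
  have hMn : DependsOnF h (Finset.Icc 1 (n + 1 : ℤ) : Finset ℤ) := hM.mono fun x hx => by
    rw [Finset.mem_coe, Finset.mem_Icc] at *
    push_cast [hn]; omega
  set V := Finset.Icc (L + 2 : ℤ) n with hV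
  set G : CC → CC := fun g => zerC {(L + 1 : ℤ)} * TT E.p V L (pull (szC L) g) with hG
  -- properties of G
  have hGd : ∀ g : CC, DependsOnF g (Finset.Icc 1 (n + 1 : ℤ) : Finset ℤ) →
      DependsOnF (G g) (Finset.Ico ((L + 1 : ℕ) : ℤ) ((L + 1 : ℕ) + (M + 2 : ℕ)) : Finset ℤ) := by
    intro g hg
    refine DependsOnF.mulC ((zerC_dep _).mono fun x hx => ?_) (DependsOnF.mono (TT_dep (S := (Finset.Icc (L + 2 : ℤ) (n + 1) : Finset ℤ)) ?_ ?_ _) fun x hx => ?_)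
    · rw [Finset.mem_coe, Finset.mem_singleton] at hx
      rw [Finset.mem_coe, Finset.mem_Ico]; push_cast; omega
    · intro ω ω' hω
      refine hg _ _ fun x hx => ?_
      rw [Finset.mem_coe, Finset.mem_Icc] at hx
      rw [szC_apply, szC_apply]
      split_ifs with hc
      · rfl
      · exact hω x (by rw [Finset.mem_coe, Finset.mem_Icc]; omega)
    · intro x hx _
      rw [hV, Finset.mem_Icc] at hx
      rw [Finset.mem_coe, Finset.mem_Icc]; omega
    · rw [Finset.mem_coe, Finset.mem_Icc] at hx
      rw [Finset.mem_coe, Finset.mem_Ico]; push_cast [hn] at *; omega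
  have hG1 : ∀ g : CC, (∀ ω, 0 ≤ g ω) → (∀ ω, g ω ≤ 1) → ∀ ω, |G g ω| ≤ 1 := by
    intro g g0 g1 ω
    have a1 := TT_ge hp0 hp1 V (pull (szC L) g) 0 (fun ω => g0 _) (Nat.cast_nonneg L) ω
    have a2 := TT_le hp0 hp1 V (pull (szC L) g) 1 (fun ω => g1 _) (Nat.cast_nonneg L) ω
    rw [hG, ContinuousMap.mul_apply, abs_of_nonneg (mul_nonneg (zerC_nonneg _ _) a1)]
    exact mul_le_one₀ (zerC_le _ _) a1 a2
  have hc0 : ∀ ω, 0 ≤ (1 - h : CC) ω := fun ω => by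
    rw [ContinuousMap.sub_apply]; exact sub_nonneg.mpr (h1 ω)
  have hc1 : ∀ ω, (1 - h : CC) ω ≤ 1 := fun ω => by
    rw [ContinuousMap.sub_apply]; have := h0 ω; simp; linarith
  have hcd : DependsOnF (1 - h : CC) (Finset.Icc 1 (n + 1 : ℤ) : Finset ℤ) := fun ω ω' hω => by
    rw [ContinuousMap.sub_apply, ContinuousMap.sub_apply, hMn ω ω' hω]; rfl
  have hsumG : G h + G (1 - h) = zerC {(L + 1 : ℤ)} := by
    ext ω
    simp only [hG]
    have e : pull (szC L) (1 - h : CC) = 1 - pull (szC L) h := rfl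
    rw [ContinuousMap.add_apply, ContinuousMap.mul_apply, ContinuousMap.mul_apply, e, map_sub, ContinuousMap.sub_apply,
      TT_one hp0 hp1 V (Nat.cast_nonneg L)]
    ring
  set s0 : ℝ := ((K * ((L + 1) + (M + 2)) : ℕ) : ℝ) with hs0
  have hs0' : 0 ≤ s0 := Nat.cast_nonneg _
  set ζ0 : Config := fun _ => true
  have hlow : ∀ g : CC, (∀ ω, 0 ≤ g ω) → (∀ ω, g ω ≤ 1) → DependsOnF g (Finset.Icc 1 (n + 1 : ℤ) : Finset ℤ) →
      ∀ ω ∈ LO, d * (Av E.p ((L + 1 : ℕ) : ℤ) (M + 2) (G g) ζ0 - (1 - E.p) / 4) ≤ QQ E (s0 + L) g ω := by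
    intro g g0 g1 gd ω hω
    have m1 := hmix (L + 1) (by omega) (M + 2) (G g) (hGd g gd) (hG1 g g0 g1) ω hω s0 le_rfl ζ0
    have m2 := (abs_le.mp m1).1
    rw [QQ_add E hs0' (Nat.cast_nonneg L)]
    have m3 : d * QQ E s0 (G g) ω ≤ EP E s0 (QQ E L g) ω := by
      have e : d * QQ E s0 (G g) ω = EP E s0 (fun η => d * G g (θL 0 η)) ω := (integral_const_mul _ _).symm
      rw [e]
      refine EP_mono_LO E hs0' hω ((fθ_meas _).const_mul _) (QQ_meas E L g) (M := d * ‖G g‖) (fun η => ?_) (QQ_bdd E L g) fun η hη => ?_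
      · rw [abs_mul, abs_of_pos hd0]
        exact mul_le_mul_of_nonneg_left (fθ_bdd _ _) hd0.le
      · rw [← QQ_θ E (Nat.cast_nonneg L) g hη]
        exact DOEB E L n (by omega) g g0 gd _ (θ_mem η)
    refine le_trans (mul_le_mul_of_nonneg_left ?_ hd0.le) m3
    linarith
  refine ⟨s0 + L, by positivity, fun ω hω ω' hω' => ?_⟩
  have l1 := hlow (1 - h) hc0 hc1 hcd ω hω
  have l2 := hlow h h0 h1 hMn ω' hω'
  have l3 : QQ E (s0 + L) (1 - h) ω = 1 - QQ E (s0 + L) h ω := by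
    rw [QQ_subf]
    congr 1
    exact QQ_const E (s0 + L) 1 ω
  have l4 : Av E.p ((L + 1 : ℕ) : ℤ) (M + 2) (G h) ζ0 + Av E.p ((L + 1 : ℕ) : ℤ) (M + 2) (G (1 - h)) ζ0 = 1 - E.p := by
    rw [← ContinuousMap.add_apply, ← map_add, hsumG]
    have e : (L + 1 : ℤ) = ((L + 1 : ℕ) : ℤ) := by push_cast; rfl
    rw [e, Av_zer]; rfl
  rw [l3] at l1
  nlinarith

/-- continuous version of `f ∘ θ` looking for the front in `[c, c+k]` -/
def lkC (f : CC) : ℕ → ℤ → CC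
  | 0, c => pull (shC c) f
  | k + 1, c => zerC {c} * pull (shC c) f + (1 - zerC {c}) * lkC f k (c + 1)

theorem lkC_succ (f : CC) (k : ℕ) (c : ℤ) (ω : Config) :
    lkC f (k + 1) c ω = if ω c = false then f (shift c ω) else lkC f k (c + 1) ω := by
  have : lkC f (k + 1) c ω = zerC {c} ω * f (shift c ω) + (1 - zerC {c} ω) * lkC f k (c + 1) ω := rfl
  rw [this, zerC_apply]
  by_cases h : ω c = false
  · simp [h]
  · simp [h]

theorem lkC_abs (f : CC) (k : ℕ) (c : ℤ) (ω : Config) : |lkC f k c ω| ≤ ‖f‖ := by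
  induction k generalizing c with
  | zero => exact f.norm_coe_le_norm _
  | succ k ih =>
    rw [lkC_succ]
    split_ifs
    · exact f.norm_coe_le_norm _
    · exact ih _

theorem lkC_eq (f : CC) (k : ℕ) (c : ℤ) (ω : Config) (h : ω ∈ LO) (h1 : c ≤ front ω) (h2 : front ω ≤ c + k) :
    lkC f k c ω = f (θL 0 ω) := by
  induction k generalizing c with
  | zero =>
    have : c = front ω := by push_cast at h2; omega
    rw [θ_eq h, ← this]; rfl
  | succ k ih =>
    rw [lkC_succ]
    split_ifs with hc
    · have : c = front ω := by
        by_contra hne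
        have := (front_spec h).2 c (by omega)
        rw [hc] at this; exact Bool.noConfusion this
      rw [θ_eq h, ← this]
    · have hne : c ≠ front ω := fun e => hc (by rw [e]; exact (front_spec h).1)
      exact ih (c + 1) (by omega) (by push_cast at h2; omega)

theorem UAPP (E : EastProcess) {t : ℝ} (ht : 0 ≤ t) (f : CC) {ε : ℝ} (hε : 0 < ε) :
    ∃ g : CC, ∀ ω ∈ LO₀, |QQ E t f ω - g ω| ≤ ε := by
  set B := 2 * ‖f‖ + 1 with hB
  have hB0 : 0 < B := by positivity
  obtain ⟨k, hk⟩ : ∃ k : ℕ, t ^ k / (k.factorial : ℝ) < ε / (2 * B) := by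
    have := (tendsto_order.1 (FloorSemiring.tendsto_pow_div_factorial_atTop t)).2 (ε / (2 * B)) (by positivity)
    exact this.exists
  set F := lkC f (2 * k) (-(k : ℤ)) with hF
  refine ⟨epC E ht F, fun ω hω => ?_⟩
  have hZ : isZ 0 ω := by rw [LO₀_eq] at hω; exact hω
  have hlo := isZ_LO hZ
  set A1 : Set Config := {η | ∃ z ≤ (0 : ℤ) - k, η z = false}
  set A2 : Set Config := {η | ∀ z < (0 : ℤ) + k, η z = true}
  have b1 := left_bound E 0 ω hZ.2 k ht
  have b2 := right_bound E 0 ω hZ.1 k ht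
  have hA1 : MeasurableSet A1 := exset_meas _
  have hA2 : MeasurableSet A2 := allone_meas _
  set h : Config → ℝ := fun η => B⁻¹ * (f (θL 0 η) - F η) with hh
  have hm : Measurable h := ((fθ_meas f).sub F.continuous.measurable).const_mul _
  have hb : ∀ η, |h η| ≤ 1 := by
    intro η
    rw [hh]
    simp only
    rw [abs_mul, abs_of_pos (inv_pos.mpr hB0)]
    have e1 : |f (θL 0 η) - F η| ≤ B := by
      have := abs_sub (f (θL 0 η)) (F η)
      have := fθ_bdd f η
      have := lkC_abs f (2 * k) (-(k : ℤ)) η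
      linarith
    calc B⁻¹ * |f (θL 0 η) - F η| ≤ B⁻¹ * B := mul_le_mul_of_nonneg_left e1 (inv_pos.mpr hB0).le
      _ = 1 := inv_mul_cancel₀ hB0.ne'
  have key := EP_abs_LO2 E ht hlo (f := h) hm (M := 1) (c := 0) hb (hA1.union hA2) (fun η hη => by
    classical
    rw [zero_add, Set.indicator_apply]
    split_ifs with hc
    · exact hb η
    · rw [Set.mem_union, not_or] at hc
      have e : F η = f (θL 0 η) := by
        refine lkC_eq f _ _ η hη ?_ ?_
        · by_contra hlt
          exact hc.1 ⟨front η, by omega, (front_spec hη).1⟩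
        · by_contra hlt
          refine hc.2 fun z hz => (front_spec hη).2 z ?_
          push_cast at hlt; omega
      simp only [hh]
      rw [e, sub_self, mul_zero, abs_zero])
  have e2 : EP E t h ω = B⁻¹ * (QQ E t f ω - epC E ht F ω) := by
    have e3 : EP E t h ω = B⁻¹ * EP E t (fun η => f (θL 0 η) - F η) ω := integral_const_mul _ _
    rw [e3]
    congr 1
    exact integral_sub (fθ_int f _) (CC_integrable _ F)
  rw [e2, abs_mul, abs_of_pos (inv_pos.mpr hB0), zero_add] at key
  have u := measureReal_union_le (μ := E.P t ω) A1 A2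
  have : B⁻¹ * |QQ E t f ω - epC E ht F ω| ≤ ε / B := by
    have : ε / B = ε / (2 * B) + ε / (2 * B) := by field_simp; ring
    linarith
  rw [inv_mul_le_iff₀ hB0] at this
  calc _ ≤ _ := this
    _ = ε := by field_simp

/-- truncation -/
def trC (M : ℕ) : C(Config, Config) :=
  ⟨fun ω x => if x < 0 then true else if x = 0 then false else if x ≤ M then ω x else true, by
    refine continuous_pi fun x => ?_
    split_ifs
    · exact continuous_const
    · exact continuous_const
    · exact continuous_apply x
    · exact continuous_const⟩

theorem trC_apply (M : ℕ) (ω : Config) (x : ℤ) :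
    trC M ω x = if x < 0 then true else if x = 0 then false else if x ≤ M then ω x else true := rfl

theorem trC_mem (M : ℕ) (ω : Config) : trC M ω ∈ LO₀ := by
  rw [LO₀_eq]
  exact ⟨rfl, fun x hx => by rw [trC_apply, if_pos hx]⟩

theorem CYLA (g : CC) {ε : ℝ} (hε : 0 < ε) : ∃ M : ℕ, ∀ ω ∈ LO₀, |g ω - g (trC M ω)| ≤ ε := by
  have hu : UniformContinuous g := CompactSpace.uniformContinuous_of_continuous g.continuous
  set tr : Config → Config := fun ω x => if x < 0 then true else if x = 0 then false else ω x with htr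
  have h1 : TendstoUniformly (fun M : ℕ => fun ω => trC M ω) tr atTop := by
    rw [tendstoUniformly_iff_tendsto, Pi.uniformity, tendsto_iInf]
    intro x
    rw [tendsto_comap_iff]
    intro s hs
    rw [mem_map]
    filter_upwards [prod_mem_prod (Ici_mem_atTop x.toNat) (univ_mem (f := (⊤ : Filter Config)))] with q hq
    have hq1 : x.toNat ≤ q.1 := hq.1
    have e : tr q.2 x = trC q.1 q.2 x := by
      rw [trC_apply]
      simp only [htr]
      have : x ≤ (q.1 : ℤ) := by omega
      rw [if_pos this]
    rw [Set.mem_preimage]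
    simp only [Function.comp]
    rw [e]
    exact refl_mem_uniformity hs
  have h2 := hu.comp_tendstoUniformly h1
  rw [Metric.tendstoUniformly_iff] at h2
  obtain ⟨M, hM⟩ := (h2 ε hε).exists
  refine ⟨M, fun ω hω => ?_⟩
  have := hM ω
  have e : tr ω = ω := by
    rw [LO₀_eq] at hω
    funext x
    simp only [htr]
    split_ifs with a b
    · exact (hω.2 x a).symm
    · rw [b]; exact hω.1.symm
    · rfl
  simp only [Function.comp, e] at this
  exact this.le

/-- a bound for the oscillation of `QQ E t f` on `LO` -/
def OSC (E : EastProcess) (t : ℝ) (f : CC) (c : ℝ) : Prop :=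
  ∀ ω ∈ LO, ∀ ω' ∈ LO, QQ E t f ω - QQ E t f ω' ≤ c

def ω00 : Config := fun x => decide (x ≠ 0)

theorem ω00_LO₀ : ω00 ∈ LO₀ := by
  rw [LO₀_eq]
  exact ⟨rfl, fun x hx => decide_eq_true hx.ne⟩

theorem ω00_LO : ω00 ∈ LO := ω00_LO₀.1

theorem OSC_lo {E : EastProcess} {t : ℝ} {f : CC} {c : ℝ} (h : OSC E t f c) :
    ∃ lo : ℝ, ∀ ω ∈ LO, lo ≤ QQ E t f ω ∧ QQ E t f ω ≤ lo + c := by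
  have hne : (QQ E t f '' LO).Nonempty := ⟨_, ω00, ω00_LO, rfl⟩
  have hbd : BddBelow (QQ E t f '' LO) := by
    refine ⟨-‖f‖, ?_⟩
    rintro _ ⟨ω, _, rfl⟩
    exact (abs_le.mp (QQ_bdd E t f ω)).1
  refine ⟨sInf (QQ E t f '' LO), fun ω hω => ⟨csInf_le hbd ⟨ω, hω, rfl⟩, ?_⟩⟩
  have : QQ E t f ω - c ≤ sInf (QQ E t f '' LO) := by
    refine le_csInf hne ?_
    rintro _ ⟨ω', hω', rfl⟩
    linarith [h ω hω ω' hω']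
  linarith

theorem OSC_later {E : EastProcess} {t : ℝ} (ht : 0 ≤ t) {f : CC} {c : ℝ} (h : OSC E t f c) :
    ∀ s, 0 ≤ s → ∀ s', 0 ≤ s' → ∀ ω ∈ LO, ∀ ω' ∈ LO, |QQ E (s + t) f ω - QQ E (s' + t) f ω'| ≤ c := by
  obtain ⟨lo, hlo⟩ := OSC_lo h
  have key : ∀ s, 0 ≤ s → ∀ ω ∈ LO, lo ≤ QQ E (s + t) f ω ∧ QQ E (s + t) f ω ≤ lo + c := by
    intro s hs ω hω
    rw [QQ_add E hs ht]
    exact ⟨EP_ge_LO E hs hω (QQ_meas E t f) (QQ_bdd E t f) fun η hη => (hlo η hη).1,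
      EP_le_LO E hs hω (QQ_meas E t f) (QQ_bdd E t f) fun η hη => (hlo η hη).2⟩
  intro s hs s' hs' ω hω ω' hω'
  have := key s hs ω hω
  have := key s' hs' ω' hω'
  rw [abs_le]; constructor <;> linarith

theorem OSC_step (E : EastProcess) {δ : ℝ} (hδ : 0 < δ) (hδ1 : δ ≤ 1) (hcon : ∀ (h : CC) (M : ℕ),
    DependsOnF h (Finset.Icc 1 (M : ℤ) : Finset ℤ) → (∀ ω, 0 ≤ h ω) → (∀ ω, h ω ≤ 1) →
      ∃ s : ℝ, 0 ≤ s ∧ ∀ ω ∈ LO, ∀ ω' ∈ LO, QQ E s h ω - QQ E s h ω' ≤ 1 - δ)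
    {t : ℝ} (ht : 0 ≤ t) (f : CC) {c : ℝ} (hc : 0 < c) (h : OSC E t f c) :
    ∃ t', 0 ≤ t' ∧ OSC E t' f ((1 - δ / 2) * c) := by
  obtain ⟨lo, hlo⟩ := OSC_lo h
  set ε := δ * c / 24 with hε
  have hε0 : 0 < ε := by positivity
  obtain ⟨g, hg⟩ := UAPP E ht f hε0
  obtain ⟨M, hM⟩ := CYLA g hε0
  set b := c + 2 * ε with hb
  have hb0 : 0 < b := by positivity
  set k : CC := pull (trC M) g with hk
  set kk' : CC := b⁻¹ • (k - ContinuousMap.const _ (lo - ε)) with hkk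
  have hkapp : ∀ ω, kk' ω = b⁻¹ * (g (trC M ω) - (lo - ε)) := fun ω => rfl
  have hgr : ∀ ω, lo - ε ≤ g (trC M ω) ∧ g (trC M ω) ≤ lo + c + ε := by
    intro ω
    have a := abs_le.mp (hg _ (trC_mem M ω))
    have b := hlo _ (trC_mem M ω).1
    constructor <;> linarith
  obtain ⟨s, hs, hsc⟩ := hcon kk' M (by
    intro ω ω' hω
    rw [hkapp, hkapp]
    congr 3
    funext x
    rw [trC_apply, trC_apply]
    split_ifs with h1 h2 h3
    · rfl
    · rfl
    · exact hω x (by rw [Finset.mem_coe, Finset.mem_Icc]; omega)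
    · rfl) (fun ω => by
    rw [hkapp]
    exact mul_nonneg (inv_pos.mpr hb0).le (by linarith [(hgr ω).1])) (fun ω => by
    rw [hkapp, inv_mul_le_iff₀ hb0]
    linarith [(hgr ω).2])
  refine ⟨s + t, by positivity, fun ω hω ω' hω' => ?_⟩
  have hq : ∀ ω, QQ E s kk' ω = b⁻¹ * (QQ E s k ω - (lo - ε)) := by
    intro ω
    rw [hkk, QQ_smul, QQ_subf, QQ_const]
  have happ : ∀ ω ∈ LO, |QQ E (s + t) f ω - QQ E s k ω| ≤ 2 * ε := by
    intro ω hω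
    rw [QQ_add E hs ht]
    have e : EP E s (QQ E t f) ω - QQ E s k ω = EP E s (fun η => QQ E t f η - k (θL 0 η)) ω :=
      (integral_sub (bdd_int _ (QQ_meas E t f) (QQ_bdd E t f)) (fθ_int k _)).symm
    rw [e]
    refine EP_abs_LO E hs hω (M := ‖f‖ + ‖k‖) ((QQ_meas E t f).sub (fθ_meas k)) (fun η => ?_) fun η hη => ?_
    · exact (abs_sub _ _).trans (add_le_add (QQ_bdd E t f η) (fθ_bdd k η))
    · rw [Pi.sub_apply, ← QQ_θ E ht f hη]
      have a1 := abs_le.mp (hg _ (θ_mem η))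
      have a2 := abs_le.mp (hM _ (θ_mem η))
      have e2 : k (θL 0 η) = g (trC M (θL 0 η)) := rfl
      rw [e2, abs_le]
      constructor <;> linarith
  have s1 := hsc ω hω ω' hω'
  rw [hq, hq, ← mul_sub, inv_mul_le_iff₀ hb0] at s1
  have a1 := abs_le.mp (happ ω hω)
  have a2 := abs_le.mp (happ ω' hω')
  have : b * (1 - δ) ≤ (1 - δ) * c + 2 * ε := by
    rw [hb]; nlinarith
  have e3 : (1 - δ / 2) * c = (1 - δ) * c + 12 * ε := by rw [hε]; ring
  rw [e3]
  linarith

theorem OSC_small (E : EastProcess) (hgap : 0 < gap E) (f : CC) {ε : ℝ} (hε : 0 < ε) : ∃ t, 0 ≤ t ∧ OSC E t f ε := by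
  obtain ⟨δ', hδ', hcon'⟩ := CON E hgap
  set δ := min δ' 1 with hδe
  have hδ : 0 < δ := lt_min hδ' one_pos
  have hδ1 : δ ≤ 1 := min_le_right _ _
  have hcon : ∀ (h : CC) (M : ℕ),
    DependsOnF h (Finset.Icc 1 (M : ℤ) : Finset ℤ) → (∀ ω, 0 ≤ h ω) → (∀ ω, h ω ≤ 1) →
      ∃ s : ℝ, 0 ≤ s ∧ ∀ ω ∈ LO, ∀ ω' ∈ LO, QQ E s h ω - QQ E s h ω' ≤ 1 - δ := by
    intro h M a b c
    obtain ⟨s, hs, hh⟩ := hcon' h M a b c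
    exact ⟨s, hs, fun ω hω ω' hω' => (hh ω hω ω' hω').trans (by linarith [min_le_left δ' 1])⟩
  have hit : ∀ n : ℕ, ∃ t, 0 ≤ t ∧ OSC E t f ((1 - δ / 2) ^ n * (2 * ‖f‖ + 1)) := by
    intro n
    induction n with
    | zero =>
      refine ⟨0, le_rfl, fun ω _ ω' _ => ?_⟩
      have a1 := abs_le.mp (QQ_bdd E 0 f ω)
      have a2 := abs_le.mp (QQ_bdd E 0 f ω')
      rw [pow_zero]; linarith
    | succ n ih =>
      obtain ⟨t, ht, h⟩ := ih
      obtain ⟨t', ht', h'⟩ := OSC_step E hδ hδ1 hcon ht f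
        (mul_pos (pow_pos (by linarith) n) (by positivity)) h
      refine ⟨t', ht', ?_⟩
      rw [pow_succ, mul_comm _ (1 - δ / 2), mul_assoc]; exact h'
  have hB0 : 0 < 2 * ‖f‖ + 1 := by positivity
  obtain ⟨n, hn⟩ := exists_pow_lt_of_lt_one (div_pos hε hB0) (show 1 - δ / 2 < 1 by linarith)
  obtain ⟨t, ht, h⟩ := hit n
  refine ⟨t, ht, fun ω hω ω' hω' => (h ω hω ω' hω').trans ?_⟩
  rw [lt_div_iff₀ hB0] at hn
  exact hn.le

theorem LIM (E : EastProcess) (hgap : 0 < gap E) (f : CC) : ∃ l : ℝ, ∀ ε > 0, ∃ T : ℝ, 0 ≤ T ∧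
    ∀ t, T ≤ t → ∀ ω ∈ LO, |QQ E t f ω - l| ≤ ε := by
  have hC : ∀ ε > 0, ∃ T : ℝ, 0 ≤ T ∧ ∀ t, T ≤ t → ∀ t', T ≤ t' → ∀ ω ∈ LO, ∀ ω' ∈ LO,
      |QQ E t f ω - QQ E t' f ω'| ≤ ε := by
    intro ε hε
    obtain ⟨T, hT, h⟩ := OSC_small E hgap f hε
    refine ⟨T, hT, fun t ht t' ht' ω hω ω' hω' => ?_⟩
    have := OSC_later hT h (t - T) (by linarith) (t' - T) (by linarith) ω hω ω' hω'
    rwa [sub_add_cancel, sub_add_cancel] at this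
  have hcau : Cauchy (map (fun t : ℝ => QQ E t f ω00) atTop) := by
    rw [Metric.cauchy_iff]
    refine ⟨inferInstance, fun ε hε => ?_⟩
    obtain ⟨T, hT, h⟩ := hC (ε / 2) (by linarith)
    refine ⟨_, image_mem_map (Ici_mem_atTop T), ?_⟩
    rintro _ ⟨t, ht, rfl⟩ _ ⟨t', ht', rfl⟩
    exact (h t ht t' ht' _ ω00_LO _ ω00_LO).trans_lt (by linarith)
  obtain ⟨l, hl⟩ := CompleteSpace.complete hcau
  refine ⟨l, fun ε hε => ?_⟩
  obtain ⟨T, hT, h⟩ := hC ε hε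
  refine ⟨T, hT, fun t ht ω hω => ?_⟩
  have h1 : Tendsto (fun t' : ℝ => |QQ E t f ω - QQ E t' f ω00|) atTop (𝓝 |QQ E t f ω - l|) :=
    (tendsto_const_nhds.sub hl).abs
  refine le_of_tendsto h1 ?_
  filter_upwards [Ici_mem_atTop T] with t' ht'
  exact h t ht t' ht' ω hω _ ω00_LO

theorem bind_int (E : EastProcess) (t : ℝ) (π : Measure Config) [IsProbabilityMeasure π] {f : Config → ℝ}
    (hf : Measurable f) {M : ℝ} (hM : ∀ ω, |f ω| ≤ M) :
    ∫ ω, f ω ∂(π.bind fun ω => E.P t ω) = ∫ ω, EP E t f ω ∂π := by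
  have e : (π.bind fun ω => E.P t ω) = ((E.P t) ∘ₖ (Kernel.const Unit π)) () := by
    rw [Kernel.comp_apply, Kernel.const_apply]
  rw [e, Kernel.integral_comp, Kernel.const_apply]
  · rfl
  · exact Integrable.of_bound hf.aestronglyMeasurable M (Eventually.of_forall hM)

instance bind_prob (E : EastProcess) (t : ℝ) (π : Measure Config) [IsProbabilityMeasure π] :
    IsProbabilityMeasure (π.bind fun ω => E.P t ω) := by
  have e : (π.bind fun ω => E.P t ω) = ((E.P t) ∘ₖ (Kernel.const Unit π)) () := by
    rw [Kernel.comp_apply, Kernel.const_apply]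
  rw [e]; infer_instance

instance Qt_prob (E : EastProcess) (t : ℝ) (π : Measure Config) [IsProbabilityMeasure π] :
    IsProbabilityMeasure (Qt E t π) :=
  Measure.isProbabilityMeasure_map θ_meas.aemeasurable

theorem Qt_int (E : EastProcess) (t : ℝ) (π : Measure Config) [IsProbabilityMeasure π] (f : CC) :
    ∫ ω, f ω ∂(Qt E t π) = ∫ ω, QQ E t f ω ∂π := by
  unfold Qt
  rw [integral_map θ_meas.aemeasurable f.continuous.aestronglyMeasurable]
  exact bind_int E t π (fθ_meas f) (fθ_bdd f)

theorem APPR (E : EastProcess) {s t : ℝ} (hs : 0 ≤ s) (ht : 0 ≤ t) (f k : CC) {ε : ℝ}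
    (hg : ∀ ω ∈ LO₀, |QQ E t f ω - k ω| ≤ ε) {ω : Config} (hω : ω ∈ LO) :
    |QQ E (s + t) f ω - QQ E s k ω| ≤ ε := by
  rw [QQ_add E hs ht]
  have e : EP E s (QQ E t f) ω - QQ E s k ω = EP E s (fun η => QQ E t f η - k (θL 0 η)) ω :=
    (integral_sub (bdd_int _ (QQ_meas E t f) (QQ_bdd E t f)) (fθ_int k _)).symm
  rw [e]
  refine EP_abs_LO E hs hω (M := ‖f‖ + ‖k‖) ((QQ_meas E t f).sub (fθ_meas k)) (fun η => ?_) fun η hη => ?_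
  · exact (abs_sub _ _).trans (add_le_add (QQ_bdd E t f η) (fθ_bdd k η))
  · rw [Pi.sub_apply, ← QQ_θ E ht f hη]
    exact hg _ (θ_mem η)

theorem ext_CC {μ ν : Measure Config} [IsProbabilityMeasure μ] [IsProbabilityMeasure ν]
    (h : ∀ f : CC, ∫ ω, f ω ∂μ = ∫ ω, f ω ∂ν) : μ = ν :=
  ext_of_forall_integral_eq_of_IsFiniteMeasure fun f => h f.toContinuousMap

/-- the limiting functional gives a measure -/
theorem RMKC (l : CC → ℝ) (hadd : ∀ f g, l (f + g) = l f + l g) (hsm : ∀ (c : ℝ) f, l (c • f) = c * l f)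
    (hpos : ∀ f : CC, (∀ ω, 0 ≤ f ω) → 0 ≤ l f) (hone : l 1 = 1) :
    ∃ ν : Measure Config, IsProbabilityMeasure ν ∧ ∀ f : CC, ∫ ω, f ω ∂ν = l f := by
  let Λ0 : CompactlySupportedContinuousMap Config ℝ →ₗ[ℝ] ℝ :=
    { toFun := fun f => l f.toContinuousMap
      map_add' := fun f g => hadd f.toContinuousMap g.toContinuousMap
      map_smul' := fun c f => hsm c f.toContinuousMap }
  let Λ : CompactlySupportedContinuousMap Config ℝ →ₚ[ℝ] ℝ :=
    PositiveLinearMap.mk₀ Λ0 fun f hf => hpos f.toContinuousMap fun ω => hf ω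
  have hint : ∀ f : CC, ∫ ω, f ω ∂(RealRMK.rieszMeasure Λ) = l f := fun f =>
    RealRMK.integral_rieszMeasure Λ (CompactlySupportedContinuousMap.continuousMapEquiv f)
  refine ⟨RealRMK.rieszMeasure Λ, ⟨?_⟩, hint⟩
  have h1 := hint 1
  rw [hone] at h1
  have h2 : ∫ _ : Config, (1 : ℝ) ∂(RealRMK.rieszMeasure Λ) = 1 := h1
  rw [integral_const, smul_eq_mul, mul_one, Measure.real, ENNReal.toReal_eq_one_iff] at h2
  exact h2

theorem ae_int_close (π : Measure Config) [IsProbabilityMeasure π] (hπ : π LO₀ = 1) {f : Config → ℝ}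
    (hf : Measurable f) {M : ℝ} (hM : ∀ ω, |f ω| ≤ M) {g : Config → ℝ}
    (hg : Measurable g) {M' : ℝ} (hM' : ∀ ω, |g ω| ≤ M') {ε : ℝ} (h : ∀ ω ∈ LO₀, |f ω - g ω| ≤ ε) :
    |∫ ω, f ω ∂π - ∫ ω, g ω ∂π| ≤ ε := by
  rw [← integral_sub (bdd_int π hf hM) (bdd_int π hg hM')]
  have hae : ∀ᵐ ω ∂π, ω ∈ LO₀ := (prob_compl_eq_zero_iff LO₀_meas).mpr hπ
  have := norm_integral_le_of_norm_le_const (μ := π) (f := fun ω => f ω - g ω) (C := ε)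
    (hae.mono fun ω hω => h ω hω)
  simpa using this

/-- **Ergodicity of the process seen from the front** (Theorem 5.1 of the paper):
the process seen from the front has a unique invariant probability measure `ν`
(concentrated on `LO₀`), and for every initial distribution `π` concentrated on `LO₀`
the law at time `t` of the process seen from the front converges weakly to `ν`. -/
theorem ergodicity_seen_from_front (E : EastProcess) (hgap : 0 < gap E) :
    ∃ ν : Measure Config, IsProbabilityMeasure ν ∧ ν LO₀ = 1 ∧
      (∀ t : ℝ, 0 ≤ t → Qt E t ν = ν) ∧
      (∀ ν' : Measure Config, IsProbabilityMeasure ν' → ν' LO₀ = 1 →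
        (∀ t : ℝ, 0 ≤ t → Qt E t ν' = ν') → ν' = ν) ∧
      (∀ π : Measure Config, IsProbabilityMeasure π → π LO₀ = 1 →
        ∀ f : Config → ℝ, Continuous f →
          Tendsto (fun t : ℝ => ∫ ω, f ω ∂(Qt E t π)) atTop (𝓝 (∫ ω, f ω ∂ν))) := by
  choose l hl using LIM E hgap
  have hT : ∀ f, Tendsto (fun t => QQ E t f ω00) atTop (𝓝 (l f)) := by
    intro f
    rw [Metric.tendsto_atTop]
    intro ε hε
    obtain ⟨T, _, h⟩ := hl f (ε / 2) (by linarith)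
    exact ⟨T, fun t ht => (h t ht _ ω00_LO).trans_lt (by linarith)⟩
  have hzero : ∀ f : CC, (∀ ω ∈ LO₀, f ω = 0) → l f = 0 := by
    intro f hf
    refine tendsto_nhds_unique (hT f) ?_
    have : (fun t => QQ E t f ω00) = fun _ => 0 := by
      funext t
      rw [QQ_congr E t (g := ContinuousMap.const _ 0) hf, QQ_const]
    rw [this]; exact tendsto_const_nhds
  obtain ⟨ν, hν, hint⟩ := RMKC l
    (fun f g => tendsto_nhds_unique (hT _) (by simpa only [QQ_addf] using (hT f).add (hT g)))
    (fun c f => tendsto_nhds_unique (hT _) (by simpa only [QQ_smul] using (hT f).const_mul c))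
    (fun f hf => ge_of_tendsto' (hT f) fun t => QQ_ge E t f (fun ω _ => hf ω) _)
    (tendsto_nhds_unique (hT 1) (by
      have : (fun t => QQ E t 1 ω00) = fun _ => 1 := funext fun t => QQ_const E t 1 _
      rw [this]; exact tendsto_const_nhds))
  have hae : ∀ f : CC, (∀ ω, 0 ≤ f ω) → (∀ ω ∈ LO₀, f ω = 0) → ∀ᵐ ω ∂ν, f ω = 0 := by
    intro f h0 h1
    have h2 := hint f
    rw [hzero f h1, integral_eq_zero_iff_of_nonneg h0 (CC_integrable ν f)] at h2
    exact h2
  have hνLO : ν LO₀ = 1 := by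
    rw [← prob_compl_eq_zero_iff LO₀_meas]
    have a1 : ∀ᵐ ω ∂ν, ω 0 = false := by
      refine (hae (1 - zerC {0}) (fun ω => ?_) fun ω hω => ?_).mono fun ω hω => ?_
      · exact sub_nonneg.mpr (zerC_le _ ω)
      · rw [LO₀_eq] at hω
        rw [ContinuousMap.sub_apply, zerC_apply, if_pos]
        · exact sub_self _
        · intro z hz; rw [Finset.mem_singleton.mp hz]; exact hω.1
      · by_contra hc
        rw [ContinuousMap.sub_apply, zerC_apply, if_neg] at hω
        · rw [sub_zero] at hω; exact one_ne_zero hω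
        · intro h; exact hc (h 0 (Finset.mem_singleton_self _))
    have a2 : ∀ᵐ ω ∂ν, ∀ x : ℤ, x < 0 → ω x = true := by
      rw [ae_all_iff]
      intro x
      by_cases hx : x < 0
      · refine (hae (zerC {x}) (zerC_nonneg _) fun ω hω => ?_).mono fun ω hω _ => ?_
        · rw [LO₀_eq] at hω
          rw [zerC_apply, if_neg]
          intro h
          have h' := h x (Finset.mem_singleton_self _)
          rw [hω.2 x hx] at h'
          exact Bool.noConfusion h'
        · by_contra hc
          rw [zerC_apply, if_pos] at hω
          · exact one_ne_zero hω
          · intro z hz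
            rw [Finset.mem_singleton.mp hz]
            exact Bool.eq_false_iff.mpr hc
      · exact Eventually.of_forall fun ω h => absurd h hx
    have a3 : ∀ᵐ ω ∂ν, ω ∈ LO₀ := by
      filter_upwards [a1, a2] with ω h1 h2
      rw [LO₀_eq]; exact ⟨h1, h2⟩
    exact a3
  have hconv : ∀ π : Measure Config, IsProbabilityMeasure π → π LO₀ = 1 → ∀ f : CC,
      Tendsto (fun t : ℝ => ∫ ω, f ω ∂(Qt E t π)) atTop (𝓝 (∫ ω, f ω ∂ν)) := by
    intro π hπ hπ1 f
    rw [hint f, Metric.tendsto_atTop]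
    intro ε hε
    obtain ⟨T, _, h⟩ := hl f (ε / 2) (by linarith)
    refine ⟨T, fun t ht => ?_⟩
    rw [Qt_int]
    have := ae_int_close π hπ1 (QQ_meas E t f) (QQ_bdd E t f) (g := fun _ => l f) measurable_const
      (M' := |l f|) (fun _ => le_rfl) (fun ω hω => h t ht ω hω.1)
    rw [integral_const, probReal_univ, one_smul] at this
    exact this.trans_lt (by linarith)
  refine ⟨ν, hν, hνLO, ?_, ?_, fun π hπ hπ1 f hf => hconv π hπ hπ1 ⟨f, hf⟩⟩
  · intro t ht
    refine ext_CC fun f => ?_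
    rw [Qt_int, hint f]
    refine eq_of_abs_sub_le_all fun ε hε => ?_
    obtain ⟨g, hg⟩ := UAPP E ht f (half_pos hε)
    have b1 := ae_int_close ν hνLO (QQ_meas E t f) (QQ_bdd E t f) g.continuous.measurable
      (fun ω => g.norm_coe_le_norm ω) hg
    rw [hint g] at b1
    have b2 : |l f - l g| ≤ ε / 2 := by
      have c1 : Tendsto (fun s => QQ E (s + t) f ω00) atTop (𝓝 (l f)) :=
        (hT f).comp (tendsto_atTop_add_const_right _ t tendsto_id)
      refine le_of_tendsto (c1.sub (hT g)).abs ?_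
      filter_upwards [Ici_mem_atTop (0 : ℝ)] with s hs
      exact APPR E hs ht f g hg ω00_LO
    rw [abs_le] at *
    constructor <;> linarith
  · intro ν' hν' hν'1 hinv
    refine ext_CC fun f => ?_
    refine tendsto_nhds_unique ?_ (hconv ν' hν' hν'1 f)
    refine tendsto_const_nhds.congr' ?_
    filter_upwards [Ici_mem_atTop (0 : ℝ)] with t ht
    rw [hinv t ht]

end
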